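/- The sequence GR(n, 18, 146)/n² converges, as n → ∞, to 5/12. -/

import Mathlib

/-- `K_n` admits a `(p,q)`-colouring with at most `c` colours: there is a colouring of the
2-element vertex subsets (edges of `K_n`) with colours in `{0, …, c-1}` such that every
`p`-element set of vertices spans edges of at least `q` distinct colours. -/
def HasPQColoring (n p q c : ℕ) : Prop :=
  ∃ col : Finset (Fin n) → ℕ, (∀ e : Finset (Fin n), col e < c) ∧
    ∀ S : Finset (Fin n), S.card = p → q ≤ ((S.powersetCard 2).image col).card

/-- The generalised Ramsey number `GR(n,p,q)`: the minimum number of colours in a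
`(p,q)`-colouring of `K_n`. -/
noncomputable def GR (n p q : ℕ) : ℕ := sInf {c : ℕ | HasPQColoring n p q c}


namespace GRL
open Finset
set_option linter.unusedSectionVars false

variable {V ι : Type*} [DecidableEq V] [DecidableEq ι]

/-- Union of the vertex sets of a set of labels. -/
def U (e : ι → Finset V) (J : Finset ι) : Finset V := J.biUnion e

lemma mem_U {e : ι → Finset V} {J : Finset ι} {v : V} : v ∈ U e J ↔ ∃ i ∈ J, v ∈ e i := by
  simp [U]

lemma U_union (e : ι → Finset V) (J K : Finset ι) : U e (J ∪ K) = U e J ∪ U e K := by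
  simp [U, Finset.union_biUnion]

lemma U_mono (e : ι → Finset V) {J K : Finset ι} (h : J ⊆ K) : U e J ⊆ U e K :=
  Finset.biUnion_subset_biUnion_of_subset_left _ h

lemma sub_U (e : ι → Finset V) {J : Finset ι} {i : ι} (h : i ∈ J) : e i ⊆ U e J :=
  Finset.subset_biUnion_of_mem e h

lemma U_insert (e : ι → Finset V) (k : ι) (K : Finset ι) : U e (insert k K) = e k ∪ U e K := by
  simp [U]

lemma card_U_insert (e : ι → Finset V) (k : ι) (K : Finset ι) :
    (U e (insert k K)).card + (e k ∩ U e K).card = (e k).card + (U e K).card := by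
  rw [U_insert]; exact Finset.card_union_add_card_inter _ _

lemma card_U_union (e : ι → Finset V) (J K : Finset ι) :
    (U e (J ∪ K)).card + (U e J ∩ U e K).card = (U e J).card + (U e K).card := by
  rw [U_union]; exact Finset.card_union_add_card_inter _ _

lemma grow (e : ι → Finset V) (h4 : ∀ i, (e i).card = 4) (K T : Finset ι) (c : ℕ)
    (hT : ∀ k ∈ T, c ≤ (e k ∩ U e K).card) :
    (U e (K ∪ T)).card + c * T.card ≤ (U e K).card + 4 * T.card := by
  induction T using Finset.induction_on with
  | empty => simp
  | insert k T hk ih =>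
    have h1 := ih (fun k hk => hT k (Finset.mem_insert_of_mem hk))
    have h2 := hT k (Finset.mem_insert_self _ _)
    have h3 := card_U_insert e k (K ∪ T)
    have h5 : (e k ∩ U e K).card ≤ (e k ∩ U e (K ∪ T)).card :=
      Finset.card_le_card (Finset.inter_subset_inter_left (U_mono e Finset.subset_union_left))
    rw [Finset.union_insert, Finset.card_insert_of_notMem hk, mul_add, mul_add]
    rw [h4] at h3
    omega

/-- Removing a maximal family of disjoint bad configurations. -/
lemma removal [Fintype V] (e : ι → Finset V) (L : Finset ι) (P : Finset ι → Prop) (m c : ℕ)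
    (hP : ∀ J, P J → J.card = m) (hm : 0 < m) (hne : ∀ J, P J → (U e J).Nonempty)
    (h : ∀ F : Finset (Finset ι), (∀ J ∈ F, J ⊆ L ∧ P J) →
      (∀ J ∈ F, ∀ K ∈ F, J ≠ K → Disjoint J K) → F.card = c + 1 → ∀ v, ¬ ∀ J ∈ F, v ∈ U e J) :
    ∃ L' ⊆ L, L.card ≤ L'.card + m * (c * Fintype.card V) ∧ ∀ J ⊆ L', ¬ P J := by
  classical
  set Fam := (L.powerset.powerset).filter (fun F => (∀ J ∈ F, J ⊆ L ∧ P J) ∧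
      (∀ J ∈ F, ∀ K ∈ F, J ≠ K → Disjoint J K)) with hFam
  obtain ⟨F, hF, hmax⟩ := Finset.exists_max_image Fam Finset.card ⟨∅, by simp [hFam]⟩
  rw [hFam, Finset.mem_filter] at hF
  obtain ⟨-, hF1, hF2⟩ := hF
  refine ⟨L \ F.biUnion id, Finset.sdiff_subset, ?_, ?_⟩
  · have h1 : (F.biUnion id).card ≤ F.card * m :=
      Finset.card_biUnion_le_card_mul _ _ _ (fun J hJ => (hP J (hF1 J hJ).2).le)
    have h2 : F.card ≤ c * Fintype.card V := by
      have h3 : ∑ v : V, (F.filter (fun J => v ∈ U e J)).card ≤ ∑ v : V, c := by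
        refine Finset.sum_le_sum fun v _ => ?_
        by_contra hcon
        push Not at hcon
        obtain ⟨F', hF', hc⟩ := Finset.exists_subset_card_eq (Nat.succ_le_of_lt hcon)
        have hsub := fun J (hJ : J ∈ F') => Finset.mem_filter.1 (hF' hJ)
        exact h F' (fun J hJ => hF1 J (hsub J hJ).1)
          (fun J hJ K hK => hF2 J (hsub J hJ).1 K (hsub K hK).1) hc v (fun J hJ => (hsub J hJ).2)
      have h4 : ∑ v : V, (F.filter (fun J => v ∈ U e J)).card = ∑ J ∈ F, (U e J).card := by
        simp_rw [Finset.card_filter]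
        rw [Finset.sum_comm]
        simp
      have h5 : ∑ J ∈ F, 1 ≤ ∑ J ∈ F, (U e J).card :=
        Finset.sum_le_sum fun J hJ => Finset.card_pos.2 (hne J (hF1 J hJ).2)
      simp at h3 h5
      rw [mul_comm c]; omega
    have h6 : L.card ≤ (L \ F.biUnion id).card + (F.biUnion id).card := by
      have := Finset.le_card_sdiff (F.biUnion id) L
      omega
    calc L.card ≤ _ := h6
      _ ≤ (L \ F.biUnion id).card + F.card * m := by omega
      _ ≤ _ := by rw [mul_comm F.card]; gcongr
  · intro J hJ hPJ
    have hdis : ∀ K ∈ F, Disjoint J K := by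
      intro K hK
      rw [Finset.disjoint_left]
      intro x hx hxK
      have := hJ hx
      rw [Finset.mem_sdiff] at this
      exact this.2 (Finset.mem_biUnion.2 ⟨K, hK, hxK⟩)
    have hJF : J ∉ F := by
      intro hJF
      have := hdis J hJF
      rw [disjoint_self] at this
      have h1 := hP J hPJ
      rw [this] at h1
      simp at h1; omega
    have hJL : J ⊆ L := hJ.trans Finset.sdiff_subset
    have : insert J F ∈ Fam := by
      rw [hFam, Finset.mem_filter]
      have hA : ∀ K ∈ insert J F, K ⊆ L ∧ P K := by
        intro K hK
        rcases Finset.mem_insert.1 hK with rfl | hK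
        · exact ⟨hJL, hPJ⟩
        · exact hF1 K hK
      refine ⟨?_, hA, ?_⟩
      · rw [Finset.mem_powerset]
        intro K hK
        exact Finset.mem_powerset.2 (hA K hK).1
      · intro K hK K' hK' hne
        rcases Finset.mem_insert.1 hK with h1 | h1
        · rcases Finset.mem_insert.1 hK' with h2 | h2
          · exact absurd (h1.trans h2.symm) hne
          · rw [h1]; exact hdis _ h2
        · rcases Finset.mem_insert.1 hK' with h2 | h2
          · rw [h2]; exact (hdis _ h1).symm
          · exact hF2 K h1 K' h2 hne
    have := hmax _ this
    rw [Finset.card_insert_of_notMem hJF] at this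
    omega

/-- The clean hypotheses after the removals. -/
structure LH (e : ι → Finset V) (L : Finset ι) : Prop where
  h4 : ∀ i, (e i).card = 4
  P2 : ∀ J ⊆ L, 2 ≤ J.card → 6 ≤ (U e J).card
  P3 : ∀ J ⊆ L, 3 ≤ J.card → 8 ≤ (U e J).card
  P4 : ∀ J ⊆ L, 4 ≤ J.card → 10 ≤ (U e J).card
  P7 : ∀ J ⊆ L, 7 ≤ J.card → 16 ≤ (U e J).card
  P8 : ∀ J ⊆ L, 8 ≤ J.card → 19 ≤ (U e J).card

lemma upgrade (e : ι → Finset V) (L : Finset ι) (m b : ℕ)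
    (h : ∀ J ⊆ L, ¬ (J.card = m ∧ (U e J).card < b)) : ∀ J ⊆ L, m ≤ J.card → b ≤ (U e J).card := by
  intro J hJ hm
  obtain ⟨J', hJ', hc⟩ := Finset.exists_subset_card_eq hm
  by_contra hcon
  push Not at hcon
  exact h J' (hJ'.trans hJ) ⟨hc, lt_of_le_of_lt (Finset.card_le_card (U_mono e hJ')) hcon⟩

lemma U_nonempty (e : ι → Finset V) (h4 : ∀ i, (e i).card = 4) (J : Finset ι) (h : 0 < J.card) :
    (U e J).Nonempty := by
  obtain ⟨i, hi⟩ := Finset.card_pos.1 h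
  have : (e i).Nonempty := Finset.card_pos.1 (by rw [h4]; norm_num)
  exact this.mono (sub_U e hi)

/-- In a (7,3) configuration without (5,2), every label shares 2 vertices with the others. -/
lemma triple_two (e : ι → Finset V) (h4 : ∀ i, (e i).card = 4) (L : Finset ι)
    (P2 : ∀ J ⊆ L, 2 ≤ J.card → 6 ≤ (U e J).card)
    (J : Finset ι) (hJL : J ⊆ L) (hJ : J.card = 3) (hU : (U e J).card < 8) (v : V) (hv : v ∈ U e J) :
    ∃ K ⊆ J, K.card = 2 ∧ (U e K).card ≤ 6 ∧ v ∈ U e K := by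
  obtain ⟨i, hi, hvi⟩ := mem_U.1 hv
  -- choose a label meeting e i in two vertices
  by_contra hcon
  push Not at hcon
  have key : ∀ j ∈ J, j ≠ i → (e i ∩ e j).card ≤ 1 := by
    intro j hj hji
    by_contra hc
    push Not at hc
    have hs : ({i, j} : Finset ι) ⊆ J := by
      intro x hx; simp at hx; rcases hx with rfl | rfl <;> assumption
    have h1 := card_U_insert e i {j}
    have hu : U e {j} = e j := by simp [U]
    rw [hu, h4, h4] at h1
    exact hcon {i, j} hs (Finset.card_pair hji.symm) (by omega) (mem_U.2 ⟨i, by simp, hvi⟩)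
  obtain ⟨j, k, hjk, hE⟩ : ∃ j k, j ≠ k ∧ J.erase i = {j, k} := by
    have : (J.erase i).card = 2 := by rw [Finset.card_erase_of_mem hi, hJ]
    exact Finset.card_eq_two.1 this
  have hj : j ∈ J.erase i := by rw [hE]; simp
  have hk : k ∈ J.erase i := by rw [hE]; simp
  have hj' := Finset.mem_erase.1 hj
  have hk' := Finset.mem_erase.1 hk
  have h1 := key j hj'.2 hj'.1
  have h2 := key k hk'.2 hk'.1
  have h3 := card_U_insert e i (J.erase i)
  rw [Finset.insert_erase hi, h4] at h3
  have h5 : 6 ≤ (U e (J.erase i)).card := P2 _ ((Finset.erase_subset _ _).trans hJL) (by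
    rw [Finset.card_erase_of_mem hi, hJ])
  have h6 : (e i ∩ U e (J.erase i)).card ≤ 2 := by
    have : e i ∩ U e (J.erase i) = (e i ∩ e j) ∪ (e i ∩ e k) := by
      rw [hE]; simp [U, Finset.inter_union_distrib_left]
    rw [this]
    have := Finset.card_union_le (e i ∩ e j) (e i ∩ e k)
    omega
  omega

lemma card_union_of_disj {J K : Finset ι} (h : Disjoint J K) : (J ∪ K).card = J.card + K.card :=
  Finset.card_union_of_disjoint h

lemma share (e : ι → Finset V) (J K : Finset ι) (v : V) (h1 : v ∈ U e J) (h2 : v ∈ U e K) :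
    (U e (J ∪ K)).card + 1 ≤ (U e J).card + (U e K).card := by
  have := card_U_union e J K
  have h : 0 < (U e J ∩ U e K).card := Finset.card_pos.2 ⟨v, Finset.mem_inter.2 ⟨h1, h2⟩⟩
  omega

/-- All removals together. -/
lemma clean [Fintype V] (e : ι → Finset V) (h4 : ∀ i, (e i).card = 4) (L : Finset ι)
    (h8 : ∀ J ⊆ L, 8 ≤ J.card → 19 ≤ (U e J).card) :
    ∃ L' ⊆ L, L.card ≤ L'.card + (15 * Fintype.card V + 4) ∧ LH e L' := by
  -- step 4
  obtain ⟨L1, hL1, hc1, hP4⟩ : ∃ L' ⊆ L, L.card ≤ L'.card + 4 ∧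
      ∀ J ⊆ L', ¬ (J.card = 4 ∧ (U e J).card < 10) := by
    by_cases hex : ∃ J ⊆ L, J.card = 4 ∧ (U e J).card < 10
    · obtain ⟨J, hJ, hJ4, hJU⟩ := hex
      refine ⟨L \ J, Finset.sdiff_subset, ?_, ?_⟩
      · have := Finset.le_card_sdiff J L
        omega
      · rintro K hK ⟨hK4, hKU⟩
        have hd : Disjoint J K := by
          rw [Finset.disjoint_right]
          intro x hx
          exact (Finset.mem_sdiff.1 (hK hx)).2
        have := h8 (J ∪ K) (Finset.union_subset hJ (hK.trans Finset.sdiff_subset))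
          (by rw [card_union_of_disj hd]; omega)
        have h2 := card_U_union e J K
        omega
    · push Not at hex
      refine ⟨L, subset_rfl, by omega, ?_⟩
      rintro J hJ ⟨h1, h2⟩
      have := hex J hJ h1
      omega
  have hP4 := upgrade e L1 4 10 hP4
  -- step 2
  obtain ⟨L2, hL2, hc2, hP2⟩ := removal e L1 (fun J => J.card = 2 ∧ (U e J).card < 6) 2 1
    (fun J h => h.1) (by norm_num) (fun J h => U_nonempty e h4 J (by omega)) (by
      intro F hF hd hc v hv
      obtain ⟨J, K, hJK, rfl⟩ := Finset.card_eq_two.1 hc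
      have hJ := hF J (by simp)
      have hK := hF K (by simp)
      have hdis := hd J (by simp) K (by simp) hJK
      have h1 := share e J K v (hv J (by simp)) (hv K (by simp))
      have := hP4 (J ∪ K) (Finset.union_subset hJ.1 hK.1)
        (by rw [card_union_of_disj hdis]; omega)
      omega)
  have hP2 := upgrade e L2 2 6 hP2
  -- step 3
  obtain ⟨L3, hL3, hc3, hP3⟩ := removal e L2 (fun J => J.card = 3 ∧ (U e J).card < 8) 3 2
    (fun J h => h.1) (by norm_num) (fun J h => U_nonempty e h4 J (by omega)) (by
      intro F hF hd hc v hv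
      obtain ⟨J, K, M, hJK, hJM, hKM, rfl⟩ := Finset.card_eq_three.1 hc
      have hJ := hF J (by simp)
      have hK := hF K (by simp)
      have hM := hF M (by simp)
      have d1 := hd J (by simp) K (by simp) hJK
      have d2 := hd J (by simp) M (by simp) hJM
      have d3 := hd K (by simp) M (by simp) hKM
      obtain ⟨M', hM', hM2, hM6, hvM⟩ := triple_two e h4 L2 hP2 M hM.1 hM.2.1 hM.2.2 v (hv M (by simp))
      have s1 := share e J K v (hv J (by simp)) (hv K (by simp))
      have s2 := share e (J ∪ K) M' v (by rw [U_union]; exact Finset.mem_union_left _ (hv J (by simp))) hvM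
      have dd : Disjoint (J ∪ K) M' := by
        rw [Finset.disjoint_union_left]
        exact ⟨d2.mono_right hM', d3.mono_right hM'⟩
      have := h8 (J ∪ K ∪ M') (Finset.union_subset (Finset.union_subset (hJ.1.trans (hL2.trans hL1))
        (hK.1.trans (hL2.trans hL1))) (hM'.trans (hM.1.trans (hL2.trans hL1))))
        (by rw [card_union_of_disj dd, card_union_of_disj d1]; omega)
      omega)
  have hP3 := upgrade e L3 3 8 hP3
  -- step 7
  obtain ⟨L4, hL4, hc4, hP7⟩ := removal e L3 (fun J => J.card = 7 ∧ (U e J).card < 16) 7 1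
    (fun J h => h.1) (by norm_num) (fun J h => U_nonempty e h4 J (by omega)) (by
      intro F hF hd hc v hv
      obtain ⟨J, K, hJK, rfl⟩ := Finset.card_eq_two.1 hc
      have hJ := hF J (by simp)
      have hK := hF K (by simp)
      have hdis := hd J (by simp) K (by simp) hJK
      obtain ⟨k, hk, hvk⟩ := mem_U.1 (hv K (by simp))
      have hu : U e {k} = e k := by simp [U]
      have h1 := share e J {k} v (hv J (by simp)) (by rw [hu]; exact hvk)
      rw [hu, h4] at h1
      have hkL : ({k} : Finset ι) ⊆ L := by
        rw [Finset.singleton_subset_iff]; exact hL1 (hL2 (hL3 (hK.1 hk)))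
      have := h8 (J ∪ {k}) (Finset.union_subset (hJ.1.trans (hL3.trans (hL2.trans hL1))) hkL)
        (by rw [card_union_of_disj (hdis.mono_right (by simpa using hk))]; simp; omega)
      omega)
  have hP7 := upgrade e L4 7 16 hP7
  refine ⟨L4, hL4.trans (hL3.trans (hL2.trans hL1)), by omega, h4, ?_, ?_, ?_, hP7, ?_⟩
  · exact fun J hJ => hP2 J (hJ.trans (hL4.trans hL3))
  · exact fun J hJ => hP3 J (hJ.trans hL4)
  · exact fun J hJ => hP4 J (hJ.trans (hL4.trans (hL3.trans hL2)))
  · exact fun J hJ => h8 J (hJ.trans (hL4.trans (hL3.trans (hL2.trans hL1))))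

end GRL


namespace GRL
open Finset
set_option linter.unusedSectionVars false

variable {V ι : Type*} [DecidableEq V] [DecidableEq ι]

/-- Adjacent pairs of labels: two labels sharing a pair. -/
def Blk (e : ι → Finset V) (L : Finset ι) : Finset (Finset ι) :=
  (L.powersetCard 2).filter (fun B => (U e B).card ≤ 6)

/-- The four cross pairs of a block. -/
def Q (e : ι → Finset V) (B : Finset ι) : Finset (Finset V) :=
  ((U e B).powersetCard 2).filter (fun p => ∀ i ∈ B, ¬ p ⊆ e i)

/-- A pair contained in some label. -/
abbrev Cov (e : ι → Finset V) (L : Finset ι) (p : Finset V) : Prop := ∃ i ∈ L, p ⊆ e i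

/-- Labels covering the cross pairs of a block. -/
def NN (e : ι → Finset V) (L : Finset ι) (lab : Finset V → ι) (B : Finset ι) : Finset ι :=
  ((Q e B).filter (fun p => Cov e L p)).image lab

variable {e : ι → Finset V} {L : Finset ι}

lemma blk_spec (H : LH e L) {B : Finset ι} (hB : B ∈ Blk e L) :
    B ⊆ L ∧ B.card = 2 ∧ (U e B).card = 6 := by
  rw [Blk, Finset.mem_filter, Finset.mem_powersetCard] at hB
  have := H.P2 B hB.1.1 hB.1.2.ge
  exact ⟨hB.1.1, hB.1.2, by omega⟩

lemma Q_spec {B : Finset ι} {p : Finset V} (h : p ∈ Q e B) :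
    p ⊆ U e B ∧ p.card = 2 ∧ ∀ i ∈ B, ¬ p ⊆ e i := by
  rw [Q, Finset.mem_filter, Finset.mem_powersetCard] at h
  exact ⟨h.1.1, h.1.2, h.2⟩

lemma pair_union {p q : Finset V} (hp : p.card = 2) (hq : q.card = 2) (h : p ≠ q) :
    3 ≤ (p ∪ q).card := by
  by_contra hc
  push Not at hc
  have h1 : p = p ∪ q := Finset.eq_of_subset_of_card_le Finset.subset_union_left (by omega)
  have h2 : q = p ∪ q := Finset.eq_of_subset_of_card_le Finset.subset_union_right (by omega)
  exact h (h1.trans h2.symm)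

lemma beta (H : LH e L) {B : Finset ι} (hB : B ∈ Blk e L) {p : Finset V} (hp : p ∈ Q e B)
    {k : ι} (hk : k ∈ L) (hpk : p ⊆ e k) : k ∉ B ∧ e k ∩ U e B = p := by
  obtain ⟨h1, h2, h3⟩ := Q_spec hp
  obtain ⟨b1, b2, b3⟩ := blk_spec H hB
  have hkB : k ∉ B := fun h => h3 k h hpk
  refine ⟨hkB, ?_⟩
  have := H.P3 (insert k B) (Finset.insert_subset hk b1)
    (by rw [Finset.card_insert_of_notMem hkB]; omega)
  have h4 := card_U_insert e k B
  rw [H.h4] at h4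
  symm
  exact Finset.eq_of_subset_of_card_le (Finset.subset_inter hpk h1) (by omega)

lemma alpha (H : LH e L) {B1 B2 : Finset ι} (h1 : B1 ∈ Blk e L) (h2 : B2 ∈ Blk e L)
    (hne : B1 ≠ B2) {p : Finset V} (hp1 : p ∈ Q e B1) (hp2 : p ∈ Q e B2) : Disjoint B1 B2 := by
  rw [Finset.disjoint_left]
  intro i hi1 hi2
  obtain ⟨a1, a2, a3⟩ := Q_spec hp1
  obtain ⟨c1, c2, c3⟩ := Q_spec hp2
  obtain ⟨b1, b2, b3⟩ := blk_spec H h1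
  obtain ⟨d1, d2, d3⟩ := blk_spec H h2
  have hs : e i ∪ p ⊆ U e B1 ∩ U e B2 := Finset.subset_inter
    (Finset.union_subset (sub_U e hi1) a1) (Finset.union_subset (sub_U e hi2) c1)
  have hc : 5 ≤ (e i ∪ p).card := by
    by_contra hcon
    push Not at hcon
    have : e i = e i ∪ p := Finset.eq_of_subset_of_card_le Finset.subset_union_left
      (by rw [H.h4]; omega)
    exact a3 i hi1 (by rw [this]; exact Finset.subset_union_right)
  have hcu := card_U_union e B1 B2
  have := Finset.card_le_card hs
  have h3 : 3 ≤ (B1 ∪ B2).card := by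
    by_contra hc
    push Not at hc
    have e1 : B1 = B1 ∪ B2 := Finset.eq_of_subset_of_card_le Finset.subset_union_left (by omega)
    have e2 : B2 = B1 ∪ B2 := Finset.eq_of_subset_of_card_le Finset.subset_union_right (by omega)
    exact hne (e1.trans e2.symm)
  have := H.P3 (B1 ∪ B2) (Finset.union_subset b1 d1) h3
  omega

lemma gamma (H : LH e L) {B1 B2 : Finset ι} (h1 : B1 ∈ Blk e L) (h2 : B2 ∈ Blk e L)
    (hd : Disjoint B1 B2) : (U e B1 ∩ U e B2).card ≤ 2 := by
  obtain ⟨b1, b2, b3⟩ := blk_spec H h1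
  obtain ⟨d1, d2, d3⟩ := blk_spec H h2
  have hcu := card_U_union e B1 B2
  have := H.P4 (B1 ∪ B2) (Finset.union_subset b1 d1) (by rw [card_union_of_disj hd]; omega)
  omega

lemma gamma_contra (H : LH e L) {B1 B2 : Finset ι} (h1 : B1 ∈ Blk e L) (h2 : B2 ∈ Blk e L)
    (hd : Disjoint B1 B2) {p q : Finset V} (hp : p.card = 2) (hq : q.card = 2) (hpq : p ≠ q)
    (p1 : p ⊆ U e B1) (p2 : p ⊆ U e B2) (q1 : q ⊆ U e B1) (q2 : q ⊆ U e B2) : False := by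
  have h3 := gamma H h1 h2 hd
  have h4 := pair_union hp hq hpq
  have h5 : p ∪ q ⊆ U e B1 ∩ U e B2 := Finset.subset_inter (Finset.union_subset p1 q1)
    (Finset.union_subset p2 q2)
  have := Finset.card_le_card h5
  omega

lemma add_block (H : LH e L) (K : Finset ι) {B : Finset ι} (hB : B ∈ Blk e L) {p : Finset V}
    (hp : p.card = 2) (h1 : p ⊆ U e K) (h2 : p ⊆ U e B) : (U e (K ∪ B)).card ≤ (U e K).card + 4 := by
  obtain ⟨b1, b2, b3⟩ := blk_spec H hB
  have hcu := card_U_union e K B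
  have := Finset.card_le_card (Finset.subset_inter h1 h2)
  omega

section lab
variable {lab : Finset V → ι}

lemma NN_spec (H : LH e L) (hlab : ∀ p, Cov e L p → lab p ∈ L ∧ p ⊆ e (lab p)) {B : Finset ι}
    (hB : B ∈ Blk e L) {k : ι} (hk : k ∈ NN e L lab B) :
    k ∈ L ∧ k ∉ B ∧ Cov e L (e k ∩ U e B) ∧ (e k ∩ U e B) ∈ Q e B := by
  rw [NN, Finset.mem_image] at hk
  obtain ⟨p, hp, rfl⟩ := hk
  rw [Finset.mem_filter] at hp
  obtain ⟨h1, h2⟩ := hlab p hp.2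
  obtain ⟨h3, h4⟩ := beta H hB hp.1 h1 h2
  rw [h4]
  exact ⟨h1, h3, hp.2, hp.1⟩

lemma card_NN (H : LH e L) (hlab : ∀ p, Cov e L p → lab p ∈ L ∧ p ⊆ e (lab p)) {B : Finset ι}
    (hB : B ∈ Blk e L) : (NN e L lab B).card = ((Q e B).filter (fun p => Cov e L p)).card := by
  rw [NN]
  refine Finset.card_image_of_injOn ?_
  intro p hp q hq hpq
  simp only [Finset.coe_filter, Set.mem_ofPred_eq] at hp hq
  have a := beta H hB hp.1 (hlab p hp.2).1 (hlab p hp.2).2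
  have b := beta H hB hq.1 (hlab q hq.2).1 (hlab q hq.2).2
  rw [hpq] at a
  exact a.2.symm.trans b.2

/-- distinct labels in `NN` have distinct traces -/
lemma NN_inj (H : LH e L) (hlab : ∀ p, Cov e L p → lab p ∈ L ∧ p ⊆ e (lab p)) {B : Finset ι}
    (hB : B ∈ Blk e L) {k k' : ι} (hk : k ∈ NN e L lab B) (hk' : k' ∈ NN e L lab B)
    (h : e k ∩ U e B = e k' ∩ U e B) : k = k' := by
  rw [NN, Finset.mem_image] at hk hk'
  obtain ⟨p, hp, rfl⟩ := hk
  obtain ⟨q, hq, rfl⟩ := hk'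
  rw [Finset.mem_filter] at hp hq
  have a := beta H hB hp.1 (hlab p hp.2).1 (hlab p hp.2).2
  have b := beta H hB hq.1 (hlab q hq.2).1 (hlab q hq.2).2
  rw [a.2, b.2] at h
  rw [h]

lemma growN (H : LH e L) (hlab : ∀ p, Cov e L p → lab p ∈ L ∧ p ⊆ e (lab p)) {B : Finset ι}
    (hB : B ∈ Blk e L) {K T : Finset ι} (hBK : B ⊆ K) (hT : T ⊆ NN e L lab B) :
    (U e (K ∪ T)).card ≤ (U e K).card + 2 * T.card := by
  have := grow e H.h4 K T 2 (by
    intro k hk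
    obtain ⟨-, -, -, h⟩ := NN_spec H hlab hB (hT hk)
    rw [← (Q_spec h).2.1]
    exact Finset.card_le_card (Finset.inter_subset_inter_left (U_mono e hBK)))
  omega

lemma NN_sub (H : LH e L) (hlab : ∀ p, Cov e L p → lab p ∈ L ∧ p ⊆ e (lab p)) {B : Finset ι}
    (hB : B ∈ Blk e L) : NN e L lab B ⊆ L := fun _ hk => (NN_spec H hlab hB hk).1

lemma NN_disj (H : LH e L) (hlab : ∀ p, Cov e L p → lab p ∈ L ∧ p ⊆ e (lab p)) {B : Finset ι}
    (hB : B ∈ Blk e L) : Disjoint B (NN e L lab B) :=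
  Finset.disjoint_right.2 fun _ hk => (NN_spec H hlab hB hk).2.1

lemma delta (H : LH e L) (hlab : ∀ p, Cov e L p → lab p ∈ L ∧ p ⊆ e (lab p)) {B1 B2 : Finset ι}
    (h1 : B1 ∈ Blk e L) (h2 : B2 ∈ Blk e L) (hne : B1 ≠ B2) {p : Finset V} (hp1 : p ∈ Q e B1)
    (hp2 : p ∈ Q e B2) (hu : ¬ Cov e L p) : Disjoint B2 (NN e L lab B1) := by
  rw [Finset.disjoint_right]
  intro k hk hk2
  obtain ⟨n1, n2, n3, n4⟩ := NN_spec H hlab h1 hk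
  refine gamma_contra H h1 h2 (alpha H h1 h2 hne hp1 hp2) (Q_spec hp1).2.1 (Q_spec n4).2.1 ?_
    (Q_spec hp1).1 (Q_spec hp2).1 (Q_spec n4).1 (Finset.inter_subset_left.trans (sub_U e hk2))
  rintro rfl
  exact hu n3

lemma two_blocks (H : LH e L) {B1 B2 : Finset ι}
    (h1 : B1 ∈ Blk e L) (h2 : B2 ∈ Blk e L) (hne : B1 ≠ B2) {p : Finset V} (hp1 : p ∈ Q e B1)
    (hp2 : p ∈ Q e B2) : B1 ∪ B2 ⊆ L ∧ (B1 ∪ B2).card = 4 ∧ (U e (B1 ∪ B2)).card ≤ 10 := by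
  have b1 := blk_spec H h1
  have b2 := blk_spec H h2
  refine ⟨Finset.union_subset b1.1 b2.1, ?_, ?_⟩
  · rw [card_union_of_disj (alpha H h1 h2 hne hp1 hp2)]; omega
  · have := add_block H B1 h2 (Q_spec hp1).2.1 (Q_spec hp1).1 (Q_spec hp2).1
    omega

lemma three_blocks (H : LH e L) {B1 B2 B3 : Finset ι}
    (h1 : B1 ∈ Blk e L) (h2 : B2 ∈ Blk e L) (h3 : B3 ∈ Blk e L) (hne : B1 ≠ B2) (hne3 : B1 ≠ B3)
    (hne23 : B2 ≠ B3) {p : Finset V} (hp1 : p ∈ Q e B1)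
    (hp2 : p ∈ Q e B2) (hp3 : p ∈ Q e B3) : B1 ∪ B2 ∪ B3 ⊆ L ∧ (B1 ∪ B2 ∪ B3).card = 6 ∧
      (U e (B1 ∪ B2 ∪ B3)).card ≤ 14 := by
  have b3 := blk_spec H h3
  have b12 := two_blocks H h1 h2 hne hp1 hp2
  refine ⟨Finset.union_subset b12.1 b3.1, ?_, ?_⟩
  · rw [card_union_of_disj]
    · omega
    · rw [Finset.disjoint_union_left]
      exact ⟨alpha H h1 h3 hne3 hp1 hp3, alpha H h2 h3 hne23 hp2 hp3⟩
  · have := add_block H (B1 ∪ B2) h3 (Q_spec hp1).2.1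
      ((Q_spec hp1).1.trans (U_mono e Finset.subset_union_left)) (Q_spec hp3).1
    omega

lemma four_blocks (H : LH e L) {B1 B2 B3 B4 : Finset ι}
    (h1 : B1 ∈ Blk e L) (h2 : B2 ∈ Blk e L) (h3 : B3 ∈ Blk e L) (h4 : B4 ∈ Blk e L)
    (hne : B1 ≠ B2) (hne3 : B1 ≠ B3)
    (hne23 : B2 ≠ B3) (g1 : B1 ≠ B4) (g2 : B2 ≠ B4) (g3 : B3 ≠ B4) {p : Finset V} (hp1 : p ∈ Q e B1)
    (hp2 : p ∈ Q e B2) (hp3 : p ∈ Q e B3) (hp4 : p ∈ Q e B4) : False := by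
  have b4 := blk_spec H h4
  have b := three_blocks H h1 h2 h3 hne hne3 hne23 hp1 hp2 hp3
  have := add_block H (B1 ∪ B2 ∪ B3) h4 (Q_spec hp1).2.1
      ((Q_spec hp1).1.trans (U_mono e (Finset.subset_union_left.trans Finset.subset_union_left)))
      (Q_spec hp4).1
  have := H.P8 (B1 ∪ B2 ∪ B3 ∪ B4) (Finset.union_subset b.1 b4.1) (by
    rw [card_union_of_disj]
    · omega
    · rw [Finset.disjoint_union_left, Finset.disjoint_union_left]
      exact ⟨⟨alpha H h1 h4 g1 hp1 hp4, alpha H h2 h4 g2 hp2 hp4⟩, alpha H h3 h4 g3 hp3 hp4⟩)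
  omega

lemma three_c (H : LH e L) (hlab : ∀ p, Cov e L p → lab p ∈ L ∧ p ⊆ e (lab p))
    {B1 B2 B3 : Finset ι}
    (h1 : B1 ∈ Blk e L) (h2 : B2 ∈ Blk e L) (h3 : B3 ∈ Blk e L) (hne : B1 ≠ B2) (hne3 : B1 ≠ B3)
    (hne23 : B2 ≠ B3) {p : Finset V} (hp1 : p ∈ Q e B1)
    (hp2 : p ∈ Q e B2) (hp3 : p ∈ Q e B3) (hu : ¬ Cov e L p) : (NN e L lab B1).card ≤ 1 := by
  by_contra hcon
  push Not at hcon
  obtain ⟨T, hT, hTc⟩ := Finset.exists_subset_card_eq (Nat.succ_le_of_lt hcon)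
  have b := three_blocks H h1 h2 h3 hne hne3 hne23 hp1 hp2 hp3
  have hg := growN H hlab h1 (K := B1 ∪ B2 ∪ B3) (T := T)
    (Finset.subset_union_left.trans Finset.subset_union_left) hT
  have := H.P8 (B1 ∪ B2 ∪ B3 ∪ T) (Finset.union_subset b.1 (hT.trans (NN_sub H hlab h1))) (by
    rw [card_union_of_disj]
    · omega
    · rw [Finset.disjoint_union_left, Finset.disjoint_union_left]
      exact ⟨⟨(NN_disj H hlab h1).mono_right hT, (delta H hlab h1 h2 hne hp1 hp2 hu).mono_right hT⟩,
        (delta H hlab h1 h3 hne3 hp1 hp3 hu).mono_right hT⟩)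
  omega

lemma two_c (H : LH e L) (hlab : ∀ p, Cov e L p → lab p ∈ L ∧ p ⊆ e (lab p))
    {B1 B2 : Finset ι} (h1 : B1 ∈ Blk e L) (h2 : B2 ∈ Blk e L) (hne : B1 ≠ B2)
    {p : Finset V} (hp1 : p ∈ Q e B1) (hp2 : p ∈ Q e B2) (hu : ¬ Cov e L p)
    (hc : (NN e L lab B1).card = 3) : (NN e L lab B2).card = 0 := by
  by_contra hcon
  obtain ⟨k, hk⟩ := Finset.card_pos.1 (Nat.pos_of_ne_zero hcon)
  have b := two_blocks H h1 h2 hne hp1 hp2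
  have hd12 := alpha H h1 h2 hne hp1 hp2
  have dN1 : Disjoint (B1 ∪ B2) (NN e L lab B1) := by
    rw [Finset.disjoint_union_left]
    exact ⟨NN_disj H hlab h1, delta H hlab h1 h2 hne hp1 hp2 hu⟩
  have dN2 : Disjoint (B1 ∪ B2) (NN e L lab B2) := by
    rw [Finset.disjoint_union_left]
    exact ⟨delta H hlab h2 h1 hne.symm hp2 hp1 hu, NN_disj H hlab h2⟩
  have hs2 := NN_spec H hlab h2 hk
  by_cases hk1 : k ∈ NN e L lab B1
  · have hs1 := NN_spec H hlab h1 hk1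
    have hne' : e k ∩ U e B1 ≠ e k ∩ U e B2 := by
      intro heq
      refine gamma_contra H h1 h2 hd12 (Q_spec hp1).2.1 (Q_spec hs1.2.2.2).2.1 ?_
        (Q_spec hp1).1 (Q_spec hp2).1 Finset.inter_subset_right (heq ▸ Finset.inter_subset_right)
      intro h
      rw [h] at hu
      exact hu hs1.2.2.1
    have hpu := pair_union (Q_spec hs1.2.2.2).2.1 (Q_spec hs2.2.2.2).2.1 hne'
    rw [← Finset.inter_union_distrib_left, ← U_union] at hpu
    have hi := card_U_insert e k (B1 ∪ B2)
    rw [H.h4] at hi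
    have hkB : k ∉ B1 ∪ B2 := fun h => (Finset.disjoint_left.1 dN1 h) hk1
    have hg := growN H hlab h1 (K := insert k (B1 ∪ B2)) (T := (NN e L lab B1).erase k)
      (Finset.subset_union_left.trans (Finset.subset_insert _ _)) (Finset.erase_subset _ _)
    have hec := Finset.card_erase_of_mem hk1
    have := H.P7 (insert k (B1 ∪ B2) ∪ (NN e L lab B1).erase k)
      (Finset.union_subset (Finset.insert_subset hs1.1 b.1)
        ((Finset.erase_subset _ _).trans (NN_sub H hlab h1))) (by
      rw [card_union_of_disj]
      · rw [Finset.card_insert_of_notMem hkB]; omega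
      · rw [Finset.disjoint_insert_left]
        exact ⟨by simp, dN1.mono_right (Finset.erase_subset _ _)⟩)
    omega
  · have hg := growN H hlab h1 (K := B1 ∪ B2) (T := NN e L lab B1)
      Finset.subset_union_left subset_rfl
    have hg2 := growN H hlab h2 (K := B1 ∪ B2 ∪ NN e L lab B1) (T := {k})
      (Finset.subset_union_right.trans Finset.subset_union_left) (by simpa using hk)
    rw [Finset.card_singleton] at hg2
    have := H.P8 (B1 ∪ B2 ∪ NN e L lab B1 ∪ {k}) (Finset.union_subset (Finset.union_subset b.1
      (NN_sub H hlab h1)) (by simpa using hs2.1)) (by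
      rw [card_union_of_disj, card_union_of_disj dN1]
      · simp; omega
      · rw [Finset.disjoint_singleton_right, Finset.mem_union]
        rintro (h | h)
        · exact Finset.disjoint_left.1 dN2 h hk
        · exact hk1 h)
    omega

/-- In a block `{f,h}` the two labels share exactly two vertices. -/
lemma blk_inter (H : LH e L) {f h : ι} (hfh : f ≠ h) (hB : ({f, h} : Finset ι) ∈ Blk e L) :
    (e f ∩ e h).card = 2 := by
  have b := blk_spec H hB
  have h1 := card_U_insert e f {h}
  have hu : U e {h} = e h := by simp [U]
  rw [hu, H.h4, H.h4] at h1
  omega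

lemma eps (H : LH e L) (hlab : ∀ p, Cov e L p → lab p ∈ L ∧ p ⊆ e (lab p))
    {B1 B2 B3 : Finset ι} (h1 : B1 ∈ Blk e L) (h2 : B2 ∈ Blk e L) (h3 : B3 ∈ Blk e L)
    {p p' : Finset V} (hpp : p ≠ p') (hp2 : p ∈ Q e B2) (hp2' : p' ∈ Q e B2)
    (hp1 : p ∈ Q e B1) (hp3 : p' ∈ Q e B3)
    (hu : ¬ Cov e L p) (hu' : ¬ Cov e L p') (hc2 : (NN e L lab B2).card = 0)
    (hc1 : (NN e L lab B1).card = 3) (hc3 : (NN e L lab B3).card = 3) : False := by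
  have h12 : B1 ≠ B2 := by rintro rfl; omega
  have h32 : B3 ≠ B2 := by rintro rfl; omega
  have d12 := alpha H h1 h2 h12 hp1 hp2
  have d32 := alpha H h3 h2 h32 hp3 hp2'
  have b := two_blocks H h1 h2 h12 hp1 hp2
  have b1 := blk_spec H h1
  have b2 := blk_spec H h2
  have b3 := blk_spec H h3
  have dN1 : Disjoint (B1 ∪ B2) (NN e L lab B1) := by
    rw [Finset.disjoint_union_left]
    exact ⟨NN_disj H hlab h1, delta H hlab h1 h2 h12 hp1 hp2 hu⟩
  by_cases h13 : B1 = B3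
  · subst h13
    exact gamma_contra H h1 h2 d12 (Q_spec hp1).2.1 (Q_spec hp3).2.1 hpp (Q_spec hp1).1
      (Q_spec hp2).1 (Q_spec hp3).1 (Q_spec hp2').1
  by_cases hd : Disjoint B1 B3
  · have hle : (NN e L lab B1 ∩ B3).card ≤ 1 := by
      by_contra hcon
      push Not at hcon
      obtain ⟨k, hk, k', hk', hkk⟩ := Finset.one_lt_card.1 hcon
      rw [Finset.mem_inter] at hk hk'
      have s := NN_spec H hlab h1 hk.1
      have s' := NN_spec H hlab h1 hk'.1
      exact gamma_contra H h1 h3 hd (Q_spec s.2.2.2).2.1 (Q_spec s'.2.2.2).2.1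
        (fun h => hkk (NN_inj H hlab h1 hk.1 hk'.1 h)) Finset.inter_subset_right
        (Finset.inter_subset_left.trans (sub_U e hk.2)) Finset.inter_subset_right
        (Finset.inter_subset_left.trans (sub_U e hk'.2))
    have hge : 2 ≤ (NN e L lab B1 \ B3).card := by
      have := Finset.card_sdiff_add_card_inter (NN e L lab B1) B3
      omega
    obtain ⟨T, hT, hTc⟩ := Finset.exists_subset_card_eq hge
    have hTN : T ⊆ NN e L lab B1 := hT.trans Finset.sdiff_subset
    have ha := add_block H (B1 ∪ B2) h3 (Q_spec hp3).2.1
      ((Q_spec hp2').1.trans (U_mono e Finset.subset_union_right)) (Q_spec hp3).1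
    have hg := growN H hlab h1 (K := B1 ∪ B2 ∪ B3) (T := T)
      (Finset.subset_union_left.trans Finset.subset_union_left) hTN
    have := H.P8 (B1 ∪ B2 ∪ B3 ∪ T) (Finset.union_subset (Finset.union_subset b.1 b3.1)
      (hTN.trans (NN_sub H hlab h1))) (by
      rw [card_union_of_disj, card_union_of_disj]
      · omega
      · rw [Finset.disjoint_union_left]; exact ⟨hd, d32.symm⟩
      · rw [Finset.disjoint_union_left]
        refine ⟨dN1.mono_right hTN, Finset.disjoint_right.2 fun x hx => ?_⟩
        exact (Finset.mem_sdiff.1 (hT hx)).2)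
    omega
  · rw [Finset.not_disjoint_iff] at hd
    obtain ⟨f, hf1, hf3⟩ := hd
    obtain ⟨h, hh⟩ := Finset.card_eq_one.1 (show (B3.erase f).card = 1 by
      rw [Finset.card_erase_of_mem hf3]; omega)
    have hhB : h ∈ B3.erase f := by rw [hh]; simp
    have hhf := Finset.mem_erase.1 hhB
    have hB3 : B3 = {f, h} := by rw [← Finset.insert_erase hf3, hh]
    have hh1 : h ∉ B1 := by
      intro hh1
      apply h13
      symm
      apply Finset.eq_of_subset_of_card_le
      · rw [hB3]; intro x hx; simp at hx; rcases hx with rfl | rfl <;> assumption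
      · omega
    have hh2 : h ∉ B2 := fun h' => Finset.disjoint_left.1 d32 hhf.2 h'
    have hin : (e f ∩ e h).card = 2 := blk_inter H hhf.1.symm (hB3 ▸ h3)
    have hsub : e f ∩ e h ⊆ e h ∩ U e B1 := by
      rw [Finset.inter_comm]
      exact Finset.inter_subset_inter_left (sub_U e hf1)
    have hhN : h ∉ NN e L lab B1 := by
      intro hhN
      have s := NN_spec H hlab h1 hhN
      have : e f ∩ e h = e h ∩ U e B1 := Finset.eq_of_subset_of_card_le hsub
        (by rw [(Q_spec s.2.2.2).2.1]; omega)
      exact (Q_spec s.2.2.2).2.2 f hf1 (this ▸ Finset.inter_subset_left)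
    have hi := card_U_insert e h (B1 ∪ B2)
    have hi2 : (e f ∩ e h).card ≤ (e h ∩ U e (B1 ∪ B2)).card :=
      Finset.card_le_card (hsub.trans (Finset.inter_subset_inter_left
        (U_mono e Finset.subset_union_left)))
    rw [H.h4] at hi
    have hg := growN H hlab h1 (K := insert h (B1 ∪ B2)) (T := NN e L lab B1)
      (Finset.subset_union_left.trans (Finset.subset_insert _ _)) subset_rfl
    have := H.P8 (insert h (B1 ∪ B2) ∪ NN e L lab B1) (Finset.union_subset
      (Finset.insert_subset (b3.1 hhf.2) b.1) (NN_sub H hlab h1)) (by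
      rw [card_union_of_disj, Finset.card_insert_of_notMem]
      · omega
      · simp [hh1, hh2]
      · rw [Finset.disjoint_insert_left]; exact ⟨hhN, dN1⟩)
    omega

end lab
end GRL


namespace GRL
open Finset
set_option linter.unusedSectionVars false

variable {V ι : Type*} [DecidableEq V] [DecidableEq ι]
variable {e : ι → Finset V} {L : Finset ι}

section lab
variable {lab : Finset V → ι}

/-- `{u,v}` is a far pair of `B`. -/
def Far (e : ι → Finset V) (L : Finset ι) (lab : Finset V → ι) (B : Finset ι) (u v : V) : Prop :=
  ∃ k ∈ NN e L lab B, ∃ k' ∈ NN e L lab B, k ≠ k' ∧ (u ∈ e k ∧ u ∉ U e B) ∧ (v ∈ e k' ∧ v ∉ U e B)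

lemma Far.symm {B : Finset ι} {u v : V} (h : Far e L lab B u v) : Far e L lab B v u := by
  obtain ⟨k, hk, k', hk', hkk, hu, hv⟩ := h
  exact ⟨k', hk', k, hk, hkk.symm, hv, hu⟩

/-- Two labels in `NN` only meet inside `U B`. -/
lemma far_meet (H : LH e L) (hlab : ∀ p, Cov e L p → lab p ∈ L ∧ p ⊆ e (lab p)) {B : Finset ι}
    (hB : B ∈ Blk e L) {k k' : ι} (hk : k ∈ NN e L lab B) (hk' : k' ∈ NN e L lab B)
    (hkk : k ≠ k') {x : V} (hx : x ∈ e k) (hx' : x ∈ e k') : x ∈ U e B := by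
  obtain ⟨b1, b2, b3⟩ := blk_spec H hB
  have s := NN_spec H hlab hB hk
  have s' := NN_spec H hlab hB hk'
  have i1 := card_U_insert e k B
  have i2 := card_U_insert e k' (insert k B)
  have q := (Q_spec s.2.2.2).2.1
  have q' := (Q_spec s'.2.2.2).2.1
  rw [H.h4] at i1 i2
  have hk'B : k' ∉ insert k B := by
    rw [Finset.mem_insert]; rintro (h | h)
    · exact hkk h.symm
    · exact s'.2.1 h
  have := H.P4 (insert k' (insert k B)) (Finset.insert_subset s'.1 (Finset.insert_subset s.1 b1))
    (by rw [Finset.card_insert_of_notMem hk'B, Finset.card_insert_of_notMem s.2.1]; omega)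
  have heq : e k' ∩ U e B = e k' ∩ U e (insert k B) := Finset.eq_of_subset_of_card_le
    (Finset.inter_subset_inter_left (U_mono e (Finset.subset_insert _ _))) (by omega)
  have : x ∈ e k' ∩ U e (insert k B) := Finset.mem_inter.2 ⟨hx', by
    rw [U_insert]; exact Finset.mem_union_left _ hx⟩
  rw [← heq] at this
  exact (Finset.mem_inter.1 this).2

lemma far_unique (H : LH e L) (hlab : ∀ p, Cov e L p → lab p ∈ L ∧ p ⊆ e (lab p)) {B : Finset ι}
    (hB : B ∈ Blk e L) {k h : ι} (hk : k ∈ NN e L lab B) {u : V} (hu : u ∈ e k) (hu' : u ∉ U e B)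
    (hh : h ∈ B ∪ NN e L lab B) (huh : u ∈ e h) : h = k := by
  rcases Finset.mem_union.1 hh with h1 | h1
  · exact absurd (sub_U e h1 huh) hu'
  · by_contra hne
    exact hu' (far_meet H hlab hB h1 hk hne huh hu)

lemma adjN (H : LH e L) (hlab : ∀ p, Cov e L p → lab p ∈ L ∧ p ⊆ e (lab p)) {B : Finset ι}
    (hB : B ∈ Blk e L) {k k' : ι} (hk : k ∈ NN e L lab B) (hk' : k' ∈ NN e L lab B)
    (hkk : k ≠ k') : (e k ∩ e k').card ≤ 1 := by
  by_contra hc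
  push Not at hc
  have s := NN_spec H hlab hB hk
  have s' := NN_spec H hlab hB hk'
  have h1 : e k ∩ e k' ⊆ U e B := fun x hx => far_meet H hlab hB hk hk' hkk
    (Finset.mem_inter.1 hx).1 (Finset.mem_inter.1 hx).2
  have h2 : e k ∩ e k' = e k ∩ U e B := Finset.eq_of_subset_of_card_le
    (Finset.subset_inter Finset.inter_subset_left h1) (by rw [(Q_spec s.2.2.2).2.1]; omega)
  have h3 : e k ∩ e k' = e k' ∩ U e B := Finset.eq_of_subset_of_card_le
    (Finset.subset_inter Finset.inter_subset_right h1) (by rw [(Q_spec s'.2.2.2).2.1]; omega)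
  exact hkk (NN_inj H hlab hB hk hk' (h2.symm.trans h3))

lemma adjBN (H : LH e L) (hlab : ∀ p, Cov e L p → lab p ∈ L ∧ p ⊆ e (lab p)) {B : Finset ι}
    (hB : B ∈ Blk e L) {k f : ι} (hk : k ∈ NN e L lab B) (hf : f ∈ B) :
    (e f ∩ e k).card ≤ 1 := by
  by_contra hc
  push Not at hc
  have s := NN_spec H hlab hB hk
  have h2 : e f ∩ e k = e k ∩ U e B := Finset.eq_of_subset_of_card_le
    (Finset.subset_inter Finset.inter_subset_right (Finset.inter_subset_left.trans (sub_U e hf)))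
    (by rw [(Q_spec s.2.2.2).2.1]; omega)
  exact (Q_spec s.2.2.2).2.2 f hf (h2 ▸ Finset.inter_subset_left)

lemma adjK (H : LH e L) (hlab : ∀ p, Cov e L p → lab p ∈ L ∧ p ⊆ e (lab p)) {B : Finset ι}
    (hB : B ∈ Blk e L) {f g : ι} (hfg : f ≠ g) (hf : f ∈ B ∪ NN e L lab B)
    (hg : g ∈ B ∪ NN e L lab B) (h : (e f ∩ e g).card = 2) : f ∈ B ∧ g ∈ B := by
  rcases Finset.mem_union.1 hf with h1 | h1 <;> rcases Finset.mem_union.1 hg with h2 | h2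
  · exact ⟨h1, h2⟩
  · have := adjBN H hlab hB h2 h1; omega
  · have := adjBN H hlab hB h1 h2; rw [Finset.inter_comm] at this; omega
  · have := adjN H hlab hB h1 h2 hfg; omega

lemma KK (H : LH e L) (hlab : ∀ p, Cov e L p → lab p ∈ L ∧ p ⊆ e (lab p)) {B : Finset ι}
    (hB : B ∈ Blk e L) (hc : (NN e L lab B).card = 4) :
    (B ∪ NN e L lab B) ⊆ L ∧ (B ∪ NN e L lab B).card = 6 ∧ (U e (B ∪ NN e L lab B)).card ≤ 14 := by
  have b := blk_spec H hB
  have := growN H hlab hB (K := B) (T := NN e L lab B) subset_rfl subset_rfl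
  refine ⟨Finset.union_subset b.1 (NN_sub H hlab hB), ?_, by omega⟩
  rw [card_union_of_disj (NN_disj H hlab hB)]; omega

lemma far_ne (H : LH e L) (hlab : ∀ p, Cov e L p → lab p ∈ L ∧ p ⊆ e (lab p)) {B : Finset ι}
    (hB : B ∈ Blk e L) {u v : V} (h : Far e L lab B u v) : u ≠ v := by
  obtain ⟨k, hk, k', hk', hkk, hu, hv⟩ := h
  rintro rfl
  exact hu.2 (far_meet H hlab hB hk hk' hkk hu.1 hv.1)

lemma far_sub {B : Finset ι} {u v : V} (h : Far e L lab B u v) :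
    ({u, v} : Finset V) ⊆ U e (B ∪ NN e L lab B) := by
  obtain ⟨k, hk, k', hk', hkk, hu, hv⟩ := h
  intro x hx
  simp only [Finset.mem_insert, Finset.mem_singleton] at hx
  rcases hx with rfl | rfl
  · exact sub_U e (Finset.mem_union_right _ hk) hu.1
  · exact sub_U e (Finset.mem_union_right _ hk') hv.1

lemma zeta (H : LH e L) (hlab : ∀ p, Cov e L p → lab p ∈ L ∧ p ⊆ e (lab p)) {B : Finset ι}
    (hB : B ∈ Blk e L) (hc : (NN e L lab B).card = 4) :
    ∃ u v, Far e L lab B u v ∧ ¬ Cov e L {u, v} := by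
  by_contra hcon
  push Not at hcon
  obtain ⟨K1, K2, K3⟩ := KK H hlab hB hc
  have b := blk_spec H hB
  -- residual sets
  have hr : ∀ k ∈ NN e L lab B, (e k \ U e B).card = 2 := by
    intro k hk
    have s := NN_spec H hlab hB hk
    have := Finset.card_sdiff_add_card_inter (e k) (U e B)
    rw [(Q_spec s.2.2.2).2.1, H.h4] at this
    omega
  have hcov : ∀ u v, Far e L lab B u v → ∀ h ∈ L, ({u, v} : Finset V) ⊆ e h →
      h ∉ B ∪ NN e L lab B := by
    rintro u v ⟨k, hk, k', hk', hkk, hu, hv⟩ h - hs hK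
    have e1 := far_unique H hlab hB hk hu.1 hu.2 hK (hs (by simp))
    have e2 := far_unique H hlab hB hk' hv.1 hv.2 hK (hs (by simp))
    exact hkk (e1.symm.trans e2)
  obtain ⟨k0, hk0, k1, hk1, hk01⟩ := Finset.one_lt_card.1 (show 1 < (NN e L lab B).card by omega)
  obtain ⟨u0, hu0⟩ := Finset.card_pos.1 (show 0 < (e k0 \ U e B).card by rw [hr k0 hk0]; norm_num)
  obtain ⟨v0, hv0⟩ := Finset.card_pos.1 (show 0 < (e k1 \ U e B).card by rw [hr k1 hk1]; norm_num)
  rw [Finset.mem_sdiff] at hu0 hv0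
  have hfar0 : Far e L lab B u0 v0 := ⟨k0, hk0, k1, hk1, hk01, hu0, hv0⟩
  obtain ⟨h, hhL, hh⟩ := hcon u0 v0 hfar0
  have hhK := hcov u0 v0 hfar0 h hhL hh
  have hall : ∀ u v, Far e L lab B u v → ({u, v} : Finset V) ⊆ e h := by
    intro u v hf
    obtain ⟨h', hhL', hh'⟩ := hcon u v hf
    have hhK' := hcov u v hf h' hhL' hh'
    by_cases heq : h' = h
    · rw [← heq]; exact hh'
    exfalso
    have hg := grow e H.h4 (B ∪ NN e L lab B) {h, h'} 2 (by
      have key : ∀ x y, Far e L lab B x y → ∀ k, ({x, y} : Finset V) ⊆ e k →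
          2 ≤ (e k ∩ U e (B ∪ NN e L lab B)).card := by
        intro x y hxy k hk
        rw [← Finset.card_pair (far_ne H hlab hB hxy)]
        exact Finset.card_le_card (Finset.subset_inter hk (far_sub hxy))
      intro k hk
      simp only [Finset.mem_insert, Finset.mem_singleton] at hk
      rcases hk with rfl | rfl
      · exact key u0 v0 hfar0 _ hh
      · exact key u v hf _ hh')
    have hc2 : ({h, h'} : Finset ι).card = 2 := Finset.card_pair (Ne.symm heq)
    have := H.P8 (B ∪ NN e L lab B ∪ {h, h'}) (Finset.union_subset K1 (by
      intro x hx; simp at hx; rcases hx with rfl | rfl <;> assumption)) (by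
      rw [card_union_of_disj]
      · omega
      · rw [Finset.disjoint_right]
        intro x hx
        simp only [Finset.mem_insert, Finset.mem_singleton] at hx
        rcases hx with rfl | rfl <;> assumption)
    omega
  have hsub : (NN e L lab B).biUnion (fun k => e k \ U e B) ⊆ e h := by
    intro x hx
    rw [Finset.mem_biUnion] at hx
    obtain ⟨k, hk, hx⟩ := hx
    obtain ⟨k', hk', hkk⟩ := Finset.exists_mem_ne (show 1 < (NN e L lab B).card by omega) k
    obtain ⟨y, hy⟩ := Finset.card_pos.1 (show 0 < (e k' \ U e B).card by rw [hr k' hk']; norm_num)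
    rw [Finset.mem_sdiff] at hx hy
    exact hall x y ⟨k, hk, k', hk', hkk.symm, hx, hy⟩ (by simp)
  have hcard : ((NN e L lab B).biUnion (fun k => e k \ U e B)).card = 8 := by
    rw [Finset.card_biUnion]
    · rw [Finset.sum_congr rfl hr]; simp [hc]
    · intro k hk k' hk' hkk
      rw [Function.onFun, Finset.disjoint_left]
      intro x hx hx'
      rw [Finset.mem_sdiff] at hx hx'
      exact hx.2 (far_meet H hlab hB hk hk' hkk hx.1 hx'.1)
  have := Finset.card_le_card hsub
  rw [hcard, H.h4] at this
  omega

/-- A 2-set block written with a chosen first element. -/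
lemma blk_pair (H : LH e L) {B : Finset ι} (hB : B ∈ Blk e L) {f : ι} (hf : f ∈ B) :
    ∃ g, g ∈ B ∧ f ≠ g ∧ B = {f, g} := by
  have b := blk_spec H hB
  obtain ⟨g, hg⟩ := Finset.card_eq_one.1 (show (B.erase f).card = 1 by
      rw [Finset.card_erase_of_mem hf]; omega)
  have hgB : g ∈ B.erase f := by rw [hg]; simp
  have h := Finset.mem_erase.1 hgB
  exact ⟨g, h.2, h.1.symm, by rw [← Finset.insert_erase hf, hg]⟩

/-- A pair not inside `e g` but inside `e f ∪ e g`, inside `W`, with `e g ⊆ W`: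
`e f` meets `W` in at least three vertices. -/
lemma meet3 {f g : ι} {p W : Finset V} (h2 : (e f ∩ e g).card = 2) (hp : p ⊆ e f ∪ e g)
    (hpg : ¬ p ⊆ e g) (hpW : p ⊆ W) (hg : e g ⊆ W) : 3 ≤ (e f ∩ W).card := by
  obtain ⟨x, hx, hxg⟩ := Finset.not_subset.1 hpg
  have hxf : x ∈ e f := by
    rcases Finset.mem_union.1 (hp hx) with h | h
    · exact h
    · exact absurd h hxg
  have hs : insert x (e f ∩ e g) ⊆ e f ∩ W := by
    rw [Finset.insert_subset_iff]
    exact ⟨Finset.mem_inter.2 ⟨hxf, hpW hx⟩, Finset.inter_subset_inter_left hg⟩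
  have := Finset.card_le_card hs
  rw [Finset.card_insert_of_notMem (by simp [hxg])] at this
  omega

lemma U_pair (f g : ι) : U e {f, g} = e f ∪ e g := by simp [U]

lemma eta (H : LH e L) (hlab : ∀ p, Cov e L p → lab p ∈ L ∧ p ⊆ e (lab p)) {B B2 : Finset ι}
    (hB : B ∈ Blk e L) (hc : (NN e L lab B).card = 4) (hB2 : B2 ∈ Blk e L) {u v : V}
    (hf : Far e L lab B u v) (hq : ({u, v} : Finset V) ∈ Q e B2) : False := by
  obtain ⟨K1, K2, K3⟩ := KK H hlab hB hc
  have b2 := blk_spec H hB2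
  obtain ⟨q1, q2, q3⟩ := Q_spec hq
  have hsub := far_sub hf
  by_cases hd : Disjoint (B ∪ NN e L lab B) B2
  · have ha := add_block H (B ∪ NN e L lab B) hB2 q2 hsub q1
    have := H.P8 _ (Finset.union_subset K1 b2.1) (by rw [card_union_of_disj hd]; omega)
    omega
  rw [Finset.not_disjoint_iff] at hd
  obtain ⟨g, hgK, hg2⟩ := hd
  obtain ⟨f, hf2, hgf, hB2e⟩ := blk_pair H hB2 hg2
  have hin : (e g ∩ e f).card = 2 := blk_inter H hgf (hB2e ▸ hB2)
  by_cases hfK : f ∈ B ∪ NN e L lab B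
  · obtain ⟨k, hk, k', hk', hkk, hu, hv⟩ := hf
    have hb := adjK H hlab hB hgf hgK hfK hin
    have : u ∈ U e B2 := q1 (by simp)
    rw [hB2e, U_pair, Finset.mem_union] at this
    rcases this with h | h
    · exact hu.2 (sub_U e hb.1 h)
    · exact hu.2 (sub_U e hb.2 h)
  · have h3 := meet3 (e := e) (f := f) (g := g) (p := {u, v}) (W := U e (B ∪ NN e L lab B))
      (by rw [Finset.inter_comm]; exact hin)
      (by rw [Finset.union_comm, ← U_pair, ← hB2e]; exact q1) (q3 g hg2) hsub (sub_U e hgK)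
    have hi := card_U_insert e f (B ∪ NN e L lab B)
    rw [H.h4] at hi
    have := H.P7 _ (Finset.insert_subset (b2.1 hf2) K1)
      (by rw [Finset.card_insert_of_notMem hfK]; omega)
    omega

lemma theta (H : LH e L) (hlab : ∀ p, Cov e L p → lab p ∈ L ∧ p ⊆ e (lab p)) {B B' : Finset ι}
    (hB : B ∈ Blk e L) (hc : (NN e L lab B).card = 4) (hB' : B' ∈ Blk e L)
    (hc' : (NN e L lab B').card = 4) {u v : V}
    (hf : Far e L lab B u v) (hf' : Far e L lab B' u v) : B = B' := by
  by_contra hne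
  obtain ⟨K1, K2, K3⟩ := KK H hlab hB hc
  have b := blk_spec H hB
  have b' := blk_spec H hB'
  have hsub := far_sub hf
  have huv := far_ne H hlab hB hf
  obtain ⟨k1, hk1, k2, hk2, hk12, hu, hv⟩ := hf
  obtain ⟨l1, hl1, l2, hl2, hl12, hu', hv'⟩ := hf'
  by_cases hd : Disjoint (B ∪ NN e L lab B) B'
  · -- no common label
    have main : ∀ l ∈ NN e L lab B', l ∉ B ∪ NN e L lab B := by
      intro l hl hlK
      have s := NN_spec H hlab hB' hl
      have ha := add_block H (B ∪ NN e L lab B) hB' (Q_spec s.2.2.2).2.1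
        (Finset.inter_subset_left.trans (sub_U e hlK)) Finset.inter_subset_right
      have := H.P8 _ (Finset.union_subset K1 b'.1) (by rw [card_union_of_disj hd]; omega)
      omega
    have m1 := main l1 hl1
    have m2 := main l2 hl2
    have c1 : ({k1, k2} : Finset ι).card = 2 := Finset.card_pair hk12
    have c2 : ({l1, l2} : Finset ι).card = 2 := Finset.card_pair hl12
    have t1 : ({k1, k2} : Finset ι) ⊆ NN e L lab B := by
      intro x hx; simp at hx; rcases hx with rfl | rfl <;> assumption
    have t2 : ({l1, l2} : Finset ι) ⊆ NN e L lab B' := by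
      intro x hx; simp at hx; rcases hx with rfl | rfl <;> assumption
    have g1 := growN H hlab hB (K := B) (T := {k1, k2}) subset_rfl t1
    have g2 := growN H hlab hB' (K := B') (T := {l1, l2}) subset_rfl t2
    have d1 : Disjoint B {k1, k2} := (NN_disj H hlab hB).mono_right t1
    have d2 : Disjoint B' {l1, l2} := (NN_disj H hlab hB').mono_right t2
    have hK : B ∪ {k1, k2} ⊆ B ∪ NN e L lab B := Finset.union_subset_union_right t1
    have hcu := card_U_union e (B ∪ {k1, k2}) (B' ∪ {l1, l2})
    have h2 : 2 ≤ (U e (B ∪ {k1, k2}) ∩ U e (B' ∪ {l1, l2})).card := by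
      rw [← Finset.card_pair huv]
      apply Finset.card_le_card
      intro x hx
      simp only [Finset.mem_insert, Finset.mem_singleton] at hx
      rw [Finset.mem_inter]
      rcases hx with rfl | rfl
      · exact ⟨sub_U e (i := k1) (by simp) hu.1, sub_U e (i := l1) (by simp) hu'.1⟩
      · exact ⟨sub_U e (i := k2) (by simp) hv.1, sub_U e (i := l2) (by simp) hv'.1⟩
    have := H.P8 (B ∪ {k1, k2} ∪ (B' ∪ {l1, l2})) (Finset.union_subset (hK.trans K1)
      (Finset.union_subset b'.1 (t2.trans (NN_sub H hlab hB')))) (by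
      rw [card_union_of_disj, card_union_of_disj d1, card_union_of_disj d2]
      · omega
      · rw [Finset.disjoint_union_right]
        refine ⟨hd.mono_left hK, Finset.disjoint_right.2 fun x hx hx2 => ?_⟩
        simp only [Finset.mem_insert, Finset.mem_singleton] at hx
        rcases hx with rfl | rfl
        · exact m1 (hK hx2)
        · exact m2 (hK hx2))
    omega
  rw [Finset.not_disjoint_iff] at hd
  obtain ⟨g, hgK, hg2⟩ := hd
  obtain ⟨f, hf2, hgf, hB2e⟩ := blk_pair H hB' hg2
  have hin : (e g ∩ e f).card = 2 := blk_inter H hgf (hB2e ▸ hB')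
  by_cases hfK : f ∈ B ∪ NN e L lab B
  · have hb := adjK H hlab hB hgf hgK hfK hin
    apply hne
    symm
    apply Finset.eq_of_subset_of_card_le
    · rw [hB2e]; intro x hx; simp at hx; rcases hx with rfl | rfl
      exacts [hb.1, hb.2]
    · omega
  have hi := card_U_insert e f (B ∪ NN e L lab B)
  rw [H.h4] at hi
  have s := NN_spec H hlab hB' hl1
  obtain ⟨q1, q2, q3⟩ := Q_spec s.2.2.2
  have hfL := b'.1 hf2
  by_cases hlK : l1 ∈ B ∪ NN e L lab B
  · have h3 := meet3 (e := e) (f := f) (g := g) (p := e l1 ∩ U e B') (W := U e (B ∪ NN e L lab B))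
      (by rw [Finset.inter_comm]; exact hin)
      (by rw [Finset.union_comm, ← U_pair, ← hB2e]; exact q1) (q3 g hg2)
      (Finset.inter_subset_left.trans (sub_U e hlK)) (sub_U e hgK)
    have := H.P7 _ (Finset.insert_subset hfL K1)
      (by rw [Finset.card_insert_of_notMem hfK]; omega)
    omega
  · have hi2 : 2 ≤ (e f ∩ U e (B ∪ NN e L lab B)).card := by
      rw [← hin, Finset.inter_comm (e g)]
      exact Finset.card_le_card (Finset.inter_subset_inter_left (sub_U e hgK))
    have hj := card_U_insert e l1 (insert f (B ∪ NN e L lab B))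
    rw [H.h4] at hj
    have hj2 : 2 ≤ (e l1 ∩ U e (insert f (B ∪ NN e L lab B))).card := by
      rw [← q2]
      refine Finset.card_le_card (Finset.inter_subset_inter_left (U_mono e ?_))
      rw [hB2e]
      intro x hx
      simp only [Finset.mem_insert, Finset.mem_singleton] at hx
      rcases hx with rfl | rfl
      · exact Finset.mem_insert_of_mem hgK
      · exact Finset.mem_insert_self _ _
    have hlf : l1 ∉ insert f (B ∪ NN e L lab B) := by
      rw [Finset.mem_insert]
      rintro (rfl | h)
      · exact s.2.1 hf2
      · exact hlK h
    have := H.P8 _ (Finset.insert_subset s.1 (Finset.insert_subset hfL K1))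
      (by rw [Finset.card_insert_of_notMem hlf, Finset.card_insert_of_notMem hfK]; omega)
    omega

lemma card_Q (H : LH e L) {B : Finset ι} (hB : B ∈ Blk e L) : (Q e B).card = 4 := by
  have b := blk_spec H hB
  obtain ⟨f, g, hfg, rfl⟩ := Finset.card_eq_two.1 b.2.1
  have hin := blk_inter H hfg hB
  have hsplit : (U e {f, g}).powersetCard 2 =
      Q e {f, g} ∪ ((e f).powersetCard 2 ∪ (e g).powersetCard 2) := by
    ext p
    simp only [Q, Finset.mem_union, Finset.mem_filter, Finset.mem_powersetCard, U_pair]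
    constructor
    · rintro ⟨h1, h2⟩
      by_cases a1 : p ⊆ e f
      · exact Or.inr (Or.inl ⟨a1, h2⟩)
      by_cases a2 : p ⊆ e g
      · exact Or.inr (Or.inr ⟨a2, h2⟩)
      · left
        refine ⟨⟨h1, h2⟩, ?_⟩
        intro i hi; simp at hi; rcases hi with rfl | rfl <;> assumption
    · rintro (⟨⟨h1, h2⟩, -⟩ | ⟨h1, h2⟩ | ⟨h1, h2⟩)
      · exact ⟨h1, h2⟩
      · exact ⟨h1.trans Finset.subset_union_left, h2⟩
      · exact ⟨h1.trans Finset.subset_union_right, h2⟩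
  have hdis : Disjoint (Q e {f, g}) ((e f).powersetCard 2 ∪ (e g).powersetCard 2) := by
    rw [Finset.disjoint_left]
    intro p hp hp2
    obtain ⟨-, -, q3⟩ := Q_spec hp
    simp only [Finset.mem_union, Finset.mem_powersetCard] at hp2
    rcases hp2 with h | h
    · exact q3 f (by simp) h.1
    · exact q3 g (by simp) h.1
  have hintr : (e f).powersetCard 2 ∩ (e g).powersetCard 2 = (e f ∩ e g).powersetCard 2 := by
    ext p
    simp only [Finset.mem_inter, Finset.mem_powersetCard, Finset.subset_inter_iff]
    tauto
  have h1 := congrArg Finset.card hsplit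
  rw [Finset.card_union_of_disjoint hdis, Finset.card_powersetCard, b.2.2] at h1
  have h2 := Finset.card_union_add_card_inter ((e f).powersetCard 2) ((e g).powersetCard 2)
  rw [hintr, Finset.card_powersetCard, Finset.card_powersetCard, Finset.card_powersetCard, hin,
    H.h4, H.h4] at h2
  have c1 : Nat.choose 6 2 = 15 := rfl
  have c2 : Nat.choose 4 2 = 6 := rfl
  have c3 : Nat.choose 2 2 = 1 := rfl
  omega

end lab
end GRL


namespace GRL
open Finset
set_option linter.unusedSectionVars false

variable {V ι : Type*} [DecidableEq V] [DecidableEq ι]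
variable {e : ι → Finset V} {L : Finset ι}

open Classical in
/-- Six times the weight given by block `B` to the uncovered pair `p`. -/
noncomputable def ww (e : ι → Finset V) (L : Finset ι) (lab : Finset V → ι)
    (phi : Finset ι → Finset V) (B : Finset ι) (p : Finset V) : ℕ :=
  if p ∈ Q e B then
    (if (NN e L lab B).card = 3 then 6 else if (NN e L lab B).card = 2 then 3 else
      if (NN e L lab B).card = 1 then 2 else
      if (NN e L lab B).card = 0 ∧ ¬ ∃ B' ∈ Blk e L, (NN e L lab B').card = 3 ∧ p ∈ Q e B' then 2
      else 0)
  else if (NN e L lab B).card = 4 ∧ p = phi B then 6 else 0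

lemma pair_cases {a b c d : V} (h : ({a, b} : Finset V) = {c, d}) (hab : a ≠ b) :
    (a = c ∧ b = d) ∨ (a = d ∧ b = c) := by
  have h1 : a ∈ ({c, d} : Finset V) := by rw [← h]; simp
  have h2 : b ∈ ({c, d} : Finset V) := by rw [← h]; simp
  simp only [Finset.mem_insert, Finset.mem_singleton] at h1 h2
  rcases h1 with rfl | rfl <;> rcases h2 with rfl | rfl <;> simp_all

section
variable {lab : Finset V → ι} {phi : Finset ι → Finset V}

lemma ww_row [Fintype V] (H : LH e L) (hlab : ∀ p, Cov e L p → lab p ∈ L ∧ p ⊆ e (lab p))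
    (hphi : ∀ B ∈ Blk e L, (NN e L lab B).card = 4 →
      ∃ u v, phi B = {u, v} ∧ Far e L lab B u v ∧ ¬ Cov e L {u, v})
    {B : Finset ι} (hB : B ∈ Blk e L) :
    6 ≤ ∑ p ∈ ((Finset.univ : Finset V).powersetCard 2).filter (fun p => ¬ Cov e L p),
      ww e L lab phi B p := by
  classical
  have hQ := card_Q H hB
  have hN := card_NN H hlab hB
  have hsplit := Finset.card_filter_add_card_filter_not (s := Q e B) (fun p => Cov e L p)
  set T := (Q e B).filter (fun p => ¬ Cov e L p) with hT
  have hTsub : T ⊆ ((Finset.univ : Finset V).powersetCard 2).filter (fun p => ¬ Cov e L p) := by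
    intro p hp
    rw [hT, Finset.mem_filter] at hp
    rw [Finset.mem_filter, Finset.mem_powersetCard]
    exact ⟨⟨Finset.subset_univ _, (Q_spec hp.1).2.1⟩, hp.2⟩
  have hmono : ∑ p ∈ T, ww e L lab phi B p ≤
      ∑ p ∈ ((Finset.univ : Finset V).powersetCard 2).filter (fun p => ¬ Cov e L p),
      ww e L lab phi B p := Finset.sum_le_sum_of_subset hTsub
  have hTQ : ∀ p ∈ T, p ∈ Q e B := fun p hp => (Finset.mem_filter.1 hp).1
  have hc5 : (NN e L lab B).card ≤ 4 := by omega
  have hcases : (NN e L lab B).card = 0 ∨ (NN e L lab B).card = 1 ∨ (NN e L lab B).card = 2 ∨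
    (NN e L lab B).card = 3 ∨ (NN e L lab B).card = 4 := by omega
  rcases hcases with hc | hc | hc | hc | hc
  · refine le_trans ?_ hmono
    set T' := T.filter (fun p => ¬ ∃ B' ∈ Blk e L, (NN e L lab B').card = 3 ∧ p ∈ Q e B') with hT'
    have h1 : (T.filter (fun p => ∃ B' ∈ Blk e L, (NN e L lab B').card = 3 ∧ p ∈ Q e B')).card ≤ 1 := by
      rw [Finset.card_le_one]
      intro p hp q hq
      rw [Finset.mem_filter] at hp hq
      obtain ⟨hp, B1, hB1, hc1, hp1⟩ := hp
      obtain ⟨hq, B3, hB3, hc3, hq3⟩ := hq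
      by_contra hpq
      exact eps H hlab hB1 hB hB3 hpq (hTQ p hp) (hTQ q hq) hp1 hq3 (Finset.mem_filter.1 hp).2
        (Finset.mem_filter.1 hq).2 hc hc1 hc3
    have h2 : (T.filter (fun p => ∃ B' ∈ Blk e L, (NN e L lab B').card = 3 ∧ p ∈ Q e B')).card +
        T'.card = T.card := by
      rw [hT']
      convert Finset.card_filter_add_card_filter_not (s := T)
        (fun p => ∃ B' ∈ Blk e L, (NN e L lab B').card = 3 ∧ p ∈ Q e B')
    have h3 : ∑ p ∈ T', ww e L lab phi B p = ∑ p ∈ T', 2 := by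
      refine Finset.sum_congr rfl fun p hp => ?_
      rw [hT', Finset.mem_filter] at hp
      rw [ww, if_pos (hTQ p hp.1), hc]
      simp [-not_exists, hp.2]
    have h4 : ∑ p ∈ T', ww e L lab phi B p ≤ ∑ p ∈ T, ww e L lab phi B p :=
      Finset.sum_le_sum_of_subset (Finset.filter_subset _ _)
    rw [h3, Finset.sum_const, smul_eq_mul] at h4
    have : 3 ≤ T'.card := by omega
    omega
  · refine le_trans ?_ hmono
    have h3 : ∑ p ∈ T, ww e L lab phi B p = ∑ p ∈ T, 2 := by
      refine Finset.sum_congr rfl fun p hp => ?_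
      rw [ww, if_pos (hTQ p hp), hc]; simp
    rw [h3, Finset.sum_const, smul_eq_mul]; omega
  · refine le_trans ?_ hmono
    have h3 : ∑ p ∈ T, ww e L lab phi B p = ∑ p ∈ T, 3 := by
      refine Finset.sum_congr rfl fun p hp => ?_
      rw [ww, if_pos (hTQ p hp), hc]; simp
    rw [h3, Finset.sum_const, smul_eq_mul]; omega
  · refine le_trans ?_ hmono
    have h3 : ∑ p ∈ T, ww e L lab phi B p = ∑ p ∈ T, 6 := by
      refine Finset.sum_congr rfl fun p hp => ?_
      rw [ww, if_pos (hTQ p hp), hc]; simp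
    rw [h3, Finset.sum_const, smul_eq_mul]; omega
  · obtain ⟨u, v, huv, hfar, hun⟩ := hphi B hB hc
    have hmem : phi B ∈ ((Finset.univ : Finset V).powersetCard 2).filter (fun p => ¬ Cov e L p) := by
      rw [Finset.mem_filter, Finset.mem_powersetCard, huv]
      exact ⟨⟨Finset.subset_univ _, Finset.card_pair (far_ne H hlab hB hfar)⟩, hun⟩
    refine le_trans ?_ (Finset.single_le_sum (f := fun p => ww e L lab phi B p)
      (fun _ _ => Nat.zero_le _) hmem)
    have hnq : phi B ∉ Q e B := by
      intro hq
      rw [huv] at hq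
      obtain ⟨k, hk, k', hk', hkk, hu, hv⟩ := hfar
      exact hu.2 ((Q_spec hq).1 (by simp))
    simp [ww, hnq, hc]

lemma ww_le_six (B : Finset ι) (p : Finset V) : ww e L lab phi B p ≤ 6 := by
  unfold ww; split_ifs <;> norm_num

lemma ww_col (H : LH e L) (hlab : ∀ p, Cov e L p → lab p ∈ L ∧ p ⊆ e (lab p))
    (hphi : ∀ B ∈ Blk e L, (NN e L lab B).card = 4 →
      ∃ u v, phi B = {u, v} ∧ Far e L lab B u v ∧ ¬ Cov e L {u, v})
    {p : Finset V} (hp : ¬ Cov e L p) :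
    ∑ B ∈ Blk e L, ww e L lab phi B p ≤ 6 := by
  classical
  by_cases hA : ∃ B0 ∈ Blk e L, (NN e L lab B0).card = 4 ∧ p = phi B0
  · obtain ⟨B0, hB0, hc0, hp0⟩ := hA
    rw [Finset.sum_eq_single B0]
    · exact ww_le_six _ _
    · intro B hB hne
      obtain ⟨u, v, huv, hfar, hun⟩ := hphi B0 hB0 hc0
      have hnq : p ∉ Q e B := by
        intro hq
        rw [hp0, huv] at hq
        exact eta H hlab hB0 hc0 hB hfar hq
      rw [ww, if_neg hnq, if_neg]
      rintro ⟨hc, hpB⟩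
      obtain ⟨u', v', huv', hfar', hun'⟩ := hphi B hB hc
      have heq : ({u, v} : Finset V) = {u', v'} := by rw [← huv, ← huv', ← hp0, ← hpB]
      apply hne
      rcases pair_cases heq (far_ne H hlab hB0 hfar) with ⟨rfl, rfl⟩ | ⟨rfl, rfl⟩
      · exact theta H hlab hB hc hB0 hc0 hfar' hfar
      · exact theta H hlab hB hc hB0 hc0 hfar' hfar.symm
    · intro h; exact absurd hB0 h
  · push Not at hA
    set S := (Blk e L).filter (fun B => p ∈ Q e B) with hS
    have hsum : ∑ B ∈ Blk e L, ww e L lab phi B p = ∑ B ∈ S, ww e L lab phi B p := by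
      rw [hS, Finset.sum_filter]
      refine Finset.sum_congr rfl fun B hB => ?_
      split_ifs with h
      · rfl
      · rw [ww, if_neg h, if_neg]
        rintro ⟨h1, h2⟩
        exact hA B hB h1 h2
    rw [hsum]
    have hmem : ∀ B ∈ S, B ∈ Blk e L ∧ p ∈ Q e B := fun B hB => Finset.mem_filter.1 hB
    have h3 : S.card ≤ 3 := by
      by_contra hcon
      push Not at hcon
      obtain ⟨S4, hS4, hc4⟩ := Finset.exists_subset_card_eq (Nat.succ_le_of_lt hcon)
      obtain ⟨B1, S3, hn1, rfl, hc3⟩ := Finset.card_eq_succ.1 hc4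
      obtain ⟨B2, B3, B4, g1, g2, g3, rfl⟩ := Finset.card_eq_three.1 hc3
      simp only [Finset.mem_insert, Finset.mem_singleton, not_or] at hn1
      have m1 := hmem B1 (hS4 (by simp))
      have m2 := hmem B2 (hS4 (by simp))
      have m3 := hmem B3 (hS4 (by simp))
      have m4 := hmem B4 (hS4 (by simp))
      exact four_blocks H m1.1 m2.1 m3.1 m4.1 hn1.1 hn1.2.1 g1 hn1.2.2 g2 g3 m1.2 m2.2 m3.2 m4.2
    have hcases : S.card = 0 ∨ S.card = 1 ∨ S.card = 2 ∨ S.card = 3 := by omega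
    rcases hcases with hc | hc | hc | hc
    · rw [Finset.card_eq_zero] at hc
      rw [hc]; simp
    · obtain ⟨B, hB⟩ := Finset.card_eq_one.1 hc
      rw [hB, Finset.sum_singleton]; exact ww_le_six _ _
    · obtain ⟨B1, B2, hne, hSe⟩ := Finset.card_eq_two.1 hc
      have m1 := hmem B1 (by rw [hSe]; simp)
      have m2 := hmem B2 (by rw [hSe]; simp)
      rw [hSe, Finset.sum_pair hne]
      have key : ∀ B B', B ∈ Blk e L → B' ∈ Blk e L → p ∈ Q e B → p ∈ Q e B' → B ≠ B' →
          (NN e L lab B).card = 3 → ww e L lab phi B' p = 0 := by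
        intro B B' hB hB' hq hq' hne' hc3
        have := two_c H hlab hB hB' hne' hq hq' hp hc3
        rw [ww, if_pos hq', this]
        have hex : ∃ B' ∈ Blk e L, (NN e L lab B').card = 3 ∧ p ∈ Q e B' := ⟨B, hB, hc3, hq⟩
        simp [-not_exists, hex]
      have key2 : ∀ B, p ∈ Q e B → (NN e L lab B).card ≠ 3 → ww e L lab phi B p ≤ 3 := by
        intro B hq hne3
        rw [ww, if_pos hq, if_neg hne3]
        split_ifs <;> norm_num
      by_cases c1 : (NN e L lab B1).card = 3
      · rw [key B1 B2 m1.1 m2.1 m1.2 m2.2 hne c1, add_zero]; exact ww_le_six _ _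
      by_cases c2 : (NN e L lab B2).card = 3
      · rw [key B2 B1 m2.1 m1.1 m2.2 m1.2 hne.symm c2, zero_add]; exact ww_le_six _ _
      have := key2 B1 m1.2 c1
      have := key2 B2 m2.2 c2
      omega
    · obtain ⟨B1, B2, B3, g1, g2, g3, hSe⟩ := Finset.card_eq_three.1 hc
      have m1 := hmem B1 (by rw [hSe]; simp)
      have m2 := hmem B2 (by rw [hSe]; simp)
      have m3 := hmem B3 (by rw [hSe]; simp)
      have c1 := three_c H hlab m1.1 m2.1 m3.1 g1 g2 g3 m1.2 m2.2 m3.2 hp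
      have c2 := three_c H hlab m2.1 m1.1 m3.1 g1.symm g3 g2 m2.2 m1.2 m3.2 hp
      have c3 := three_c H hlab m3.1 m1.1 m2.1 g2.symm g3.symm g1 m3.2 m1.2 m2.2 hp
      have key2 : ∀ B, p ∈ Q e B → (NN e L lab B).card ≤ 1 → ww e L lab phi B p ≤ 2 := by
        intro B hq hne3
        rw [ww, if_pos hq, if_neg (by omega), if_neg (by omega)]
        split_ifs <;> norm_num
      rw [hSe, Finset.sum_insert (by simp [g1, g2]), Finset.sum_pair g3]
      have := key2 B1 m1.2 c1
      have := key2 B2 m2.2 c2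
      have := key2 B3 m3.2 c3
      omega

end

lemma blk_le [Fintype V] [Nonempty ι] (H : LH e L) : (Blk e L).card ≤
    (((Finset.univ : Finset V).powersetCard 2).filter (fun p => ¬ Cov e L p)).card := by
  classical
  obtain ⟨lab, hlab⟩ : ∃ lab : Finset V → ι, ∀ p, Cov e L p → lab p ∈ L ∧ p ⊆ e (lab p) := by
    have : ∀ p, ∃ k : ι, Cov e L p → k ∈ L ∧ p ⊆ e k := by
      intro p
      by_cases h : Cov e L p
      · obtain ⟨i, hi⟩ := h; exact ⟨i, fun _ => hi⟩
      · exact ⟨Classical.arbitrary ι, fun h' => absurd h' h⟩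
    exact ⟨fun p => (this p).choose, fun p => (this p).choose_spec⟩
  obtain ⟨phi, hphi⟩ : ∃ phi : Finset ι → Finset V, ∀ B ∈ Blk e L, (NN e L lab B).card = 4 →
      ∃ u v, phi B = {u, v} ∧ Far e L lab B u v ∧ ¬ Cov e L {u, v} := by
    have : ∀ B : Finset ι, ∃ q : Finset V, B ∈ Blk e L → (NN e L lab B).card = 4 →
        ∃ u v, q = {u, v} ∧ Far e L lab B u v ∧ ¬ Cov e L {u, v} := by
      intro B
      by_cases h : B ∈ Blk e L ∧ (NN e L lab B).card = 4
      · obtain ⟨u, v, h1, h2⟩ := zeta H hlab h.1 h.2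
        exact ⟨{u, v}, fun _ _ => ⟨u, v, rfl, h1, h2⟩⟩
      · exact ⟨∅, fun a b => absurd ⟨a, b⟩ h⟩
    exact ⟨fun p => (this p).choose, fun p => (this p).choose_spec⟩
  have h1 : ∑ B ∈ Blk e L, 6 ≤ ∑ B ∈ Blk e L,
      ∑ p ∈ ((Finset.univ : Finset V).powersetCard 2).filter (fun p => ¬ Cov e L p),
      ww e L lab phi B p := Finset.sum_le_sum fun B hB => ww_row H hlab hphi hB
  rw [Finset.sum_comm] at h1
  have h2 := Finset.sum_le_sum (s := ((Finset.univ : Finset V).powersetCard 2).filter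
    (fun p => ¬ Cov e L p)) fun p hp => ww_col H hlab hphi (Finset.mem_filter.1 hp).2
  have h3 := h1.trans h2
  simp only [Finset.sum_const, smul_eq_mul] at h3
  omega

lemma choose_two_aux (d : ℕ) : d ≤ (if 0 < d then 1 else 0) + d.choose 2 := by
  rcases d with _ | _ | d
  · simp
  · simp
  · rw [Nat.choose_two_right, if_pos (by omega)]
    have : d + 1 ≤ (d + 1 + 1) * (d + 1 + 1 - 1) / 2 := by
      rw [Nat.le_div_iff_mul_le (by norm_num)]
      simp only [Nat.add_sub_cancel]
      nlinarith
    omega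

lemma count [Fintype V] [Nonempty ι] (H : LH e L) :
    6 * L.card ≤ (Fintype.card V).choose 2 := by
  classical
  set PP := (Finset.univ : Finset V).powersetCard 2 with hPP
  have hd : ∑ p ∈ PP, (L.filter (fun i => p ⊆ e i)).card = 6 * L.card := by
    simp_rw [Finset.card_filter]
    rw [Finset.sum_comm]
    have : ∀ i ∈ L, ∑ p ∈ PP, (if p ⊆ e i then 1 else 0) = 6 := by
      intro i _
      rw [← Finset.card_filter]
      have : PP.filter (fun p => p ⊆ e i) = (e i).powersetCard 2 := by
        ext p; simp [hPP, Finset.mem_powersetCard]; tauto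
      rw [this, Finset.card_powersetCard, H.h4]; rfl
    rw [Finset.sum_congr rfl this]; simp [mul_comm]
  have h1 : ∑ p ∈ PP, (L.filter (fun i => p ⊆ e i)).card ≤
      ∑ p ∈ PP, ((if 0 < (L.filter (fun i => p ⊆ e i)).card then 1 else 0) +
        ((L.filter (fun i => p ⊆ e i)).card).choose 2) :=
    Finset.sum_le_sum fun p _ => choose_two_aux _
  rw [Finset.sum_add_distrib, hd] at h1
  have h2 : ∑ p ∈ PP, (if 0 < (L.filter (fun i => p ⊆ e i)).card then 1 else 0) =
      (PP.filter (fun p => Cov e L p)).card := by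
    rw [Finset.card_filter]
    refine Finset.sum_congr rfl fun p _ => ?_
    congr 1
    rw [Finset.card_pos, Finset.filter_nonempty_iff]
  have h3 : ∑ p ∈ PP, ((L.filter (fun i => p ⊆ e i)).card).choose 2 ≤ (Blk e L).card := by
    have h4 : ∀ p ∈ PP, ((L.filter (fun i => p ⊆ e i)).card).choose 2 =
        ∑ B ∈ L.powersetCard 2, if ∀ i ∈ B, p ⊆ e i then 1 else 0 := by
      intro p _
      rw [← Finset.card_powersetCard, ← Finset.card_filter]
      congr 1
      ext B
      simp only [Finset.mem_powersetCard, Finset.mem_filter, Finset.subset_iff (s₁ := B)]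
      constructor
      · rintro ⟨a, b⟩; exact ⟨⟨fun x hx => (a hx).1, b⟩, fun i hi => (a hi).2⟩
      · rintro ⟨⟨a, b⟩, c⟩; exact ⟨fun x hx => ⟨a hx, c x hx⟩, b⟩
    rw [Finset.sum_congr rfl h4, Finset.sum_comm, Blk, Finset.card_filter]
    refine Finset.sum_le_sum fun B hB => ?_
    rw [← Finset.card_filter]
    rw [Finset.mem_powersetCard] at hB
    obtain ⟨i, j, hij, rfl⟩ := Finset.card_eq_two.1 hB.2
    have hU := card_U_insert e i {j}
    have hu : U e {j} = e j := by simp [U]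
    rw [hu, H.h4, H.h4] at hU
    have hP2 := H.P2 _ hB.1 hB.2.ge
    have hfil : PP.filter (fun p => ∀ k ∈ ({i, j} : Finset ι), p ⊆ e k) =
        (e i ∩ e j).powersetCard 2 := by
      ext p; simp [hPP, Finset.mem_powersetCard, Finset.subset_inter_iff]; tauto
    rw [hfil, Finset.card_powersetCard]
    split_ifs with h
    · have : (e i ∩ e j).card = 2 := by omega
      rw [this]; rfl
    · rw [Nat.choose_eq_zero_of_lt]; omega
  have h5 := blk_le H
  have h6 := Finset.card_filter_add_card_filter_not (s := PP) (fun p => Cov e L p)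
  have h7 : PP.card = (Fintype.card V).choose 2 := by
    rw [hPP, Finset.card_powersetCard, Finset.card_univ]
  rw [← hPP] at h5
  omega

/-- The extremal bound: labelled 4-sets without 8 on 18 vertices. -/
lemma extremal [Fintype V] [Nonempty ι] (e : ι → Finset V) (h4 : ∀ i, (e i).card = 4) (L : Finset ι)
    (h8 : ∀ J ⊆ L, 8 ≤ J.card → 19 ≤ (U e J).card) :
    6 * L.card ≤ (Fintype.card V).choose 2 + (90 * Fintype.card V + 24) := by
  obtain ⟨L', hL', hc, H⟩ := clean e h4 L h8
  have := count H
  omega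

end GRL


namespace GRL
open Finset
set_option linter.unusedSectionVars false

lemma lower {n c : ℕ} (hn : 18 ≤ n) (h : HasPQColoring n 18 146 c) :
    6 * n.choose 2 ≤ 6 * c + (n.choose 2 + (90 * n + 24)) := by
  classical
  obtain ⟨col, hcol, hS⟩ := h
  set PP := (Finset.univ : Finset (Fin n)).powersetCard 2 with hPP
  obtain ⟨r, hr⟩ : ∃ r : ℕ → Finset (Fin n), ∀ p ∈ PP, r (col p) ∈ PP ∧ col (r (col p)) = col p := by
    have : ∀ x : ℕ, ∃ q : Finset (Fin n), ∀ p ∈ PP, col p = x → q ∈ PP ∧ col q = x := by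
      intro x
      by_cases h : ∃ p ∈ PP, col p = x
      · obtain ⟨p, hp, hpx⟩ := h
        exact ⟨p, fun _ _ _ => ⟨hp, hpx⟩⟩
      · push Not at h
        exact ⟨∅, fun p hp hpx => absurd hpx (h p hp)⟩
    exact ⟨fun x => (this x).choose, fun p hp => (this (col p)).choose_spec p hp rfl⟩
  obtain ⟨e, he⟩ : ∃ e : Finset (Fin n) → Finset (Fin n), ∀ p, (e p).card = 4 ∧
      (p ∈ PP → p ∪ r (col p) ⊆ e p) := by
    have : ∀ p : Finset (Fin n), ∃ q : Finset (Fin n), q.card = 4 ∧ (p ∈ PP → p ∪ r (col p) ⊆ q) := by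
      intro p
      by_cases h : p ∈ PP
      · have h1 : (p ∪ r (col p)).card ≤ 4 := by
          have := Finset.card_union_le p (r (col p))
          have a := (Finset.mem_powersetCard.1 h).2
          have b := (Finset.mem_powersetCard.1 (hr p h).1).2
          omega
        obtain ⟨q, q1, q2, q3⟩ := Finset.exists_subsuperset_card_eq (Finset.subset_univ _) h1
          (by rw [Finset.card_univ, Fintype.card_fin]; omega)
        exact ⟨q, q3, fun _ => q1⟩
      · obtain ⟨q, q1, q2⟩ := Finset.exists_subset_card_eq (s := (Finset.univ : Finset (Fin n)))
          (n := 4) (by rw [Finset.card_univ, Fintype.card_fin]; omega)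
        exact ⟨q, q2, fun h' => absurd h' h⟩
    exact ⟨fun p => (this p).choose, fun p => (this p).choose_spec⟩
  set L := PP.filter (fun p => ¬ r (col p) = p) with hL
  have hsplit : (PP.filter (fun p => r (col p) = p)).card + L.card = PP.card := by
    rw [hL]
    convert Finset.card_filter_add_card_filter_not (s := PP) (fun p => r (col p) = p)
  have hle : (PP.filter (fun p => r (col p) = p)).card ≤ c := by
    have : (PP.filter (fun p => r (col p) = p)).card ≤ (Finset.range c).card := by
      refine Finset.card_le_card_of_injOn col (fun p _ => by simpa using hcol p) ?_
      intro p hp q hq hpq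
      have a := (Finset.mem_filter.1 hp).2
      have b := (Finset.mem_filter.1 hq).2
      rw [← a, ← b, hpq]
    simpa using this
  have h8 : ∀ J ⊆ L, 8 ≤ J.card → 19 ≤ (U e J).card := by
    intro J hJ hJc
    by_contra hcon
    push Not at hcon
    obtain ⟨S, s1, -, s3⟩ := Finset.exists_subsuperset_card_eq (n := 18)
      (Finset.subset_univ (U e J)) (by omega)
      (by rw [Finset.card_univ, Fintype.card_fin]; omega)
    have h1 := hS S s3
    have hmem : ∀ p ∈ J, p ∈ PP ∧ ¬ r (col p) = p := fun p hp => Finset.mem_filter.1 (hJ hp)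
    have hJS : J ⊆ S.powersetCard 2 := by
      intro p hp
      have := hmem p hp
      rw [Finset.mem_powersetCard]
      exact ⟨(Finset.subset_union_left.trans ((he p).2 this.1)).trans ((sub_U e hp).trans s1),
        (Finset.mem_powersetCard.1 this.1).2⟩
    have h2 : (S.powersetCard 2).image col ⊆ (S.powersetCard 2 \ J).image col := by
      intro x hx
      rw [Finset.mem_image] at hx ⊢
      obtain ⟨p, hp, rfl⟩ := hx
      by_cases hpJ : p ∈ J
      · have hm := hmem p hpJ
        have hrp := hr p hm.1
        refine ⟨r (col p), ?_, hrp.2⟩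
        rw [Finset.mem_sdiff, Finset.mem_powersetCard]
        refine ⟨⟨(Finset.subset_union_right.trans ((he p).2 hm.1)).trans ((sub_U e hpJ).trans s1),
          (Finset.mem_powersetCard.1 hrp.1).2⟩, ?_⟩
        intro hin
        have := (hmem _ hin).2
        rw [hrp.2] at this
        exact this rfl
      · exact ⟨p, Finset.mem_sdiff.2 ⟨hp, hpJ⟩, rfl⟩
    have h3 := (Finset.card_le_card h2).trans Finset.card_image_le
    rw [Finset.card_sdiff_of_subset hJS, Finset.card_powersetCard, s3] at h3
    have : Nat.choose 18 2 = 153 := rfl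
    omega
  have : Nonempty (Finset (Fin n)) := ⟨∅⟩
  have := extremal e (fun i => (he i).1) L h8
  rw [Fintype.card_fin] at this
  have h7 : PP.card = n.choose 2 := by
    rw [hPP, Finset.card_powersetCard, Finset.card_univ, Fintype.card_fin]
  omega

end GRL


namespace GRU
open Finset

/-- No small sets of members of `M` on few vertices. -/
def Good {n : ℕ} (M : Finset (Finset (Fin n))) : Prop :=
  ∀ C ⊆ M, 2 ≤ C.card → C.card ≤ 8 → 2 * C.card + 3 ≤ (C.biUnion id).card

lemma coloring_of_good {n : ℕ} (M : Finset (Finset (Fin n))) (h4 : ∀ m ∈ M, m.card = 4)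
    (hM : Good M) : HasPQColoring n 18 146 (n.choose 2 - M.card + 1) := by
  have hshare : ∀ m ∈ M, ∀ m' ∈ M, ∀ p : Finset (Fin n), p.card = 2 → p ⊆ m → p ⊆ m' → m = m' := by
    intro m hm m' hm' p hp h1 h2
    by_contra hne
    have := hM {m, m'} (by intro x hx; simp at hx; rcases hx with rfl | rfl <;> assumption)
      (Finset.card_pair hne).ge (by rw [Finset.card_pair hne]; norm_num)
    rw [Finset.card_pair hne] at this
    have hb : ({m, m'} : Finset (Finset (Fin n))).biUnion id = m ∪ m' := by simp
    rw [hb] at this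
    have h3 := Finset.card_union_add_card_inter m m'
    have h5 := Finset.card_le_card (Finset.subset_inter h1 h2)
    rw [h4 m hm, h4 m' hm'] at h3
    omega
  obtain ⟨α, hα⟩ : ∃ α : Finset (Fin n) → Finset (Fin n), ∀ m ∈ M, α m ⊆ m ∧ (α m).card = 2 := by
    have : ∀ m : Finset (Fin n), ∃ q, m ∈ M → q ⊆ m ∧ q.card = 2 := by
      intro m
      by_cases hm : m ∈ M
      · obtain ⟨q, hq⟩ := Finset.exists_subset_card_eq (s := m) (n := 2) (by rw [h4 m hm]; norm_num)
        exact ⟨q, fun _ => hq⟩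
      · exact ⟨∅, fun h => absurd h hm⟩
    exact ⟨fun m => (this m).choose, fun m => (this m).choose_spec⟩
  have hβ : ∀ m ∈ M, (m \ α m).card = 2 := by
    intro m hm
    rw [Finset.card_sdiff_of_subset (hα m hm).1, h4 m hm, (hα m hm).2]
  have hβinj : ∀ m ∈ M, ∀ m' ∈ M, m \ α m = m' \ α m' → m = m' := by
    intro m hm m' hm' h
    exact hshare m hm m' hm' (m \ α m) (hβ m hm) Finset.sdiff_subset (h ▸ Finset.sdiff_subset)
  have hαβ : ∀ m ∈ M, ∀ m' ∈ M, α m ≠ m' \ α m' := by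
    intro m hm m' hm' h
    have := hshare m hm m' hm' (α m) (hα m hm).2 (hα m hm).1 (h ▸ Finset.sdiff_subset)
    subst this
    have h1 : α m ∩ (m \ α m) = ∅ := Finset.inter_sdiff_self _ _
    rw [← h, Finset.inter_self] at h1
    have := (hα m hm).2
    rw [h1] at this
    simp at this
  set PP := (Finset.univ : Finset (Fin n)).powersetCard 2 with hPP
  set βM := M.image (fun m => m \ α m) with hβM
  have hβc : βM.card = M.card := Finset.card_image_of_injOn (fun m hm m' hm' h => hβinj m hm m' hm' h)
  have hβP : βM ⊆ PP := by
    intro p hp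
    rw [hβM, Finset.mem_image] at hp
    obtain ⟨m, hm, rfl⟩ := hp
    rw [hPP, Finset.mem_powersetCard]
    exact ⟨Finset.subset_univ _, hβ m hm⟩
  set X := PP \ βM with hX
  have hXc : X.card = n.choose 2 - M.card := by
    rw [hX, Finset.card_sdiff_of_subset hβP, hβc, hPP, Finset.card_powersetCard, Finset.card_univ,
      Fintype.card_fin]
  obtain ⟨rep, hrep1, hrep2⟩ : ∃ rep : Finset (Fin n) → Finset (Fin n),
      (∀ m ∈ M, rep (m \ α m) = α m) ∧ (∀ p, p ∉ βM → rep p = p) := by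
    have : ∀ p : Finset (Fin n), ∃ q, (∀ m ∈ M, p = m \ α m → q = α m) ∧ (p ∉ βM → q = p) := by
      intro p
      by_cases hp : p ∈ βM
      · obtain ⟨m, hm, hmp⟩ := Finset.mem_image.1 hp
        refine ⟨α m, ?_, fun h => absurd hp h⟩
        intro m' hm' h'
        rw [hβinj m hm m' hm' (hmp.trans h')]
      · refine ⟨p, ?_, fun _ => rfl⟩
        intro m hm h
        exact absurd (Finset.mem_image.2 ⟨m, hm, h.symm⟩) hp
    exact ⟨fun p => (this p).choose, fun m hm => (this _).choose_spec.1 m hm rfl,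
      fun p hp => (this p).choose_spec.2 hp⟩
  have hrepX : ∀ p ∈ PP, rep p ∈ X := by
    intro p hp
    by_cases hpβ : p ∈ βM
    · obtain ⟨m, hm, rfl⟩ := Finset.mem_image.1 hpβ
      rw [hrep1 m hm, hX, Finset.mem_sdiff]
      refine ⟨Finset.mem_powersetCard.2 ⟨Finset.subset_univ _, (hα m hm).2⟩, ?_⟩
      intro hin
      obtain ⟨m', hm', h'⟩ := Finset.mem_image.1 hin
      exact hαβ m hm m' hm' h'.symm
    · rw [hrep2 p hpβ, hX, Finset.mem_sdiff]; exact ⟨hp, hpβ⟩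
  refine ⟨fun p => if h : rep p ∈ X then (X.equivFin ⟨rep p, h⟩ : ℕ) else X.card, ?_, ?_⟩
  · intro p
    dsimp only
    split_ifs with h
    · have := (X.equivFin ⟨rep p, h⟩).2
      omega
    · omega
  · intro S hS
    set MS := M.filter (fun m => m ⊆ S) with hMS
    have h7 : MS.card ≤ 7 := by
      by_contra hcon
      push Not at hcon
      obtain ⟨C, hC, hCc⟩ := Finset.exists_subset_card_eq (Nat.succ_le_of_lt hcon)
      have h1 := hM C (hC.trans (Finset.filter_subset _ _)) (by omega) (by omega)
      have h2 : C.biUnion id ⊆ S := by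
        rw [Finset.biUnion_subset]
        intro m hm
        exact (Finset.mem_filter.1 (hC hm)).2
      have := Finset.card_le_card h2
      omega
    set Y := S.powersetCard 2 \ MS.image (fun m => m \ α m) with hY
    have hYc : 146 ≤ Y.card := by
      have h1 := Finset.le_card_sdiff (MS.image (fun m => m \ α m)) (S.powersetCard 2)
      have h2 : (MS.image (fun m => m \ α m)).card ≤ MS.card := Finset.card_image_le
      rw [Finset.card_powersetCard, hS, ← hY] at h1
      have : Nat.choose 18 2 = 153 := rfl
      omega
    have hYP : ∀ p ∈ Y, p ∈ PP := by
      intro p hp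
      have := (Finset.mem_powersetCard.1 (Finset.mem_sdiff.1 hp).1).2
      exact Finset.mem_powersetCard.2 ⟨Finset.subset_univ _, this⟩
    have hYS : ∀ p ∈ Y, p ⊆ S := fun p hp => (Finset.mem_powersetCard.1 (Finset.mem_sdiff.1 hp).1).1
    have hYn : ∀ m ∈ M, m \ α m ∈ Y → ¬ m ⊆ S := by
      intro m hm hp hmS
      exact (Finset.mem_sdiff.1 hp).2 (Finset.mem_image.2 ⟨m, Finset.mem_filter.2 ⟨hm, hmS⟩, rfl⟩)
    have hcross : ∀ m ∈ M, m \ α m ∈ Y → α m ∈ Y → False := by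
      intro m hm h1 h2
      apply hYn m hm h1
      rw [← Finset.sdiff_union_of_subset (hα m hm).1]
      exact Finset.union_subset (hYS _ h1) (hYS _ h2)
    refine hYc.trans ?_
    refine Finset.card_le_card_of_injOn
      (fun p => if h : rep p ∈ X then (X.equivFin ⟨rep p, h⟩ : ℕ) else X.card) ?_ ?_
    · intro p hp
      exact Finset.mem_coe.2 (Finset.mem_image_of_mem _ (Finset.mem_sdiff.1 hp).1)
    · intro p hp q hq hpq
      have hp := Finset.mem_coe.1 hp
      have hq := Finset.mem_coe.1 hq
      simp only [dif_pos (hrepX p (hYP p hp)), dif_pos (hrepX q (hYP q hq))] at hpq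
      have h1 := X.equivFin.injective (Fin.ext hpq)
      have h2 : rep p = rep q := congrArg Subtype.val h1
      by_cases hpβ : p ∈ βM
      · obtain ⟨m, hm, rfl⟩ := Finset.mem_image.1 hpβ
        rw [hrep1 m hm] at h2
        by_cases hqβ : q ∈ βM
        · obtain ⟨m', hm', rfl⟩ := Finset.mem_image.1 hqβ
          rw [hrep1 m' hm'] at h2
          have := hshare m hm m' hm' (α m) (hα m hm).2 (hα m hm).1 (h2 ▸ (hα m' hm').1)
          rw [this]
        · rw [hrep2 q hqβ] at h2
          exact (hcross m hm hp (h2 ▸ hq)).elim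
      · rw [hrep2 p hpβ] at h2
        by_cases hqβ : q ∈ βM
        · obtain ⟨m', hm', rfl⟩ := Finset.mem_image.1 hqβ
          rw [hrep1 m' hm'] at h2
          exact (hcross m' hm' hq (h2 ▸ hp)).elim
        · rw [hrep2 q hqβ] at h2; exact h2

end GRU


namespace GRU
open Finset

variable {n : ℕ}

/-- vertex set of a set of blocks -/
def un (C : Finset (Finset (Fin n))) : Finset (Fin n) := C.biUnion id

/-- all possible blocks -/
def Ed (n : ℕ) : Finset (Finset (Fin n)) := (Finset.univ : Finset (Fin n)).powersetCard 4

lemma mem_Ed {b : Finset (Fin n)} : b ∈ Ed n ↔ b.card = 4 := by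
  simp [Ed, Finset.mem_powersetCard]

lemma mem_un {C : Finset (Finset (Fin n))} {v : Fin n} : v ∈ un C ↔ ∃ b ∈ C, v ∈ b := by
  simp [un]

lemma un_union (J K : Finset (Finset (Fin n))) : un (J ∪ K) = un J ∪ un K := by
  simp [un, Finset.union_biUnion]

lemma un_mono {J K : Finset (Finset (Fin n))} (h : J ⊆ K) : un J ⊆ un K :=
  Finset.biUnion_subset_biUnion_of_subset_left _ h

lemma sub_un {J : Finset (Finset (Fin n))} {b : Finset (Fin n)} (h : b ∈ J) : b ⊆ un J :=
  Finset.subset_biUnion_of_mem id h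

lemma un_insert (k : Finset (Fin n)) (K : Finset (Finset (Fin n))) :
    un (insert k K) = k ∪ un K := by
  simp [un]

lemma un_singleton (k : Finset (Fin n)) : un {k} = k := by simp [un]

lemma un_pair (k l : Finset (Fin n)) : un {k, l} = k ∪ l := by simp [un]

lemma un_empty : un (∅ : Finset (Finset (Fin n))) = ∅ := by simp [un]

lemma card_un_insert (k : Finset (Fin n)) (K : Finset (Finset (Fin n))) :
    (un (insert k K)).card + (k ∩ un K).card = k.card + (un K).card := by
  rw [un_insert]; exact Finset.card_union_add_card_inter _ _

lemma card_un_union (J K : Finset (Finset (Fin n))) :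
    (un (J ∪ K)).card + (un J ∩ un K).card = (un J).card + (un K).card := by
  rw [un_union]; exact Finset.card_union_add_card_inter _ _

lemma card_un_le (C : Finset (Finset (Fin n))) (h : C ⊆ Ed n) : (un C).card ≤ 4 * C.card := by
  have : (C.biUnion id).card ≤ C.card * 4 :=
    Finset.card_biUnion_le_card_mul _ _ _ (fun b hb => (mem_Ed.1 (h hb)).le)
  rw [un]; omega

lemma inter_union_sdiff' {α : Type*} [DecidableEq α] (T S : Finset α) : T ∩ S ∪ T \ S = T := by
  ext x; simp only [Finset.mem_union, Finset.mem_inter, Finset.mem_sdiff]; tauto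

/-- forbidden configuration -/
def Bad (C : Finset (Finset (Fin n))) : Prop :=
  2 ≤ C.card ∧ C.card ≤ 8 ∧ (un C).card ≤ 2 * C.card + 2

/-- minimal forbidden configuration -/
def MinBad (C : Finset (Finset (Fin n))) : Prop := Bad C ∧ ∀ T, T ⊂ C → ¬ Bad T

lemma good_iff {M : Finset (Finset (Fin n))} : Good M ↔ ∀ C ⊆ M, ¬ Bad C := by
  unfold Good Bad un
  constructor
  · rintro h C hC ⟨h1, h2, h3⟩
    have := h C hC h1 h2
    omega
  · intro h C hC h1 h2
    have := h C hC
    by_contra hcon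
    exact this ⟨h1, h2, by omega⟩

lemma good_mono {M M' : Finset (Finset (Fin n))} (h : M ⊆ M') (hM : Good M') : Good M :=
  fun C hC => hM C (hC.trans h)

lemma MinBad.proper {C T : Finset (Finset (Fin n))} (h : MinBad C) (hT : T ⊂ C) (h2 : 2 ≤ T.card) :
    2 * T.card + 3 ≤ (un T).card := by
  by_contra hcon
  exact h.2 T hT ⟨h2, (Finset.card_le_card hT.subset).trans h.1.2.1, by omega⟩

lemma exists_minBad {C : Finset (Finset (Fin n))} (h : Bad C) : ∃ C' ⊆ C, MinBad C' := by
  induction C using Finset.strongInduction with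
  | H C ih =>
    by_cases hC : ∃ T, T ⊂ C ∧ Bad T
    · obtain ⟨T, hT, hTb⟩ := hC
      obtain ⟨C', hC', hm⟩ := ih T hT hTb
      exact ⟨C', hC'.trans hT.subset, hm⟩
    · push Not at hC
      exact ⟨C, subset_rfl, h, hC⟩

/-- the admissible class of pairs (open blocks, chosen blocks) -/
structure Cls (A B : Finset (Finset (Fin n))) : Prop where
  hA : A ⊆ Ed n
  hB : B ⊆ Ed n
  disj : Disjoint A B
  c1 : ∀ T ⊆ A ∪ B, T.Nonempty → 2 * T.card + 2 ≤ (un T).card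
  c2 : ∀ T ⊆ A ∪ B, Bad T → 2 ≤ (T ∩ A).card

/-- closing by a generic pair-sharing block -/
def GenI (A B : Finset (Finset (Fin n))) (h : Finset (Fin n)) : Prop :=
  h ∈ Ed n ∧ (h ∩ un (A ∪ B)).card = 2 ∧ ∃ a ∈ A, h ∩ un (A ∪ B) ⊆ a

/-- generic larger minimal configuration through `a` -/
def GenII (A B : Finset (Finset (Fin n))) (a : Finset (Fin n)) (C : Finset (Finset (Fin n))) : Prop :=
  MinBad C ∧ C ⊆ Ed n ∧ 3 ≤ C.card ∧ (un C).card = 2 * C.card + 2 ∧ a ∈ C ∧ un C ∩ un (A ∪ B) = a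

section closure
variable {A B : Finset (Finset (Fin n))}

lemma Cls.pair_AB (H : Cls A B) {a b : Finset (Fin n)} (ha : a ∈ A) (hb : b ∈ B) :
    (a ∩ b).card ≤ 1 := by
  by_contra hcon
  push Not at hcon
  have hne : a ≠ b := by rintro rfl; exact Finset.disjoint_left.1 H.disj ha hb
  have hc : ({a, b} : Finset (Finset (Fin n))).card = 2 := Finset.card_pair hne
  have h1 := Finset.card_union_add_card_inter a b
  rw [mem_Ed.1 (H.hA ha), mem_Ed.1 (H.hB hb)] at h1
  have := H.c2 {a, b} (by
    intro x hx; simp at hx; rcases hx with rfl | rfl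
    · exact Finset.mem_union_left _ ha
    · exact Finset.mem_union_right _ hb) ⟨by omega, by omega, by rw [un_pair]; omega⟩
  have h2 : ({a, b} : Finset (Finset (Fin n))) ∩ A ⊆ {a} := by
    intro x hx
    simp only [Finset.mem_inter, Finset.mem_insert, Finset.mem_singleton] at hx ⊢
    rcases hx with ⟨rfl | rfl, h⟩
    · rfl
    · exact absurd hb (Finset.disjoint_left.1 H.disj h)
  have := Finset.card_le_card h2
  simp at this
  omega

lemma Cls.pair_AA (H : Cls A B) {a b : Finset (Fin n)} (ha : a ∈ A) (hb : b ∈ A) (hne : a ≠ b) :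
    (a ∩ b).card ≤ 2 := by
  have hc : ({a, b} : Finset (Finset (Fin n))).card = 2 := Finset.card_pair hne
  have h1 := Finset.card_union_add_card_inter a b
  rw [mem_Ed.1 (H.hA ha), mem_Ed.1 (H.hA hb)] at h1
  have := H.c1 {a, b} (by
    intro x hx; simp at hx; rcases hx with rfl | rfl
    · exact Finset.mem_union_left _ ha
    · exact Finset.mem_union_left _ hb) ⟨a, by simp⟩
  rw [un_pair] at this
  omega

lemma GenI.notMem {h : Finset (Fin n)} (hI : GenI A B h) : h ∉ A ∪ B := by
  intro hmem
  have h1 := hI.2.1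
  rw [Finset.inter_eq_left.2 (sub_un hmem), mem_Ed.1 hI.1] at h1
  omega

lemma Cls.closeI (H : Cls A B) {h : Finset (Fin n)} (hI : GenI A B h) : Cls (insert h A) B := by
  have hn := hI.notMem
  obtain ⟨hE, h2, a, ha, hsub⟩ := hI
  have h4 := mem_Ed.1 hE
  rw [Finset.mem_union, not_or] at hn
  have hle : ∀ T ⊆ A ∪ B, (h ∩ un T).card ≤ 2 := fun T hT => by
    rw [← h2]; exact Finset.card_le_card (Finset.inter_subset_inter_left (un_mono hT))
  have hsplit : ∀ T ⊆ insert h A ∪ B, h ∈ T → T.erase h ⊆ A ∪ B := by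
    intro T hT _ x hx
    rw [Finset.mem_erase] at hx
    have := hT hx.2
    rw [Finset.insert_union, Finset.mem_insert] at this
    exact this.resolve_left hx.1
  have hsplit' : ∀ T ⊆ insert h A ∪ B, h ∉ T → T ⊆ A ∪ B := by
    intro T hT hT2 x hx
    have := hT hx
    rw [Finset.insert_union, Finset.mem_insert] at this
    exact this.resolve_left (fun h' => hT2 (h' ▸ hx))
  refine ⟨Finset.insert_subset hE H.hA, H.hB, ?_, ?_, ?_⟩
  · rw [Finset.disjoint_insert_left]; exact ⟨hn.2, H.disj⟩
  · intro T hT hTn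
    by_cases hhT : h ∈ T
    · have hT0 := hsplit T hT hhT
      have hi := card_un_insert h (T.erase h)
      rw [Finset.insert_erase hhT, h4] at hi
      have hl := hle _ hT0
      have hc := Finset.card_erase_add_one hhT
      by_cases hem : (T.erase h).Nonempty
      · have := H.c1 _ hT0 hem
        omega
      · rw [Finset.not_nonempty_iff_eq_empty] at hem
        rw [hem] at hi hc
        simp [un_empty] at hi hc
        omega
    · exact H.c1 T (hsplit' T hT hhT) hTn
  · intro T hT hbad
    by_cases hhT : h ∈ T
    · by_contra hcon
      push Not at hcon
      have hT0 := hsplit T hT hhT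
      have hi := card_un_insert h (T.erase h)
      rw [Finset.insert_erase hhT, h4] at hi
      have hl := hle _ hT0
      have hc := Finset.card_erase_add_one hhT
      have hA0 : T.erase h ∩ A = ∅ := by
        by_contra hne
        obtain ⟨x, hx⟩ := Finset.nonempty_iff_ne_empty.2 hne
        rw [Finset.mem_inter, Finset.mem_erase] at hx
        have hs : ({h, x} : Finset (Finset (Fin n))) ⊆ T ∩ insert h A := by
          intro y hy; simp at hy; rcases hy with rfl | rfl
          · simp [hhT]
          · simp [hx]
        have := Finset.card_le_card hs
        rw [Finset.card_pair hx.1.1.symm] at this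
        omega
      obtain ⟨b1, b2, b3⟩ := hbad
      by_cases hsz : 2 ≤ (T.erase h).card
      · have hnb : ¬ Bad (T.erase h) := by
          intro hb
          have := H.c2 _ hT0 hb
          rw [hA0] at this
          simp at this
        apply hnb
        refine ⟨hsz, by omega, ?_⟩
        omega
      · obtain ⟨b, hb⟩ := Finset.card_eq_one.1 (show (T.erase h).card = 1 by omega)
        have hbm : b ∈ T.erase h := by rw [hb]; simp
        have hbA : b ∉ A := by
          intro hbA
          have : b ∈ T.erase h ∩ A := Finset.mem_inter.2 ⟨hbm, hbA⟩
          rw [hA0] at this; simp at this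
        have hbB : b ∈ B := (Finset.mem_union.1 (hT0 hbm)).resolve_left hbA
        rw [hb, un_singleton, mem_Ed.1 (H.hB hbB)] at hi
        have hcc : T.card = 2 := by rw [hb] at hc; simpa using hc.symm
        have hin : h ∩ b = h ∩ un (A ∪ B) := Finset.eq_of_subset_of_card_le
          (Finset.inter_subset_inter_left (sub_un (Finset.mem_union_right _ hbB))) (by omega)
        have hab := H.pair_AB ha hbB
        have : h ∩ un (A ∪ B) ⊆ a ∩ b := Finset.subset_inter hsub (hin ▸ Finset.inter_subset_right)
        have := Finset.card_le_card this
        omega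
    · have := H.c2 T (hsplit' T hT hhT) hbad
      exact this.trans (Finset.card_le_card (Finset.inter_subset_inter_left (Finset.subset_insert _ _)))

lemma Cls.closeIII (H : Cls A B) {b : Finset (Fin n)} (hb : b ∈ B) : Cls (insert b A) (B.erase b) := by
  have hS : insert b A ∪ B.erase b = A ∪ B := by
    rw [Finset.insert_union, ← Finset.union_insert, Finset.insert_erase hb]
  refine ⟨Finset.insert_subset (H.hB hb) H.hA, (Finset.erase_subset _ _).trans H.hB, ?_, ?_, ?_⟩
  · rw [Finset.disjoint_insert_left]
    exact ⟨by simp, H.disj.mono_right (Finset.erase_subset _ _)⟩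
  · rw [hS]; exact H.c1
  · rw [hS]
    intro T hT hbad
    exact (H.c2 T hT hbad).trans
      (Finset.card_le_card (Finset.inter_subset_inter_left (Finset.subset_insert _ _)))

lemma GenII.notMem {a : Finset (Fin n)} {C : Finset (Finset (Fin n))} (ha4 : a.card = 4)
    (hII : GenII A B a C) {c : Finset (Fin n)} (hc : c ∈ C) (hca : c ≠ a) : c ∉ A ∪ B := by
  intro hmem
  obtain ⟨m, hE, -, -, haC, hU⟩ := hII
  have h1 : c ⊆ a := by
    rw [← hU]; exact Finset.subset_inter (sub_un hc) (sub_un hmem)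
  exact hca (Finset.eq_of_subset_of_card_le h1 (by rw [ha4, mem_Ed.1 (hE hc)]))

/-- `a` meets the rest of a tight minimal configuration in at least three points -/
lemma GenII.meet {a : Finset (Fin n)} {C : Finset (Finset (Fin n))} (ha4 : a.card = 4)
    (hII : GenII A B a C) : 3 ≤ (a ∩ un (C.erase a)).card := by
  obtain ⟨m, hE, h3, hc, haC, hU⟩ := hII
  have h1 := card_un_insert a (C.erase a)
  rw [Finset.insert_erase haC] at h1
  have h2 := Finset.card_erase_add_one haC
  have := m.proper (Finset.erase_ssubset haC) (by omega)
  omega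

lemma Cls.closeII (H : Cls A B) {a h : Finset (Fin n)} {C : Finset (Finset (Fin n))} (ha : a ∈ A)
    (hII : GenII A B a C) (hh : h ∈ C) (hha : h ≠ a) :
    Cls (insert h A) (B ∪ (C.erase a).erase h) := by
  have ha4 := mem_Ed.1 (H.hA ha)
  have hnm : ∀ c ∈ C, c ≠ a → c ∉ A ∪ B := fun c hc hca => hII.notMem ha4 hc hca
  have hmeet := hII.meet ha4
  obtain ⟨m, hE, h3, hc, haC, hU⟩ := hII
  have hhn := hnm h hh hha
  rw [Finset.mem_union, not_or] at hhn
  set S := A ∪ B with hS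
  -- splitting a subset
  have hspl : ∀ T ⊆ insert h A ∪ (B ∪ (C.erase a).erase h), T \ S ⊆ C.erase a := by
    intro T hT x hx
    rw [Finset.mem_sdiff, hS, Finset.mem_union, not_or] at hx
    have := hT hx.1
    simp only [Finset.mem_union, Finset.mem_insert, Finset.mem_erase] at this
    rw [Finset.mem_erase]
    rcases this with (rfl | h') | h' | h'
    · exact ⟨hha, hh⟩
    · exact absurd h' hx.2.1
    · exact absurd h' hx.2.2
    · exact h'.2
  have hval : ∀ T ⊆ insert h A ∪ (B ∪ (C.erase a).erase h), 
      (un (T ∩ S)).card + (un (insert a (T \ S))).card ≤ (un T).card + 4 := by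
    intro T hT
    have h1 := card_un_union (T ∩ S) (T \ S)
    rw [inter_union_sdiff'] at h1
    have h2 := card_un_insert a (T \ S)
    have h5 : un (T ∩ S) ∩ un (T \ S) ⊆ a ∩ un (T \ S) := by
      refine Finset.subset_inter ?_ Finset.inter_subset_right
      rw [← hU, Finset.inter_comm]
      exact Finset.inter_subset_inter (un_mono ((hspl T hT).trans (Finset.erase_subset _ _)))
        (un_mono Finset.inter_subset_right)
    have := Finset.card_le_card h5
    omega
  have haT : ∀ T ⊆ insert h A ∪ (B ∪ (C.erase a).erase h), a ∉ T \ S := by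
    intro T _ hx
    exact (Finset.mem_sdiff.1 hx).2 (Finset.mem_union_left _ ha)
  have hsubC : ∀ T ⊆ insert h A ∪ (B ∪ (C.erase a).erase h), insert a (T \ S) ⊆ C := by
    intro T hT
    exact Finset.insert_subset haC ((hspl T hT).trans (Finset.erase_subset _ _))
  have hins : ∀ T ⊆ insert h A ∪ (B ∪ (C.erase a).erase h), (T \ S).Nonempty →
      2 * (T \ S).card + 4 ≤ (un (insert a (T \ S))).card ∧
      (insert a (T \ S) ≠ C → 2 * (T \ S).card + 5 ≤ (un (insert a (T \ S))).card) := by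
    intro T hT hne
    have h1 : (insert a (T \ S)).card = (T \ S).card + 1 := Finset.card_insert_of_notMem (haT T hT)
    have h2 := Finset.card_pos.2 hne
    by_cases heq : insert a (T \ S) = C
    · rw [heq] at h1 ⊢
      exact ⟨by omega, fun h => absurd rfl h⟩
    · have := m.proper (Finset.ssubset_iff_subset_ne.2 ⟨hsubC T hT, heq⟩) (by omega)
      exact ⟨by omega, fun _ => by omega⟩
  have hcard : ∀ T : Finset (Finset (Fin n)), (T ∩ S).card + (T \ S).card = T.card := by
    intro T; rw [add_comm]; exact Finset.card_sdiff_add_card_inter T S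
  have hTS : ∀ T : Finset (Finset (Fin n)), T \ S = ∅ → T ⊆ S := fun T h =>
    Finset.sdiff_eq_empty_iff_subset.1 h
  refine ⟨Finset.insert_subset (hE hh) H.hA, Finset.union_subset H.hB
    ((Finset.erase_subset _ _).trans ((Finset.erase_subset _ _).trans hE)), ?_, ?_, ?_⟩
  · rw [Finset.disjoint_insert_left, Finset.disjoint_union_right]
    refine ⟨by simp [hhn.2], H.disj, ?_⟩
    rw [Finset.disjoint_right]
    intro x hx hxA
    simp only [Finset.mem_erase] at hx
    exact hnm x hx.2.2 hx.2.1 (Finset.mem_union_left _ hxA)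
  · intro T hT hTn
    by_cases h2 : (T \ S).Nonempty
    · have hi := (hins T hT h2).1
      have hv := hval T hT
      have hk := hcard T
      by_cases h1 : (T ∩ S).Nonempty
      · have := H.c1 (T ∩ S) Finset.inter_subset_right h1
        omega
      · rw [Finset.not_nonempty_iff_eq_empty] at h1
        have hTC : T ⊆ C.erase a := by
          have := hspl T hT
          rwa [Finset.sdiff_eq_self_of_disjoint (Finset.disjoint_iff_inter_eq_empty.2 h1)] at this
        have hp := Finset.card_pos.2 hTn
        by_cases hsz : 2 ≤ T.card
        · have := m.proper (lt_of_le_of_lt hTC (Finset.erase_ssubset haC)) hsz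
          omega
        · obtain ⟨b, rfl⟩ := Finset.card_eq_one.1 (show T.card = 1 by omega)
          have : b ∈ C := Finset.mem_of_mem_erase (hTC (by simp))
          rw [un_singleton, mem_Ed.1 (hE this)]
          simp
    · rw [Finset.not_nonempty_iff_eq_empty] at h2
      exact H.c1 T (hTS T h2) hTn
  · intro T hT hbad
    by_contra hcon
    push Not at hcon
    have hmono : (T ∩ A).card ≤ (T ∩ insert h A).card :=
      Finset.card_le_card (Finset.inter_subset_inter_left (Finset.subset_insert _ _))
    by_cases h2 : (T \ S).Nonempty
    · have hi := hins T hT h2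
      have hv := hval T hT
      have hk := hcard T
      have hb := hbad
      obtain ⟨b1, b2, b3⟩ := hb
      by_cases h1 : (T ∩ S).Nonempty
      · have hc1 := H.c1 (T ∩ S) Finset.inter_subset_right h1
        by_cases heq : insert a (T \ S) = C
        · have hhT : h ∈ T \ S := by
            have : h ∈ insert a (T \ S) := by rw [heq]; exact hh
            exact (Finset.mem_insert.1 this).resolve_left hha
          have hhT' := (Finset.mem_sdiff.1 hhT).1
          have hA0 : T ∩ A = ∅ := by
            by_contra hne
            obtain ⟨x, hx⟩ := Finset.nonempty_iff_ne_empty.2 hne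
            rw [Finset.mem_inter] at hx
            have hxh : h ≠ x := by rintro rfl; exact hhn.1 hx.2
            have hs : ({h, x} : Finset (Finset (Fin n))) ⊆ T ∩ insert h A := by
              intro y hy; simp at hy; rcases hy with rfl | rfl
              · simp [hhT']
              · simp [hx]
            have := Finset.card_le_card hs
            rw [Finset.card_pair hxh] at this
            omega
          by_cases hsz : 2 ≤ (T ∩ S).card
          · have hnb : ¬ Bad (T ∩ S) := by
              intro hb
              have hq : 2 ≤ (T ∩ S ∩ A).card := H.c2 _ Finset.inter_subset_right hb
              have hss : T ∩ S ∩ A ⊆ T ∩ A :=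
                Finset.inter_subset_inter_right Finset.inter_subset_left
              have hw := Finset.card_le_card hss
              rw [hA0, Finset.card_empty] at hw
              omega
            apply hnb
            exact ⟨hsz, by omega, by omega⟩
          · have hp := Finset.card_pos.2 h1
            obtain ⟨b, hb⟩ := Finset.card_eq_one.1 (show (T ∩ S).card = 1 by omega)
            have hbm : b ∈ T ∩ S := by rw [hb]; simp
            rw [Finset.mem_inter] at hbm
            have hbA : b ∉ A := by
              intro hbA
              have : b ∈ T ∩ A := Finset.mem_inter.2 ⟨hbm.1, hbA⟩
              rw [hA0] at this; simp at this
            have hbB : b ∈ B := (Finset.mem_union.1 hbm.2).resolve_left hbA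
            have hab := H.pair_AB ha hbB
            have heq2 : T \ S = C.erase a := by
              rw [← heq, Finset.erase_insert (haT T hT)]
            have hu1 := card_un_union (T ∩ S) (T \ S)
            rw [inter_union_sdiff', hb, un_singleton, mem_Ed.1 (H.hB hbB), heq2] at hu1
            have hsub : b ∩ un (C.erase a) ⊆ a ∩ b := by
              refine Finset.subset_inter ?_ Finset.inter_subset_left
              rw [← hU, Finset.inter_comm b]
              exact Finset.inter_subset_inter (un_mono (Finset.erase_subset _ _)) (sub_un hbm.2)
            have hle := Finset.card_le_card hsub
            have hins2 := card_un_insert a (C.erase a)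
            rw [Finset.insert_erase haC, ha4] at hins2
            have hce := Finset.card_erase_add_one haC
            rw [heq2, hb] at hk
            simp only [Finset.card_singleton] at hk
            omega
        · have := hi.2 heq
          omega
      · rw [Finset.not_nonempty_iff_eq_empty] at h1
        have hTC : T ⊆ C.erase a := by
          have := hspl T hT
          rwa [Finset.sdiff_eq_self_of_disjoint (Finset.disjoint_iff_inter_eq_empty.2 h1)] at this
        exact m.2 T (lt_of_le_of_lt hTC (Finset.erase_ssubset haC)) hbad
    · rw [Finset.not_nonempty_iff_eq_empty] at h2
      have := H.c2 T (hTS T h2) hbad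
      omega

end closure
end GRU


namespace GRU
open Finset

variable {n : ℕ}

open Classical in
/-- open (available) blocks -/
noncomputable def Op (M : Finset (Finset (Fin n))) : Finset (Finset (Fin n)) :=
  (Ed n).filter (fun e => e ∉ M ∧ Good (insert e M))

lemma mem_Op {M : Finset (Finset (Fin n))} {e : Finset (Fin n)} :
    e ∈ Op M ↔ e ∈ Ed n ∧ e ∉ M ∧ Good (insert e M) := by
  classical
  simp [Op]

/-- one step of the process -/
noncomputable def step (M : Finset (Finset (Fin n))) (h : Finset (Fin n)) : Finset (Finset (Fin n)) :=
  if h ∈ Op M then insert h M else M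

/-- reachable states -/
def Rc (M : Finset (Finset (Fin n))) : Prop := M ⊆ Ed n ∧ Good M

lemma Rc_empty : Rc (∅ : Finset (Finset (Fin n))) := by
  refine ⟨by simp, ?_⟩
  intro C hC h2
  rw [Finset.subset_empty.1 hC] at h2
  simp at h2

lemma Rc_step {M : Finset (Finset (Fin n))} (hM : Rc M) (h : Finset (Fin n)) : Rc (step M h) := by
  unfold step
  split_ifs with hh
  · rw [mem_Op] at hh
    exact ⟨Finset.insert_subset hh.1 hM.1, hh.2.2⟩
  · exact hM

/-- one step averaging operator -/
noncomputable def opL (F : Finset (Finset (Fin n)) → ℝ) : Finset (Finset (Fin n)) → ℝ :=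
  fun M => (∑ h ∈ Ed n, F (step M h)) / ((Ed n).card : ℝ)

/-- expectation after `t` steps -/
noncomputable def ex : ℕ → (Finset (Finset (Fin n)) → ℝ) → ℝ
  | 0, F => F ∅
  | t + 1, F => ex t (opL F)

lemma opL_sum {ι : Type*} (s : Finset ι) (c : ι → ℝ) (F : ι → Finset (Finset (Fin n)) → ℝ) :
    opL (fun M => ∑ i ∈ s, c i * F i M) = fun M => ∑ i ∈ s, c i * opL (F i) M := by
  funext M
  unfold opL
  rw [Finset.sum_comm, Finset.sum_div]
  refine Finset.sum_congr rfl fun i _ => ?_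
  rw [← Finset.mul_sum, mul_div_assoc]

lemma ex_sum {ι : Type*} (t : ℕ) (s : Finset ι) (c : ι → ℝ) (F : ι → Finset (Finset (Fin n)) → ℝ) :
    ex t (fun M => ∑ i ∈ s, c i * F i M) = ∑ i ∈ s, c i * ex t (F i) := by
  induction t generalizing F with
  | zero => simp [ex]
  | succ t ih => simp only [ex]; rw [opL_sum, ih]

lemma ex_sum' {ι : Type*} (t : ℕ) (s : Finset ι) (F : ι → Finset (Finset (Fin n)) → ℝ) :
    ex t (fun M => ∑ i ∈ s, F i M) = ∑ i ∈ s, ex t (F i) := by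
  have := ex_sum t s (fun _ => 1) F
  simpa using this

lemma ex_smul (t : ℕ) (c : ℝ) (F : Finset (Finset (Fin n)) → ℝ) :
    ex t (fun M => c * F M) = c * ex t F := by
  have := ex_sum t {()} (fun _ => c) (fun _ => F)
  simpa using this

lemma ex_add (t : ℕ) (F G : Finset (Finset (Fin n)) → ℝ) :
    ex t (fun M => F M + G M) = ex t F + ex t G := by
  have := ex_sum' t (Finset.univ : Finset Bool) (fun b => if b then F else G)
  simpa using this

lemma ex_sub (t : ℕ) (F G : Finset (Finset (Fin n)) → ℝ) :
    ex t (fun M => F M - G M) = ex t F - ex t G := by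
  have h1 := ex_add t F (fun M => (-1) * G M)
  rw [ex_smul] at h1
  simp only [sub_eq_add_neg]
  simpa using h1

lemma ex_mono (t : ℕ) {F G : Finset (Finset (Fin n)) → ℝ} (h : ∀ M, Rc M → F M ≤ G M) :
    ex t F ≤ ex t G := by
  induction t generalizing F G with
  | zero => exact h _ Rc_empty
  | succ t ih =>
    simp only [ex]
    refine ih fun M hM => ?_
    unfold opL
    gcongr with e he
    exact h _ (Rc_step hM e)

lemma ex_const (hN : 0 < (Ed n).card) (t : ℕ) (c : ℝ) :
    ex t (fun _ : Finset (Finset (Fin n)) => c) = c := by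
  induction t with
  | zero => rfl
  | succ t ih =>
    simp only [ex]
    have : opL (fun _ : Finset (Finset (Fin n)) => c) = fun _ => c := by
      funext M
      unfold opL
      rw [Finset.sum_const, nsmul_eq_mul]
      field_simp
    rw [this, ih]

lemma ex_nonneg (t : ℕ) {F : Finset (Finset (Fin n)) → ℝ} (h : ∀ M, Rc M → 0 ≤ F M) :
    0 ≤ ex t F := by
  have := ex_mono t (F := fun M => (0:ℝ) * F M) (G := F) (fun M hM => by simpa using h M hM)
  rw [ex_smul] at this
  simpa using this

lemma ex_abs (t : ℕ) {F G : Finset (Finset (Fin n)) → ℝ} (h : ∀ M, Rc M → |F M| ≤ G M) :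
    |ex t F| ≤ ex t G := by
  rw [abs_le]
  constructor
  · have := ex_mono t (F := fun M => (-1) * G M) (G := F) (fun M hM => by
      have := abs_le.1 (h M hM); linarith)
    rw [ex_smul] at this
    linarith
  · exact ex_mono t (fun M hM => (le_abs_self _).trans (h M hM))

/-- if the expectation is large then some reachable state has a large value -/
lemma exists_of_ex (hN : 0 < (Ed n).card) (t : ℕ) {F : Finset (Finset (Fin n)) → ℝ} {x : ℝ}
    (h : x < ex t F) : ∃ M, Rc M ∧ x ≤ F M := by
  by_contra hcon
  push Not at hcon
  have := ex_mono t (F := F) (G := fun _ => x) (fun M hM => (hcon M hM).le)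
  rw [ex_const hN] at this
  linarith

/-- indicator of containment -/
noncomputable def iB (B M : Finset (Finset (Fin n))) : ℝ := if B ⊆ M then 1 else 0

lemma iB_nonneg (B M : Finset (Finset (Fin n))) : 0 ≤ iB B M := by
  unfold iB; split_ifs <;> norm_num

lemma iB_le_one (B M : Finset (Finset (Fin n))) : iB B M ≤ 1 := by
  unfold iB; split_ifs <;> norm_num

lemma iB_of_sub {B M : Finset (Finset (Fin n))} (h : B ⊆ M) : iB B M = 1 := by
  unfold iB; simp [h]

lemma opL_iB (hN : 0 < (Ed n).card) (B M : Finset (Finset (Fin n))) :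
    opL (iB B) M ≤ iB B M + (1 / ((Ed n).card : ℝ)) * ∑ b ∈ B, iB (B.erase b) M := by
  unfold opL
  have hN' : (0:ℝ) < (Ed n).card := by exact_mod_cast hN
  have h1 : ∀ h ∈ Ed n, iB B (step M h) ≤ iB B M + ∑ b ∈ B, if h = b then iB (B.erase b) M else 0 := by
    intro h _
    have hs : 0 ≤ ∑ b ∈ B, (if h = b then iB (B.erase b) M else 0) :=
      Finset.sum_nonneg fun b _ => by split_ifs; exacts [iB_nonneg _ _, le_rfl]
    by_cases hBM : B ⊆ M
    · rw [iB_of_sub hBM]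
      linarith [iB_le_one B (step M h)]
    · by_cases hBs : B ⊆ step M h
      · have hb : h ∈ B ∧ B.erase h ⊆ M := by
          unfold step at hBs
          split_ifs at hBs with hO
          · refine ⟨?_, ?_⟩
            · by_contra hh
              apply hBM
              intro x hx
              exact (Finset.mem_insert.1 (hBs hx)).resolve_left (fun e => hh (e ▸ hx))
            · intro x hx
              rw [Finset.mem_erase] at hx
              exact (Finset.mem_insert.1 (hBs hx.2)).resolve_left hx.1
          · exact absurd hBs hBM
        rw [iB_of_sub hBs]
        rw [Finset.sum_ite_eq, if_pos hb.1, iB_of_sub hb.2]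
        linarith [iB_nonneg B M]
      · have : iB B (step M h) = 0 := by unfold iB; simp [hBs]
        rw [this]
        linarith [iB_nonneg B M]
  have h2 := Finset.sum_le_sum h1
  rw [Finset.sum_add_distrib, Finset.sum_const, nsmul_eq_mul, Finset.sum_comm] at h2
  have h3 : ∑ b ∈ B, ∑ h ∈ Ed n, (if h = b then iB (B.erase b) M else 0) ≤ ∑ b ∈ B, iB (B.erase b) M := by
    refine Finset.sum_le_sum fun b _ => ?_
    rw [Finset.sum_ite_eq']
    split_ifs
    · exact le_rfl
    · exact iB_nonneg _ _
  rw [div_le_iff₀ hN']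
  have : (iB B M + 1 / ((Ed n).card : ℝ) * ∑ b ∈ B, iB (B.erase b) M) * ((Ed n).card : ℝ)
      = ((Ed n).card : ℝ) * iB B M + ∑ b ∈ B, iB (B.erase b) M := by
    field_simp
  rw [this]
  linarith

lemma ex_iB (hN : 0 < (Ed n).card) (t : ℕ) (B : Finset (Finset (Fin n))) :
    ex t (iB B) ≤ ((t : ℝ) / ((Ed n).card : ℝ)) ^ B.card := by
  have hN' : (0:ℝ) < (Ed n).card := by exact_mod_cast hN
  induction t generalizing B with
  | zero =>
    simp only [ex, iB, Finset.subset_empty]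
    split_ifs with h
    · simp [h]
    · positivity
  | succ t ih =>
    simp only [ex]
    have h1 := ex_mono t (F := opL (iB B))
      (G := fun M => iB B M + (1 / ((Ed n).card : ℝ)) * ∑ b ∈ B, iB (B.erase b) M)
      (fun M _ => opL_iB hN B M)
    rw [ex_add, ex_smul, ex_sum'] at h1
    refine h1.trans ?_
    set N : ℝ := ((Ed n).card : ℝ)
    rcases Nat.eq_zero_or_pos B.card with h0 | hpos
    · rw [Finset.card_eq_zero] at h0
      have := ih B
      subst h0
      simpa using this
    obtain ⟨k, hk⟩ : ∃ k, B.card = k + 1 := ⟨B.card - 1, by omega⟩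
    have h2 : ∑ b ∈ B, ex t (iB (B.erase b)) ≤ ∑ b ∈ B, ((t:ℝ)/N)^k := by
      refine Finset.sum_le_sum fun b hb => ?_
      have := ih (B.erase b)
      rwa [Finset.card_erase_of_mem hb, hk, Nat.add_sub_cancel] at this
    rw [Finset.sum_const, nsmul_eq_mul, hk] at h2
    have h3 := ih B
    rw [hk] at h3 ⊢
    have h4 : ((t:ℝ)/N)^(k+1) + (1/N) * (((k+1 : ℕ):ℝ) * ((t:ℝ)/N)^k) ≤ (((t+1 : ℕ):ℝ)/N)^(k+1) := by
      have hb : ∀ x y : ℝ, 0 ≤ x → 0 ≤ y → x^(k+1) + ((k+1 : ℕ):ℝ) * x^k * y ≤ (x+y)^(k+1) := by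
        intro x y hx hy
        clear h1 h2 h3 hk ih hpos
        induction k with
        | zero => simp
        | succ k ih =>
          have : (x+y)^(k+1+1) = (x+y) * (x+y)^(k+1) := by ring
          rw [this]
          have h5 : 0 ≤ x ^ (k+1) := by positivity
          have h6 : 0 ≤ ((k+1 : ℕ):ℝ) * x^k * y := by positivity
          calc x^(k+1+1) + ((k+1+1 : ℕ):ℝ) * x^(k+1) * y
              ≤ (x+y) * (x^(k+1) + ((k+1 : ℕ):ℝ) * x^k * y) := by
                push_cast
                have : 0 ≤ ((k:ℝ)+1) * x^k * y * y := by positivity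
                ring_nf
                ring_nf at this
                linarith
            _ ≤ _ := by gcongr
      have := hb ((t:ℝ)/N) (1/N) (by positivity) (by positivity)
      calc _ = ((t:ℝ)/N)^(k+1) + ((k+1 : ℕ):ℝ) * ((t:ℝ)/N)^k * (1/N) := by ring
        _ ≤ _ := this
        _ = _ := by push_cast; ring
    have h5 : (1/N) * ∑ b ∈ B, ex t (iB (B.erase b)) ≤ (1/N) * (((k+1 : ℕ):ℝ) * ((t:ℝ)/N)^k) := by
      gcongr
    linarith

end GRU


namespace GRU
open Finset

variable {n : ℕ}

/-- indicator of `A` open and `B` chosen -/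
noncomputable def ind (A B M : Finset (Finset (Fin n))) : ℝ := if A ⊆ Op M ∧ B ⊆ M then 1 else 0

open Classical in
noncomputable def G1 (A B : Finset (Finset (Fin n))) : Finset (Finset (Fin n)) :=
  (Ed n).filter (GenI A B)

open Classical in
noncomputable def G2 (A B : Finset (Finset (Fin n))) :
    Finset (Finset (Fin n) × Finset (Finset (Fin n))) :=
  (A ×ˢ (Ed n).powerset).filter (fun x => GenII A B x.1 x.2)

/-- dense extensions of the block set `S` -/
noncomputable def Jk (S : Finset (Finset (Fin n))) : Finset (Finset (Finset (Fin n))) :=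
  (Ed n).powerset.filter
    (fun Q => Disjoint Q S ∧ 1 ≤ Q.card ∧ Q.card ≤ 16 ∧ (un Q \ un S).card + 1 ≤ 2 * Q.card)

lemma mem_G1 {A B : Finset (Finset (Fin n))} {h : Finset (Fin n)} : h ∈ G1 A B ↔ GenI A B h := by
  classical
  simp only [G1, Finset.mem_filter, and_iff_right_iff_imp]
  exact fun h => h.1

lemma mem_G2 {A B : Finset (Finset (Fin n))} {x : Finset (Fin n) × Finset (Finset (Fin n))} :
    x ∈ G2 A B ↔ x.1 ∈ A ∧ GenII A B x.1 x.2 := by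
  classical
  simp only [G2, Finset.mem_filter, Finset.mem_product, Finset.mem_powerset]
  exact ⟨fun h => ⟨h.1.1, h.2⟩, fun h => ⟨⟨h.1, h.2.2.1⟩, h.2⟩⟩

lemma mem_Jk {S Q : Finset (Finset (Fin n))} : Q ∈ Jk S ↔
    Q ⊆ Ed n ∧ Disjoint Q S ∧ 1 ≤ Q.card ∧ Q.card ≤ 16 ∧ (un Q \ un S).card + 1 ≤ 2 * Q.card := by
  simp [Jk]

lemma killer {M : Finset (Finset (Fin n))} {a h : Finset (Fin n)} (ha : a ∈ Op M) (hh : h ∈ Op M)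
    (hne : a ≠ h) (hk : a ∉ Op (insert h M)) :
    ∃ C, MinBad C ∧ C ⊆ insert a (insert h M) ∧ a ∈ C ∧ h ∈ C := by
  rw [mem_Op] at ha hh hk
  have h1 : ¬ Good (insert a (insert h M)) := by
    intro hg
    exact hk ⟨ha.1, by simp [hne, ha.2.1], hg⟩
  rw [good_iff] at h1
  push Not at h1
  obtain ⟨C0, hC0, hb⟩ := h1
  obtain ⟨C, hC, hm⟩ := exists_minBad hb
  have hsub := hC.trans hC0
  refine ⟨C, hm, hsub, ?_, ?_⟩
  · by_contra haC
    refine good_iff.1 hh.2.2 C ?_ hm.1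
    intro x hx
    exact (Finset.mem_insert.1 (hsub hx)).resolve_left (fun e => haC (e ▸ hx))
  · by_contra haC
    refine good_iff.1 ha.2.2 C ?_ hm.1
    intro x hx
    have := hsub hx
    simp only [Finset.mem_insert] at this ⊢
    rcases this with h' | h' | h'
    · exact Or.inl h'
    · exact absurd (h' ▸ hx) haC
    · exact Or.inr h'

lemma junk_of {C S : Finset (Finset (Fin n))} (m : MinBad C) (hE : C ⊆ Ed n)
    (h2 : 2 ≤ (C ∩ S).card) (hne : (C \ S).Nonempty) : C \ S ∈ Jk S := by
  have hcard := Finset.card_sdiff_add_card_inter C S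
  have hpos := Finset.card_pos.2 hne
  have hlt : C ∩ S ⊂ C := by
    refine Finset.ssubset_iff_subset_ne.2 ⟨Finset.inter_subset_left, ?_⟩
    intro heq
    rw [heq] at hcard
    omega
  have hp := m.proper hlt h2
  obtain ⟨⟨b1, b2, b3⟩, -⟩ := m
  rw [mem_Jk]
  refine ⟨Finset.sdiff_subset.trans hE, Finset.sdiff_disjoint, hpos, by omega, ?_⟩
  have h3 : un (C \ S) \ un S ⊆ un C \ un (C ∩ S) :=
    Finset.sdiff_subset_sdiff (un_mono Finset.sdiff_subset) (un_mono Finset.inter_subset_right)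
  have h4 := Finset.card_le_card h3
  rw [Finset.card_sdiff_of_subset (un_mono Finset.inter_subset_left)] at h4
  omega

section ptw
variable {A B M : Finset (Finset (Fin n))}

lemma loss_cases (hM : Rc M) (hAO : A ⊆ Op M) (hBM : B ⊆ M) {a h : Finset (Fin n)}
    (hh : h ∈ Op M) (hhA : h ∉ A) (ha : a ∈ A) (hk : a ∉ Op (insert h M)) :
    (∃ Q ∈ Jk (A ∪ B), h ∈ Q ∧ Q.erase h ⊆ M) ∨ GenI A B h ∨
      ∃ C, GenII A B a C ∧ h ∈ C ∧ h ≠ a ∧ (C.erase a).erase h ⊆ M := by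
  have hah : a ≠ h := by rintro rfl; exact hhA ha
  have haO := hAO ha
  obtain ⟨C, m, hsub, haC, hhC⟩ := killer haO hh hah hk
  rw [mem_Op] at hh haO
  have hE : C ⊆ Ed n := hsub.trans
    (Finset.insert_subset haO.1 (Finset.insert_subset hh.1 hM.1))
  have hhS : h ∉ A ∪ B := by
    rw [Finset.mem_union, not_or]
    exact ⟨hhA, fun hb => hh.2.1 (hBM hb)⟩
  have hAM : ∀ x ∈ A, x ∉ M := fun x hx => (mem_Op.1 (hAO hx)).2.1
  have ha4 := mem_Ed.1 haO.1
  have hh4 := mem_Ed.1 hh.1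
  have hCS : (C \ (A ∪ B)).erase h ⊆ M := by
    intro x hx
    rw [Finset.mem_erase, Finset.mem_sdiff] at hx
    have := hsub hx.2.1
    simp only [Finset.mem_insert] at this
    rcases this with rfl | rfl | h'
    · exact absurd (Finset.mem_union_left _ ha) hx.2.2
    · exact absurd rfl hx.1
    · exact h'
  have hhQ : h ∈ C \ (A ∪ B) := Finset.mem_sdiff.2 ⟨hhC, hhS⟩
  have haT : a ∈ C ∩ (A ∪ B) := Finset.mem_inter.2 ⟨haC, Finset.mem_union_left _ ha⟩
  by_cases h3 : 3 ≤ C.card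
  · by_cases hT : 2 ≤ (C ∩ (A ∪ B)).card
    · exact Or.inl ⟨_, junk_of m hE hT ⟨h, hhQ⟩, hhQ, hCS⟩
    · have hTa : C ∩ (A ∪ B) = {a} := by
        refine (Finset.eq_of_subset_of_card_le (Finset.singleton_subset_iff.2 haT) ?_).symm
        rw [Finset.card_singleton]; omega
      have hsd : C \ (A ∪ B) = C.erase a := by
        rw [← Finset.sdiff_inter_self_left, hTa, Finset.sdiff_singleton_eq_erase]
      have hasub : a ⊆ un C ∩ un (A ∪ B) := Finset.subset_inter (sub_un haC)
        (sub_un (Finset.mem_union_left _ ha))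
      by_cases hgen : (un C).card = 2 * C.card + 2 ∧ un C ∩ un (A ∪ B) = a
      · right; right
        exact ⟨C, ⟨m, hE, h3, hgen.1, haC, hgen.2⟩, hhC, hah.symm, by rw [← hsd]; exact hCS⟩
      · left
        refine ⟨_, mem_Jk.2 ⟨Finset.sdiff_subset.trans hE, Finset.sdiff_disjoint, ?_, ?_, ?_⟩, hhQ, hCS⟩
        · exact Finset.card_pos.2 ⟨h, hhQ⟩
        · exact (Finset.card_le_card Finset.sdiff_subset).trans (m.1.2.1.trans (by norm_num))
        · have h5 : (un (C \ (A ∪ B)) \ un (A ∪ B)).card ≤ (un C \ un (A ∪ B)).card :=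
            Finset.card_le_card (Finset.sdiff_subset_sdiff (un_mono Finset.sdiff_subset) subset_rfl)
          have h6 := Finset.card_sdiff_add_card_inter (un C) (un (A ∪ B))
          have h7 := m.1.2.2
          have h8 : (C \ (A ∪ B)).card + 1 = C.card := by
            rw [hsd]; exact Finset.card_erase_add_one haC
          have h9 := Finset.card_le_card hasub
          by_cases h10 : un C ∩ un (A ∪ B) = a
          · have : (un C).card ≠ 2 * C.card + 2 := fun e => hgen ⟨e, h10⟩
            omega
          · have : a.card < (un C ∩ un (A ∪ B)).card :=
              Finset.card_lt_card (Finset.ssubset_iff_subset_ne.2 ⟨hasub, fun e => h10 e.symm⟩)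
            omega
  · have hC2 : C.card = 2 := by have := m.1.1; omega
    have hCeq : C = {a, h} := by
      refine (Finset.eq_of_subset_of_card_le ?_ ?_).symm
      · intro x hx; simp at hx; rcases hx with rfl | rfl <;> assumption
      · rw [Finset.card_pair hah, hC2]
    have hb := m.1.2.2
    rw [hCeq, un_pair, Finset.card_pair hah] at hb
    have hu := Finset.card_union_add_card_inter a h
    have hsub2 : a ∩ h ⊆ h ∩ un (A ∪ B) := by
      rw [Finset.inter_comm]
      exact Finset.inter_subset_inter_left (sub_un (Finset.mem_union_left _ ha))
    have hle := Finset.card_le_card hsub2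
    by_cases h2 : (h ∩ un (A ∪ B)).card = 2
    · right; left
      refine ⟨hh.1, h2, a, ha, ?_⟩
      rw [← Finset.eq_of_subset_of_card_le hsub2 (by omega)]
      exact Finset.inter_subset_left
    · left
      refine ⟨{h}, mem_Jk.2 ⟨by simpa using hh.1, by simpa using hhS, by simp, by simp, ?_⟩, by simp, by simp⟩
      rw [un_singleton, Finset.card_singleton]
      have := Finset.card_sdiff_add_card_inter h (un (A ∪ B))
      omega

lemma kill_I (hAO : A ⊆ Op M) {h : Finset (Fin n)}
    (hh : h ∈ Op M) (hI : GenI A B h) : ∃ a ∈ A, a ∉ Op (insert h M) := by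
  have hn := hI.notMem
  obtain ⟨hE, h2, a, ha, hsub⟩ := hI
  refine ⟨a, ha, fun hO => ?_⟩
  have hg := good_iff.1 (mem_Op.1 hO).2.2
  have hah : a ≠ h := by rintro rfl; exact hn (Finset.mem_union_left _ ha)
  apply hg {a, h}
  · intro x hx; simp at hx ⊢; tauto
  · have hu := Finset.card_union_add_card_inter a h
    rw [mem_Ed.1 hE, mem_Ed.1 (mem_Op.1 (hAO ha)).1] at hu
    have : (h ∩ un (A ∪ B)).card ≤ (a ∩ h).card :=
      Finset.card_le_card (Finset.subset_inter hsub Finset.inter_subset_left)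
    refine ⟨by rw [Finset.card_pair hah], by rw [Finset.card_pair hah]; norm_num, ?_⟩
    rw [un_pair, Finset.card_pair hah]; omega

lemma kill_II {a h : Finset (Fin n)} {C : Finset (Finset (Fin n))}
    (hII : GenII A B a C) (hsub : (C.erase a).erase h ⊆ M) : a ∉ Op (insert h M) := by
  intro hO
  have hg := good_iff.1 (mem_Op.1 hO).2.2
  refine hg C ?_ hII.1.1
  intro x hx
  by_cases h1 : x = a
  · simp [h1]
  by_cases h2 : x = h
  · simp [h2]
  have := hsub (Finset.mem_erase.2 ⟨h2, Finset.mem_erase.2 ⟨h1, hx⟩⟩)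
  simp [this]

lemma not_I_II (H : Cls A B) {a h : Finset (Fin n)} {C : Finset (Finset (Fin n))} (ha : a ∈ A)
    (hI : GenI A B h) (hII : GenII A B a C) (hhC : h ∈ C) (hha : h ≠ a) : False := by
  obtain ⟨m, hE, h3, hc, haC, hU⟩ := hII
  have hs : h ∩ un (A ∪ B) ⊆ a := by
    rw [← hU]; exact Finset.inter_subset_inter_right (sub_un hhC)
  have h2 : (h ∩ un (A ∪ B)).card ≤ (a ∩ h).card :=
    Finset.card_le_card (Finset.subset_inter hs Finset.inter_subset_left)
  rw [hI.2.1] at h2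
  have hu := Finset.card_union_add_card_inter a h
  rw [mem_Ed.1 hI.1, mem_Ed.1 (H.hA ha)] at hu
  have hsub : ({a, h} : Finset (Finset (Fin n))) ⊆ C := by
    intro x hx; simp at hx; rcases hx with rfl | rfl <;> assumption
  have hcp : ({a, h} : Finset (Finset (Fin n))).card = 2 := Finset.card_pair hha.symm
  have := m.proper (T := {a, h}) (Finset.ssubset_iff_subset_ne.2 ⟨hsub, by
    intro e; rw [e] at hcp; omega⟩) hcp.ge
  rw [un_pair, hcp] at this
  omega

lemma two_II_aux (H : Cls A B) {a1 a2 h : Finset (Fin n)} {C1 C2 : Finset (Finset (Fin n))}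
    (ha1 : a1 ∈ A) (ha2 : a2 ∈ A) (h1 : GenII A B a1 C1) (h2 : GenII A B a2 C2)
    (hh1 : h ∈ C1) (hh2 : h ∈ C2) (hha2 : h ≠ a2)
    (hnot : ¬ (C2.erase a2 ⊆ C1)) : C1.erase a1 ∪ C2.erase a2 ∈ Jk (A ∪ B) := by
  have hn1 := fun c hc hca => h1.notMem (mem_Ed.1 (H.hA ha1)) (c := c) hc hca
  have hn2 := fun c hc hca => h2.notMem (mem_Ed.1 (H.hA ha2)) (c := c) hc hca
  obtain ⟨m1, hE1, c31, hc1, haC1, hU1⟩ := h1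
  obtain ⟨m2, hE2, c32, hc2, haC2, hU2⟩ := h2
  have e1 := Finset.card_erase_add_one haC1
  have e2 := Finset.card_erase_add_one haC2
  have b1 := m1.1.2.1
  have b2 := m2.1.2.1
  have hcu := Finset.card_union_le (C1.erase a1) (C2.erase a2)
  set W := C2 \ insert a2 C1 with hW
  set D2 := C2 ∩ insert a2 C1 with hD2
  have hWD := Finset.card_sdiff_add_card_inter C2 (insert a2 C1)
  rw [← hW, ← hD2] at hWD
  have hWne : W.Nonempty := by
    obtain ⟨x, hx, hx1⟩ := Finset.not_subset.1 hnot
    rw [Finset.mem_erase] at hx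
    exact ⟨x, by simp [hW, hx.2, hx.1, hx1]⟩
  have hWpos := Finset.card_pos.2 hWne
  have hD2c : 2 ≤ D2.card := by
    rw [← Finset.card_pair hha2]
    apply Finset.card_le_card
    intro x hx; simp at hx; rcases hx with rfl | rfl
    · simp [hD2, hh2, hh1]
    · simp [hD2, haC2]
  have hp := m2.proper (T := D2) (Finset.ssubset_iff_subset_ne.2 ⟨Finset.inter_subset_left, by
    intro e; rw [e] at hWD; omega⟩) hD2c
  have hQeq : C1.erase a1 ∪ C2.erase a2 = C1.erase a1 ∪ W := by
    ext x
    simp only [Finset.mem_union, Finset.mem_erase, hW, Finset.mem_sdiff, Finset.mem_insert, not_or]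
    constructor
    · rintro (h' | ⟨h', h''⟩)
      · exact Or.inl h'
      · by_cases hx1 : x ∈ C1
        · left
          refine ⟨?_, hx1⟩
          rintro rfl
          exact hn2 _ h'' h' (Finset.mem_union_left _ ha1)
        · exact Or.inr ⟨h'', h', hx1⟩
    · rintro (h' | ⟨h', h'', _⟩)
      · exact Or.inl h'
      · exact Or.inr ⟨h'', h'⟩
  have hdis : Disjoint (C1.erase a1) W := by
    rw [Finset.disjoint_left]
    intro x hx hxW
    simp [hW] at hxW
    exact hxW.2.2 (Finset.mem_of_mem_erase hx)
  have hQc : (C1.erase a1 ∪ C2.erase a2).card = (C1.erase a1).card + W.card := by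
    rw [hQeq, Finset.card_union_of_disjoint hdis]
  rw [mem_Jk]
  refine ⟨Finset.union_subset ((Finset.erase_subset _ _).trans hE1)
    ((Finset.erase_subset _ _).trans hE2), ?_, by omega, by omega, ?_⟩
  · rw [Finset.disjoint_left]
    intro x hx
    rw [Finset.mem_union, Finset.mem_erase, Finset.mem_erase] at hx
    rcases hx with hx | hx
    · exact hn1 x hx.2 hx.1
    · exact hn2 x hx.2 hx.1
  · have hsub : un (C1.erase a1 ∪ C2.erase a2) \ un (A ∪ B) ⊆
        (un C1 \ un (A ∪ B)) ∪ (un C2 \ un D2) := by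
      rw [hQeq, un_union]
      intro v hv
      rw [Finset.mem_sdiff, Finset.mem_union] at hv
      obtain ⟨hv1 | hv1, hv2⟩ := hv
      · exact Finset.mem_union_left _ (Finset.mem_sdiff.2 ⟨un_mono (Finset.erase_subset _ _) hv1, hv2⟩)
      · by_cases hvc : v ∈ un C1
        · exact Finset.mem_union_left _ (Finset.mem_sdiff.2 ⟨hvc, hv2⟩)
        · refine Finset.mem_union_right _ (Finset.mem_sdiff.2 ⟨un_mono Finset.sdiff_subset hv1, ?_⟩)
          intro hvD
          obtain ⟨d, hd, hvd⟩ := mem_un.1 hvD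
          rw [hD2, Finset.mem_inter, Finset.mem_insert] at hd
          rcases hd.2 with rfl | hd1
          · exact hv2 (mem_un.2 ⟨d, Finset.mem_union_left _ ha2, hvd⟩)
          · exact hvc (mem_un.2 ⟨d, hd1, hvd⟩)
    have l1 := Finset.card_le_card hsub
    have l2 := Finset.card_union_le (un C1 \ un (A ∪ B)) (un C2 \ un D2)
    have l3 := Finset.card_sdiff_add_card_inter (un C1) (un (A ∪ B))
    rw [hU1, mem_Ed.1 (H.hA ha1)] at l3
    have l4 : (un C2 \ un D2).card = (un C2).card - (un D2).card :=
      Finset.card_sdiff_of_subset (un_mono Finset.inter_subset_left)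
    omega

lemma two_II (H : Cls A B) {a1 a2 h : Finset (Fin n)} {C1 C2 : Finset (Finset (Fin n))}
    (ha1 : a1 ∈ A) (ha2 : a2 ∈ A) (h1 : GenII A B a1 C1) (h2 : GenII A B a2 C2)
    (hh1 : h ∈ C1) (hh2 : h ∈ C2) (hha1 : h ≠ a1) (hha2 : h ≠ a2)
    (hne : (a1, C1) ≠ (a2, C2)) : C1.erase a1 ∪ C2.erase a2 ∈ Jk (A ∪ B) := by
  by_cases hs2 : C2.erase a2 ⊆ C1
  swap
  · exact two_II_aux H ha1 ha2 h1 h2 hh1 hh2 hha2 hs2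
  by_cases hs1 : C1.erase a1 ⊆ C2
  swap
  · rw [Finset.union_comm (C1.erase a1)]
    exact two_II_aux H ha2 ha1 h2 h1 hh2 hh1 hha1 hs1
  exfalso
  have hn1 := fun c hc hca => h1.notMem (mem_Ed.1 (H.hA ha1)) (c := c) hc hca
  have hn2 := fun c hc hca => h2.notMem (mem_Ed.1 (H.hA ha2)) (c := c) hc hca
  have heq : C1.erase a1 = C2.erase a2 := by
    apply Finset.Subset.antisymm
    · intro x hx
      refine Finset.mem_erase.2 ⟨?_, hs1 hx⟩
      rintro rfl
      rw [Finset.mem_erase] at hx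
      exact hn1 _ hx.2 hx.1 (Finset.mem_union_left _ ha2)
    · intro x hx
      refine Finset.mem_erase.2 ⟨?_, hs2 hx⟩
      rintro rfl
      rw [Finset.mem_erase] at hx
      exact hn2 _ hx.2 hx.1 (Finset.mem_union_left _ ha1)
  have hane : a1 ≠ a2 := by
    rintro rfl
    apply hne
    rw [← Finset.insert_erase h1.2.2.2.2.1, heq, Finset.insert_erase h2.2.2.2.2.1]
  have hmeet := h1.meet (mem_Ed.1 (H.hA ha1))
  have hsub : a1 ∩ un (C1.erase a1) ⊆ a1 ∩ a2 := by
    refine Finset.subset_inter Finset.inter_subset_left ?_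
    rw [← h2.2.2.2.2.2, heq, Finset.inter_comm]
    exact Finset.inter_subset_inter (un_mono (Finset.erase_subset _ _))
      (sub_un (Finset.mem_union_left _ ha1))
  have := Finset.card_le_card hsub
  have := H.pair_AA ha1 ha2 hane
  omega

lemma gain_cases (H : Cls A B) (hM : Rc M) {a b : Finset (Fin n)} (hAO : A ⊆ Op M)
    (hb : b ∈ B) (hbO : b ∈ Op M) (ha : a ∈ A) (hk : a ∉ Op (insert b M)) :
    ∃ Q ∈ Jk (A ∪ B), Q ⊆ M := by
  have hab : a ≠ b := by rintro rfl; exact Finset.disjoint_left.1 H.disj ha hb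
  have haO := hAO ha
  obtain ⟨C, m, hsub, haC, hbC⟩ := killer haO hbO hab hk
  have hE : C ⊆ Ed n := hsub.trans
    (Finset.insert_subset (H.hA ha) (Finset.insert_subset (H.hB hb) hM.1))
  have hAM : ∀ x ∈ A, x ∉ M := fun x hx => (mem_Op.1 (hAO hx)).2.1
  refine ⟨C \ (A ∪ B), junk_of m hE ?_ ?_, ?_⟩
  · rw [← Finset.card_pair hab]
    apply Finset.card_le_card
    intro x hx; simp at hx; rcases hx with rfl | rfl
    · simp [haC, ha]
    · simp [hbC, hb]
  · by_contra hne
    rw [Finset.not_nonempty_iff_eq_empty, Finset.sdiff_eq_empty_iff_subset] at hne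
    have h2 := H.c2 C hne m.1
    have : C ∩ A ⊆ {a} := by
      intro x hx
      rw [Finset.mem_inter] at hx
      have := hsub hx.1
      simp only [Finset.mem_insert] at this
      rcases this with rfl | rfl | h'
      · simp
      · exact absurd hb (Finset.disjoint_left.1 H.disj hx.2)
      · exact absurd h' (hAM x hx.2)
    have := Finset.card_le_card this
    simp at this
    omega
  · intro x hx
    rw [Finset.mem_sdiff, Finset.mem_union, not_or] at hx
    have := hsub hx.1
    simp only [Finset.mem_insert] at this
    rcases this with rfl | rfl | h'
    · exact absurd ha hx.2.1
    · exact absurd hb hx.2.2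
    · exact h'

end ptw
end GRU


namespace GRU
open Finset

variable {n : ℕ} {A B M : Finset (Finset (Fin n))}

/-- indicator that some member of `A` is closed by adding `h` -/
noncomputable def Ls (A M : Finset (Finset (Fin n))) (h : Finset (Fin n)) : ℝ :=
  if A ⊆ Op (insert h M) then 0 else 1

noncomputable def X2 (A B M : Finset (Finset (Fin n))) (h : Finset (Fin n)) :
    Finset (Finset (Fin n) × Finset (Finset (Fin n))) :=
  (G2 A B).filter (fun x => h ∈ x.2.erase x.1 ∧ (x.2.erase x.1).erase h ⊆ M)

noncomputable def Jh (A B M : Finset (Finset (Fin n))) (h : Finset (Fin n)) :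
    Finset (Finset (Finset (Fin n))) :=
  (Jk (A ∪ B)).filter (fun Q => h ∈ Q ∧ Q.erase h ⊆ M)

lemma X2_bound (H : Cls A B) (h : Finset (Fin n)) :
    (X2 A B M h).card ≤ 1 + A.card * 2 ^ 16 * (Jh A B M h).card := by
  rcases (X2 A B M h).eq_empty_or_nonempty with he | ⟨x1, hx1⟩
  · rw [he]; simp
  have hc := Finset.card_erase_add_one hx1
  have hx1' := hx1
  rw [X2, Finset.mem_filter, mem_G2] at hx1
  obtain ⟨⟨ha1, hg1⟩, hh1, hs1⟩ := hx1
  rw [Finset.mem_erase] at hh1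
  have := Finset.card_le_mul_card_image_of_maps_to (s := (X2 A B M h).erase x1) (t := Jh A B M h)
    (f := fun x => x1.2.erase x1.1 ∪ x.2.erase x.1) (n := A.card * 2 ^ 16) ?_ ?_
  · omega
  · intro x hx
    rw [Finset.mem_erase, X2, Finset.mem_filter, mem_G2] at hx
    obtain ⟨hne, ⟨ha2, hg2⟩, hh2, hs2⟩ := hx
    rw [Finset.mem_erase] at hh2
    rw [Jh, Finset.mem_filter]
    refine ⟨two_II H ha1 ha2 hg1 hg2 hh1.2 hh2.2 hh1.1 hh2.1 (fun e => hne e.symm), ?_, ?_⟩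
    · exact Finset.mem_union_left _ (Finset.mem_erase.2 hh1)
    · rw [Finset.erase_union_distrib]
      exact Finset.union_subset hs1 hs2
  · intro Q hQ
    rw [Jh, Finset.mem_filter, mem_Jk] at hQ
    have hcard : (A ×ˢ Q.powerset).card ≤ A.card * 2 ^ 16 := by
      rw [Finset.card_product, Finset.card_powerset]
      exact Nat.mul_le_mul_left _ (Nat.pow_le_pow_right (by norm_num) hQ.1.2.2.2.1)
    refine le_trans ?_ hcard
    refine Finset.card_le_card_of_injOn (fun x => (x.1, x.2.erase x.1)) ?_ ?_
    · intro x hx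
      simp only [Finset.coe_filter, Finset.mem_erase, Set.mem_ofPred_eq, X2, Finset.mem_filter, mem_G2] at hx
      simp only [Finset.coe_product, Set.mem_prod, Finset.mem_coe, Finset.mem_powerset]
      refine ⟨hx.1.2.1.1, ?_⟩
      rw [← hx.2]
      exact Finset.subset_union_right
    · intro x hx y hy hxy
      simp only [Finset.coe_filter, Finset.mem_erase, Set.mem_ofPred_eq, X2, Finset.mem_filter, mem_G2] at hx hy
      simp only [Prod.mk.injEq] at hxy
      have e1 : x.1 ∈ x.2 := hx.1.2.1.2.2.2.2.2.1
      have e2 : y.1 ∈ y.2 := hy.1.2.1.2.2.2.2.2.1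
      refine Prod.ext hxy.1 ?_
      rw [← Finset.insert_erase e1, ← Finset.insert_erase e2, hxy.2, hxy.1]

lemma Ls_bounds (A M : Finset (Finset (Fin n))) (h : Finset (Fin n)) : 0 ≤ Ls A M h ∧ Ls A M h ≤ 1 := by
  unfold Ls; split_ifs <;> norm_num

lemma ptw_h (H : Cls A B) (hM : Rc M) (hAO : A ⊆ Op M) (hBM : B ⊆ M) {h : Finset (Fin n)}
    (hh : h ∈ Op M) :
    |Ls A M h - (if h ∈ G1 A B then 1 else 0) - ((X2 A B M h).card : ℝ)| ≤
      (if h ∈ A then 1 else 0) + (3 + A.card * 2 ^ 16 : ℝ) * (Jh A B M h).card := by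
  have hL := Ls_bounds A M h
  by_cases hhA : h ∈ A
  · have h1 : h ∉ G1 A B := by
      rw [mem_G1]; intro hI; exact hI.notMem (Finset.mem_union_left _ hhA)
    have h2 : X2 A B M h = ∅ := by
      rw [X2, Finset.filter_eq_empty_iff]
      rintro x hx ⟨hx1, -⟩
      rw [mem_G2] at hx
      rw [Finset.mem_erase] at hx1
      exact hx.2.notMem (mem_Ed.1 (H.hA hx.1)) hx1.2 hx1.1 (Finset.mem_union_left _ hhA)
    rw [h2]
    simp only [h1, hhA, if_true, if_false, Finset.card_empty]
    rw [abs_le]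
    have : (0:ℝ) ≤ (3 + A.card * 2 ^ 16 : ℝ) * (Jh A B M h).card := by positivity
    constructor <;> push_cast <;> linarith
  simp only [hhA, if_false, zero_add]
  have hX := X2_bound (M := M) H h
  have hXr : ((X2 A B M h).card : ℝ) ≤ 1 + A.card * 2 ^ 16 * (Jh A B M h).card := by exact_mod_cast hX
  rcases (Jh A B M h).eq_empty_or_nonempty with hJ | hJ
  · -- exact case
    have hJ' : ¬ ∃ Q ∈ Jk (A ∪ B), h ∈ Q ∧ Q.erase h ⊆ M := by
      rintro ⟨Q, hQ, h1, h2⟩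
      have : Q ∈ Jh A B M h := Finset.mem_filter.2 ⟨hQ, h1, h2⟩
      rw [hJ] at this; simp at this
    rw [hJ] at hX ⊢
    simp only [Finset.card_empty, mul_zero, add_zero, Nat.cast_zero] at hX ⊢
    rw [abs_nonpos_iff]
    by_cases hI : GenI A B h
    · have hX0 : X2 A B M h = ∅ := by
        rw [X2, Finset.filter_eq_empty_iff]
        rintro x hx ⟨hx1, -⟩
        rw [mem_G2] at hx
        rw [Finset.mem_erase] at hx1
        exact not_I_II H hx.1 hI hx.2 hx1.2 hx1.1
      obtain ⟨a, ha, hk⟩ := kill_I hAO hh hI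
      have : Ls A M h = 1 := by
        unfold Ls; rw [if_neg]; exact fun hs => hk (hs ha)
      rw [this, hX0, if_pos (mem_G1.2 hI)]
      simp
    · rw [if_neg (fun h' => hI (mem_G1.1 h'))]
      rcases (X2 A B M h).eq_empty_or_nonempty with he | ⟨x, hx⟩
      · rw [he]
        have : Ls A M h = 0 := by
          unfold Ls; rw [if_pos]
          intro a ha
          by_contra hk
          rcases loss_cases hM hAO hBM hh hhA ha hk with h' | h' | ⟨C, hg, hhC, hha, hs⟩
          · exact hJ' h'
          · exact hI h'
          · have : (a, C) ∈ X2 A B M h := by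
              rw [X2, Finset.mem_filter, mem_G2]
              exact ⟨⟨ha, hg⟩, Finset.mem_erase.2 ⟨hha, hhC⟩, hs⟩
            rw [he] at this; simp at this
        rw [this]; simp
      · have hc1 : (X2 A B M h).card = 1 := le_antisymm hX (Finset.card_pos.2 ⟨x, hx⟩)
        rw [X2, Finset.mem_filter, mem_G2] at hx
        have hk := kill_II hx.1.2 hx.2.2
        have : Ls A M h = 1 := by
          unfold Ls; rw [if_neg]; exact fun hs => hk (hs hx.1.1)
        rw [this, hc1]; simp
  · have hJ1 : (1:ℝ) ≤ (Jh A B M h).card := by exact_mod_cast Finset.card_pos.2 hJ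
    have hX0 : (0:ℝ) ≤ (X2 A B M h).card := by positivity
    have hI : (0:ℝ) ≤ (if h ∈ G1 A B then (1:ℝ) else 0) ∧ (if h ∈ G1 A B then (1:ℝ) else 0) ≤ 1 := by
      split_ifs <;> norm_num
    rw [abs_le]
    constructor <;> nlinarith

lemma Op_anti {M M' : Finset (Finset (Fin n))} (h : M ⊆ M') {e : Finset (Fin n)} (he : e ∈ Op M') :
    e ∈ Op M := by
  rw [mem_Op] at *
  exact ⟨he.1, fun h' => he.2.1 (h h'), good_mono (Finset.insert_subset_insert _ h) he.2.2⟩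

lemma ind_step {h : Finset (Fin n)} (hh : h ∈ Op M) :
    ind A B (insert h M) - ind A B M =
      (if h ∈ B then (if A ⊆ Op (insert h M) ∧ B.erase h ⊆ M then 1 else 0) else 0)
        - ind A B M * Ls A M h := by
  have hhM := (mem_Op.1 hh).2.1
  have hmono : A ⊆ Op (insert h M) → A ⊆ Op M := fun hs x hx =>
    Op_anti (Finset.subset_insert _ _) (hs hx)
  by_cases hB : h ∈ B
  · have h0 : ind A B M = 0 := by
      unfold ind; rw [if_neg]; exact fun hc => hhM (hc.2 hB)
    rw [h0, if_pos hB]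
    unfold ind
    simp only [Finset.subset_insert_iff]
    simp
  · rw [if_neg hB]
    have hiff : B ⊆ insert h M ↔ B ⊆ M := by
      rw [Finset.subset_insert_iff, Finset.erase_eq_of_notMem hB]
    unfold ind Ls
    simp only [hiff]
    by_cases h1 : A ⊆ Op (insert h M) <;> by_cases h2 : B ⊆ M <;> by_cases h3 : A ⊆ Op M <;>
      simp [h1, h2, h3] 
    exact h3 (hmono h1)

/-- right hand error function -/
noncomputable def Er (A B M : Finset (Finset (Fin n))) : ℝ :=
  A.card * iB B M + (3 + A.card * 2 ^ 16 : ℝ) * ∑ Q ∈ Jk (A ∪ B), ∑ h ∈ Q, iB (B ∪ Q.erase h) M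
    + ∑ b ∈ B, ∑ Q ∈ Jk (A ∪ B), iB (B.erase b ∪ Q) M

lemma ind_mul {A' B' : Finset (Finset (Fin n))} :
    ind (A ∪ A') (B ∪ B') M = ind A B M * (if A' ⊆ Op M ∧ B' ⊆ M then 1 else 0) := by
  unfold ind
  simp only [Finset.union_subset_iff]
  by_cases h1 : A ⊆ Op M <;> by_cases h2 : A' ⊆ Op M <;> by_cases h3 : B ⊆ M <;>
    by_cases h4 : B' ⊆ M <;> simp [h1, h2, h3, h4]

lemma ind_bounds (A B M : Finset (Finset (Fin n))) : 0 ≤ ind A B M ∧ ind A B M ≤ iB B M := by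
  unfold ind iB
  by_cases h1 : A ⊆ Op M <;> by_cases h2 : B ⊆ M <;> simp [h1, h2]

lemma ptw (hN : 0 < (Ed n).card) (H : Cls A B) (hM : Rc M) :
    |((Ed n).card : ℝ) * (opL (ind A B) M - ind A B M) + ∑ h ∈ G1 A B, ind (insert h A) B M
      + ∑ x ∈ G2 A B, ∑ h ∈ x.2.erase x.1, ind (insert h A) (B ∪ (x.2.erase x.1).erase h) M
      - ∑ b ∈ B, ind (insert b A) (B.erase b) M| ≤ Er A B M := by
  have hN' : (0:ℝ) < (Ed n).card := by exact_mod_cast hN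
  set F := ind A B M with hF
  have hFb := ind_bounds A B M
  rw [← hF] at hFb
  have hOpE : Op M ⊆ Ed n := fun e he => (mem_Op.1 he).1
  have e1 : ((Ed n).card : ℝ) * (opL (ind A B) M - F) = ∑ h ∈ Op M,
      ((if h ∈ B then (if A ⊆ Op (insert h M) ∧ B.erase h ⊆ M then (1:ℝ) else 0) else 0)
        - F * Ls A M h) := by
    have : ((Ed n).card : ℝ) * (opL (ind A B) M - F) = ∑ h ∈ Ed n, (ind A B (step M h) - F) := by
      rw [Finset.sum_sub_distrib, Finset.sum_const, nsmul_eq_mul]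
      unfold opL
      field_simp
    rw [this, ← Finset.sum_subset hOpE]
    · refine Finset.sum_congr rfl fun h hh => ?_
      rw [← ind_step hh]
      simp [step, hh, hF]
    · intro h _ hh
      simp [step, hh, hF]
  have e2 : ∑ h ∈ G1 A B, ind (insert h A) B M = ∑ h ∈ Op M, F * (if h ∈ G1 A B then 1 else 0) := by
    have : ∀ h ∈ G1 A B, ind (insert h A) B M = if h ∈ Op M then F else 0 := by
      intro h _
      have := ind_mul (A := A) (B := B) (M := M) (A' := {h}) (B' := ∅)
      rw [Finset.union_comm A, ← Finset.insert_eq, Finset.union_empty] at this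
      rw [this, ← hF]
      simp
    rw [Finset.sum_congr rfl this, Finset.sum_ite_mem]
    simp only [mul_ite, mul_one, mul_zero]
    rw [Finset.sum_ite_mem, Finset.inter_comm]
  have e3 : ∑ x ∈ G2 A B, ∑ h ∈ x.2.erase x.1, ind (insert h A) (B ∪ (x.2.erase x.1).erase h) M
      = ∑ h ∈ Op M, F * ((X2 A B M h).card : ℝ) := by
    have : ∀ x ∈ G2 A B, ∑ h ∈ x.2.erase x.1, ind (insert h A) (B ∪ (x.2.erase x.1).erase h) M =
        ∑ h ∈ Op M, if (h ∈ x.2.erase x.1 ∧ (x.2.erase x.1).erase h ⊆ M) then F else 0 := by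
      intro x _
      have h1 : ∀ h ∈ x.2.erase x.1, ind (insert h A) (B ∪ (x.2.erase x.1).erase h) M =
          if h ∈ Op M then (if (x.2.erase x.1).erase h ⊆ M then F else 0) else 0 := by
        intro h _
        rw [Finset.insert_eq, Finset.union_comm {h} A, ind_mul, ← hF]
        simp only [Finset.singleton_subset_iff]
        by_cases q1 : h ∈ Op M <;> by_cases q2 : (x.2.erase x.1).erase h ⊆ M <;> simp [q1, q2]
      rw [Finset.sum_congr rfl h1, Finset.sum_ite_mem, Finset.inter_comm, ← Finset.sum_ite_mem]
      refine Finset.sum_congr rfl fun h _ => ?_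
      rw [ite_and]
    rw [Finset.sum_congr rfl this, Finset.sum_comm]
    refine Finset.sum_congr rfl fun h _ => ?_
    rw [X2, Finset.card_filter]
    push_cast
    rw [Finset.mul_sum]
    refine Finset.sum_congr rfl fun x _ => ?_
    simp
  have e4 : ∑ b ∈ B, ind (insert b A) (B.erase b) M =
      ∑ h ∈ Op M, if h ∈ B then (if A ⊆ Op M ∧ B.erase h ⊆ M then (1:ℝ) else 0) else 0 := by
    have : ∀ b ∈ B, ind (insert b A) (B.erase b) M =
        if b ∈ Op M then (if A ⊆ Op M ∧ B.erase b ⊆ M then (1:ℝ) else 0) else 0 := by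
      intro b _
      unfold ind
      simp only [Finset.insert_subset_iff, and_assoc]
      rw [ite_and]
    rw [Finset.sum_congr rfl this, Finset.sum_ite_mem, Finset.inter_comm, ← Finset.sum_ite_mem]
  rw [e1, e2, e3, e4, ← Finset.sum_add_distrib, ← Finset.sum_add_distrib, ← Finset.sum_sub_distrib]
  refine (Finset.abs_sum_le_sum_abs _ _).trans ?_
  -- termwise bound
  have hterm : ∀ h ∈ Op M, |(if h ∈ B then (if A ⊆ Op (insert h M) ∧ B.erase h ⊆ M then (1:ℝ) else 0) else 0)
        - F * Ls A M h + F * (if h ∈ G1 A B then 1 else 0) + F * ((X2 A B M h).card : ℝ)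
        - (if h ∈ B then (if A ⊆ Op M ∧ B.erase h ⊆ M then (1:ℝ) else 0) else 0)| ≤
      (if h ∈ A then iB B M else 0)
      + (3 + A.card * 2 ^ 16 : ℝ) * (∑ Q ∈ Jk (A ∪ B), if h ∈ Q then iB (B ∪ Q.erase h) M else 0)
      + (if h ∈ B then ∑ Q ∈ Jk (A ∪ B), iB (B.erase h ∪ Q) M else 0) := by
    intro h hh
    have hJ0 : 0 ≤ ∑ Q ∈ Jk (A ∪ B), (if h ∈ Q then iB (B ∪ Q.erase h) M else 0) :=
      Finset.sum_nonneg fun Q _ => by split_ifs; exacts [iB_nonneg _ _, le_rfl]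
    have hG0 : 0 ≤ ∑ Q ∈ Jk (A ∪ B), iB (B.erase h ∪ Q) M :=
      Finset.sum_nonneg fun Q _ => iB_nonneg _ _
    have hA0 : 0 ≤ (if h ∈ A then iB B M else 0) := by
      split_ifs; exacts [iB_nonneg _ _, le_rfl]
    have hK0 : (0:ℝ) ≤ (3 + A.card * 2 ^ 16 : ℝ) := by positivity
    by_cases hB : h ∈ B
    · have h0 : F = 0 := by
        rw [hF]; unfold ind; rw [if_neg]; exact fun hc => (mem_Op.1 hh).2.1 (hc.2 hB)
      rw [h0]
      simp only [hB, if_true, zero_mul, sub_zero, add_zero]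
      refine le_trans ?_ (le_add_of_nonneg_left (add_nonneg hA0 (mul_nonneg hK0 hJ0)))
      by_cases q1 : A ⊆ Op M ∧ B.erase h ⊆ M
      · by_cases q2 : A ⊆ Op (insert h M)
        · simp only [q1, q2, and_self, if_true, sub_self, abs_zero]
          exact hG0
        · simp only [q1, q2, false_and, if_false, if_true, and_self, zero_sub, abs_neg, abs_one]
          obtain ⟨a, ha, hk⟩ := Finset.not_subset.1 q2
          obtain ⟨Q, hQ, hQM⟩ := gain_cases H hM q1.1 hB hh ha hk
          have : iB (B.erase h ∪ Q) M = 1 := iB_of_sub (Finset.union_subset q1.2 hQM)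
          rw [← this]
          exact Finset.single_le_sum (f := fun Q => iB (B.erase h ∪ Q) M) (fun Q _ => iB_nonneg _ _) hQ
      · have q2 : ¬ (A ⊆ Op (insert h M) ∧ B.erase h ⊆ M) := fun hc =>
          q1 ⟨fun x hx => Op_anti (Finset.subset_insert _ _) (hc.1 hx), hc.2⟩
        simp only [q1, q2, if_false, sub_self, abs_zero]
        exact hG0
    · simp only [hB, if_false, zero_sub, sub_zero, add_zero]
      by_cases hc : A ⊆ Op M ∧ B ⊆ M
      · have hF1 : F = 1 := by rw [hF]; unfold ind; rw [if_pos hc]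
        have := ptw_h H hM hc.1 hc.2 hh
        rw [hF1]
        have heq : |-(1 * Ls A M h) + 1 * (if h ∈ G1 A B then (1:ℝ) else 0) + 1 * ((X2 A B M h).card : ℝ)|
            = |Ls A M h - (if h ∈ G1 A B then 1 else 0) - ((X2 A B M h).card : ℝ)| := by
          rw [← abs_neg]; congr 1; ring
        rw [heq]
        refine this.trans ?_
        rw [iB_of_sub hc.2]
        have hJc : ((Jh A B M h).card : ℝ) = ∑ Q ∈ Jk (A ∪ B), (if h ∈ Q then iB (B ∪ Q.erase h) M else 0) := by
          rw [Jh, Finset.card_filter]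
          push_cast
          refine Finset.sum_congr rfl fun Q _ => ?_
          unfold iB
          rw [ite_and]
          simp [hc.2, Finset.union_subset_iff]
        rw [hJc]
      · have hF1 : F = 0 := by rw [hF]; unfold ind; rw [if_neg hc]
        rw [hF1]
        simp only [zero_mul, neg_zero, add_zero, abs_zero]
        exact add_nonneg hA0 (mul_nonneg hK0 hJ0)
  refine (Finset.sum_le_sum hterm).trans ?_
  rw [Finset.sum_add_distrib, Finset.sum_add_distrib, ← Finset.mul_sum]
  unfold Er
  refine add_le_add (add_le_add ?_ ?_) ?_
  · rw [Finset.sum_ite_mem, Finset.sum_const, nsmul_eq_mul]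
    refine mul_le_mul_of_nonneg_right ?_ (iB_nonneg _ _)
    exact_mod_cast Finset.card_le_card Finset.inter_subset_right
  · refine mul_le_mul_of_nonneg_left ?_ (by positivity)
    rw [Finset.sum_comm]
    refine Finset.sum_le_sum fun Q _ => ?_
    rw [Finset.sum_ite_mem]
    exact Finset.sum_le_sum_of_subset_of_nonneg Finset.inter_subset_right (fun _ _ _ => iB_nonneg _ _)
  · rw [Finset.sum_ite_mem]
    exact Finset.sum_le_sum_of_subset_of_nonneg Finset.inter_subset_right
      (fun _ _ _ => Finset.sum_nonneg fun _ _ => iB_nonneg _ _)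

end GRU


namespace GRU
open Finset

variable {n : ℕ}

/-- counting constant -/
@[irreducible] def cnt (u q : ℕ) : ℕ := (4 * q + 1) * 2 ^ (2 ^ (u + 4 * q))

lemma card_fibre (U0 : Finset (Fin n)) (u q : ℕ) (hu : U0.card ≤ u)
    (𝒬 : Finset (Finset (Finset (Fin n)))) (w : ℕ) (hw : w ≤ 4 * q) :
    (𝒬.filter (fun Q => (un Q \ U0).card = w)).card ≤ 2 ^ (2 ^ (u + 4 * q)) * n ^ w := by
  have := Finset.card_le_mul_card_image_of_maps_to (s := 𝒬.filter (fun Q => (un Q \ U0).card = w))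
    (t := (Finset.univ : Finset (Fin n)).powersetCard w) (f := fun Q => un Q \ U0)
    (n := 2 ^ (2 ^ (u + 4 * q))) ?_ ?_
  · refine this.trans (Nat.mul_le_mul_left _ ?_)
    rw [Finset.card_powersetCard, Finset.card_univ, Fintype.card_fin]
    exact Nat.choose_le_pow n w
  · intro Q hQ'
    rw [Finset.mem_filter] at hQ'
    rw [Finset.mem_powersetCard]
    exact ⟨Finset.subset_univ _, hQ'.2⟩
  · intro W hW
    rw [Finset.mem_powersetCard] at hW
    have hc : ((U0 ∪ W).powerset.powerset).card ≤ 2 ^ (2 ^ (u + 4 * q)) := by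
      rw [Finset.card_powerset, Finset.card_powerset]
      refine Nat.pow_le_pow_right (by norm_num) (Nat.pow_le_pow_right (by norm_num) ?_)
      have := Finset.card_union_le U0 W
      omega
    refine le_trans (Finset.card_le_card ?_) hc
    intro Q hQ'
    simp only [Finset.mem_filter] at hQ'
    rw [Finset.mem_powerset]
    intro b hb
    rw [Finset.mem_powerset, ← hQ'.2]
    intro v hv
    have : v ∈ un Q := mem_un.2 ⟨b, hb, hv⟩
    by_cases h0 : v ∈ U0
    · exact Finset.mem_union_left _ h0
    · exact Finset.mem_union_right _ (Finset.mem_sdiff.2 ⟨this, h0⟩)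

lemma cnt_sum (hn : 1 ≤ n) (U0 : Finset (Fin n)) (u q : ℕ) (hu : U0.card ≤ u)
    (𝒬 : Finset (Finset (Finset (Fin n)))) (hQ : ∀ Q ∈ 𝒬, Q ⊆ Ed n ∧ Q.card ≤ q) :
    ∑ Q ∈ 𝒬, (1 / (n:ℝ)) ^ (un Q \ U0).card ≤ cnt u q := by
  have hn' : (0:ℝ) < n := by exact_mod_cast hn
  rw [← Finset.sum_fiberwise_of_maps_to (s := 𝒬) (t := Finset.range (4 * q + 1))
    (g := fun Q => (un Q \ U0).card)]
  · have : ∀ w ∈ Finset.range (4 * q + 1),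
        ∑ Q ∈ 𝒬 with (un Q \ U0).card = w, (1 / (n:ℝ)) ^ (un Q \ U0).card ≤ (2 ^ (2 ^ (u + 4 * q)) : ℕ) := by
      intro w hw
      rw [Finset.mem_range] at hw
      rw [Finset.sum_congr rfl (g := fun _ => (1 / (n:ℝ)) ^ w) (fun Q hQ' => by
        rw [(Finset.mem_filter.1 hQ').2]), Finset.sum_const, nsmul_eq_mul]
      have h1 : ((𝒬.filter (fun Q => (un Q \ U0).card = w)).card : ℝ) ≤
          ((2 ^ (2 ^ (u + 4 * q)) * n ^ w : ℕ) : ℝ) := by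
        exact_mod_cast card_fibre U0 u q hu 𝒬 w (by omega)
      calc _ ≤ ((2 ^ (2 ^ (u + 4 * q)) * n ^ w : ℕ) : ℝ) * (1 / (n:ℝ)) ^ w := by gcongr
        _ = _ := by
          rw [Nat.cast_mul, Nat.cast_pow n w, mul_assoc, ← mul_pow, mul_one_div_cancel hn'.ne', one_pow,
            mul_one]
    refine (Finset.sum_le_sum this).trans ?_
    rw [Finset.sum_const, nsmul_eq_mul, Finset.card_range, ← Nat.cast_mul, cnt]
  · intro Q hQ'
    rw [Finset.mem_range]
    have h1 := card_un_le Q (hQ Q hQ').1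
    have h2 := Finset.card_le_card (Finset.sdiff_subset (s := un Q) (t := U0))
    have := (hQ Q hQ').2
    omega

/-- probability that `A` is open and `B` chosen -/
noncomputable def p (t : ℕ) (A B : Finset (Finset (Fin n))) : ℝ := ex t (ind A B)

/-- error constant -/
noncomputable def Es (k : ℝ) (s : ℕ) : ℝ :=
  s * k ^ s + (3 + s * 2 ^ 16) * (16 * k ^ (s + 16) * cnt (4 * s) 16) + s * (k ^ (s + 16) * cnt (4 * s) 16)

lemma pw_aux {k x m : ℝ} (hk : 1 ≤ k) (hx : 0 < x) (hx1 : x ≤ 1) (hm : m * x = 1) {b q w s : ℕ} (hb : b ≤ s)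
    (hq : 1 ≤ q) (hq2 : q ≤ 16) (hw : w + 1 ≤ 2 * q) :
    (k * x ^ 2) ^ (b + (q - 1)) ≤ k ^ (s + 16) * m * x ^ (2 * b) * x ^ w := by
  have hm0 : 0 < m := by
    by_contra h
    push Not at h
    nlinarith
  rw [mul_pow, ← pow_mul]
  have h1 : k ^ (b + (q - 1)) ≤ k ^ (s + 16) := pow_le_pow_right₀ hk (by omega)
  have h2 : x ^ (2 * (b + (q - 1))) ≤ m * x ^ (2 * b) * x ^ w := by
    have : x ^ (2 * (b + (q - 1))) = m * x ^ (2 * b) * x ^ (2 * q - 1) := by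
      have e : 2 * q - 1 = 2 * (q - 1) + 1 := by omega
      rw [e, mul_add, pow_add, pow_add]
      calc _ = (m * x) * (x ^ (2 * b) * x ^ (2 * (q-1))) := by rw [hm, one_mul]
        _ = _ := by ring
    rw [this]
    gcongr _ * ?_
    exact pow_le_pow_of_le_one hx.le hx1 (by omega)
  calc _ ≤ k ^ (s + 16) * (m * x ^ (2 * b) * x ^ w) := by gcongr
    _ = _ := by ring

set_option maxHeartbeats 1000000 in
lemma ex_Er (hn : 1 ≤ n) (hN : 0 < (Ed n).card) {A B : Finset (Finset (Fin n))} (H : Cls A B)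
    {k : ℝ} (hk : 1 ≤ k) {t s : ℕ} (ht : (t:ℝ) / (Ed n).card ≤ k * (1 / (n:ℝ)) ^ 2)
    (hs : A.card + B.card ≤ s) :
    ex t (Er A B) ≤ Es k s * n * (1 / (n:ℝ)) ^ (2 * B.card) := by
  have hn' : (1:ℝ) ≤ n := by exact_mod_cast hn
  set x : ℝ := 1 / (n:ℝ) with hx
  have hx0 : 0 < x := by positivity
  have hx1 : x ≤ 1 := by rw [hx, div_le_one (by positivity)]; exact hn'
  have hm : (n:ℝ) * x = 1 := by rw [hx]; field_simp
  have hiB : ∀ Y : Finset (Finset (Fin n)), ex t (iB Y) ≤ (k * x ^ 2) ^ Y.card := by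
    intro Y
    refine (ex_iB hN t Y).trans ?_
    gcongr
  set U0 := un (A ∪ B) with hU0
  have hU0c : U0.card ≤ 4 * s := by
    have h1 := card_un_le (A ∪ B) (Finset.union_subset H.hA H.hB)
    have h2 := Finset.card_union_le A B
    rw [← hU0] at h1
    omega
  have hcnt := cnt_sum hn U0 (4 * s) 16 hU0c (Jk (A ∪ B)) (fun Q hQ => by
    rw [mem_Jk] at hQ; exact ⟨hQ.1, hQ.2.2.2.1⟩)
  rw [← hx] at hcnt
  have hAs : (A.card : ℝ) ≤ s := by exact_mod_cast (by omega : A.card ≤ s)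
  have hBs : (B.card : ℝ) ≤ s := by exact_mod_cast (by omega : B.card ≤ s)
  have hBs' : B.card ≤ s := by omega
  have e : ex t (Er A B) = A.card * ex t (iB B) + (3 + A.card * 2 ^ 16 : ℝ) *
      ∑ Q ∈ Jk (A ∪ B), ∑ h ∈ Q, ex t (iB (B ∪ Q.erase h))
      + ∑ b ∈ B, ∑ Q ∈ Jk (A ∪ B), ex t (iB (B.erase b ∪ Q)) := by
    unfold Er
    rw [ex_add, ex_add, ex_smul, ex_smul]
    simp only [ex_sum']
  rw [e]
  have t1 : A.card * ex t (iB B) ≤ (s * k ^ s) * (n * x ^ (2 * B.card)) := by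
    have h1 := hiB B
    rw [mul_pow, ← pow_mul] at h1
    have h2 : k ^ B.card ≤ k ^ s := pow_le_pow_right₀ hk hBs'
    have h0 : 0 ≤ ex t (iB B) := ex_nonneg t (fun M _ => iB_nonneg B M)
    calc A.card * ex t (iB B) ≤ s * (k ^ s * (1 * x ^ (2 * B.card))) := by
          rw [one_mul]
          exact mul_le_mul hAs (h1.trans (by gcongr)) h0 (by positivity)
      _ ≤ s * (k ^ s * (n * x ^ (2 * B.card))) := by gcongr
      _ = _ := by ring
  have tQ : ∀ Q ∈ Jk (A ∪ B), ∀ b : ℕ, b = B.card + (Q.card - 1) →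
      (k * x ^ 2) ^ b ≤ k ^ (s + 16) * n * x ^ (2 * B.card) * x ^ (un Q \ U0).card := by
    rintro Q hQ b rfl
    rw [mem_Jk] at hQ
    exact pw_aux hk hx0 hx1 hm hBs' hQ.2.2.1 hQ.2.2.2.1 hQ.2.2.2.2
  have t2 : ∑ Q ∈ Jk (A ∪ B), ∑ h ∈ Q, ex t (iB (B ∪ Q.erase h)) ≤
      (16 * k ^ (s + 16) * cnt (4 * s) 16) * (n * x ^ (2 * B.card)) := by
    have : ∀ Q ∈ Jk (A ∪ B), ∑ h ∈ Q, ex t (iB (B ∪ Q.erase h)) ≤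
        16 * (k ^ (s + 16) * n * x ^ (2 * B.card)) * x ^ (un Q \ U0).card := by
      intro Q hQ
      have hQ' := mem_Jk.1 hQ
      have h1 : ∀ h ∈ Q, ex t (iB (B ∪ Q.erase h)) ≤
          k ^ (s + 16) * n * x ^ (2 * B.card) * x ^ (un Q \ U0).card := by
        intro h hh
        refine (hiB _).trans (tQ Q hQ _ ?_)
        rw [Finset.card_union_of_disjoint, Finset.card_erase_of_mem hh]
        refine Finset.disjoint_of_subset_right (Finset.erase_subset _ _) ?_
        exact (Finset.disjoint_union_right.1 hQ'.2.1).2.symm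
      refine (Finset.sum_le_sum h1).trans ?_
      rw [Finset.sum_const, nsmul_eq_mul]
      have : (Q.card : ℝ) ≤ 16 := by exact_mod_cast hQ'.2.2.2.1
      calc _ ≤ 16 * (k ^ (s + 16) * n * x ^ (2 * B.card) * x ^ (un Q \ U0).card) := by gcongr
        _ = _ := by ring
    refine (Finset.sum_le_sum this).trans ?_
    rw [← Finset.mul_sum]
    calc _ ≤ 16 * (k ^ (s + 16) * n * x ^ (2 * B.card)) * cnt (4 * s) 16 := by gcongr
      _ = _ := by ring
  have t3 : ∑ b ∈ B, ∑ Q ∈ Jk (A ∪ B), ex t (iB (B.erase b ∪ Q)) ≤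
      (s * (k ^ (s + 16) * cnt (4 * s) 16)) * (n * x ^ (2 * B.card)) := by
    have : ∀ b ∈ B, ∑ Q ∈ Jk (A ∪ B), ex t (iB (B.erase b ∪ Q)) ≤
        (k ^ (s + 16) * n * x ^ (2 * B.card)) * cnt (4 * s) 16 := by
      intro b hb
      have h1 : ∀ Q ∈ Jk (A ∪ B), ex t (iB (B.erase b ∪ Q)) ≤
          k ^ (s + 16) * n * x ^ (2 * B.card) * x ^ (un Q \ U0).card := by
        intro Q hQ
        have hQ' := mem_Jk.1 hQ
        refine (hiB _).trans (tQ Q hQ _ ?_)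
        rw [Finset.card_union_of_disjoint, Finset.card_erase_of_mem hb]
        · have := Finset.card_pos.2 ⟨b, hb⟩
          have := hQ'.2.2.1
          omega
        · refine Finset.disjoint_of_subset_left (Finset.erase_subset _ _) ?_
          exact (Finset.disjoint_union_right.1 hQ'.2.1).2.symm
      refine (Finset.sum_le_sum h1).trans ?_
      rw [← Finset.mul_sum]
      gcongr
    refine (Finset.sum_le_sum this).trans ?_
    rw [Finset.sum_const, nsmul_eq_mul]
    calc _ ≤ s * ((k ^ (s + 16) * n * x ^ (2 * B.card)) * cnt (4 * s) 16) := by gcongr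
      _ = _ := by ring
  have t2' : (3 + A.card * 2 ^ 16 : ℝ) * ∑ Q ∈ Jk (A ∪ B), ∑ h ∈ Q, ex t (iB (B ∪ Q.erase h)) ≤
      (3 + s * 2 ^ 16) * ((16 * k ^ (s + 16) * cnt (4 * s) 16) * (n * x ^ (2 * B.card))) := by
    refine mul_le_mul (by linarith) t2 ?_ (by positivity)
    exact Finset.sum_nonneg fun Q _ => Finset.sum_nonneg fun h _ => ex_nonneg t (fun M _ => iB_nonneg _ M)
  calc _ ≤ (s * k ^ s) * (n * x ^ (2 * B.card)) +
        (3 + s * 2 ^ 16) * ((16 * k ^ (s + 16) * cnt (4 * s) 16) * (n * x ^ (2 * B.card))) +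
        (s * (k ^ (s + 16) * cnt (4 * s) 16)) * (n * x ^ (2 * B.card)) := by linarith
    _ = _ := by unfold Es; ring

lemma evol (hn : 1 ≤ n) (hN : 0 < (Ed n).card) {A B : Finset (Finset (Fin n))} (H : Cls A B)
    {k : ℝ} (hk : 1 ≤ k) {t s : ℕ} (ht : (t:ℝ) / (Ed n).card ≤ k * (1 / (n:ℝ)) ^ 2)
    (hs : A.card + B.card ≤ s) :
    |((Ed n).card : ℝ) * (p (t + 1) A B - p t A B) + ∑ h ∈ G1 A B, p t (insert h A) B
      + ∑ x ∈ G2 A B, ∑ h ∈ x.2.erase x.1, p t (insert h A) (B ∪ (x.2.erase x.1).erase h)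
      - ∑ b ∈ B, p t (insert b A) (B.erase b)| ≤ Es k s * n * (1 / (n:ℝ)) ^ (2 * B.card) := by
  refine le_trans ?_ (ex_Er hn hN H hk ht hs)
  have := ex_abs t (fun M hM => ptw (M := M) hN H hM)
  rw [ex_sub, ex_add, ex_add, ex_smul, ex_sub] at this
  simp only [ex_sum'] at this
  exact this

lemma p_nonneg (t : ℕ) (A B : Finset (Finset (Fin n))) : 0 ≤ p t A B :=
  ex_nonneg t fun M _ => (ind_bounds A B M).1

lemma p_le (hN : 0 < (Ed n).card) {k : ℝ} {t : ℕ}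
    (ht : (t:ℝ) / (Ed n).card ≤ k * (1 / (n:ℝ)) ^ 2) (A B : Finset (Finset (Fin n))) :
    p t A B ≤ (k * (1 / (n:ℝ)) ^ 2) ^ B.card := by
  refine (ex_mono t fun M _ => (ind_bounds A B M).2).trans ((ex_iB hN t B).trans ?_)
  gcongr

end GRU


namespace GRU
open Finset

variable {n : ℕ}

/-- pairs inside the members of `A` -/
def pr (A : Finset (Finset (Fin n))) : Finset (Finset (Fin n)) := A.biUnion (fun a => a.powersetCard 2)

lemma mem_pr {A : Finset (Finset (Fin n))} {q : Finset (Fin n)} :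
    q ∈ pr A ↔ ∃ a ∈ A, q ⊆ a ∧ q.card = 2 := by
  simp [pr, Finset.mem_powersetCard]

lemma card_pr_le {A : Finset (Finset (Fin n))} (hA : A ⊆ Ed n) : (pr A).card ≤ 6 * A.card := by
  have : (pr A).card ≤ A.card * 6 := by
    refine Finset.card_biUnion_le_card_mul _ _ _ (fun a ha => ?_)
    rw [Finset.card_powersetCard, mem_Ed.1 (hA ha)]
    decide
  omega

lemma card_pr_insert {A : Finset (Finset (Fin n))} {h : Finset (Fin n)} (hh : h.card = 4) :
    (pr (insert h A)).card + (h.powersetCard 2 ∩ pr A).card = (pr A).card + 6 := by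
  have : pr (insert h A) = h.powersetCard 2 ∪ pr A := by simp [pr]
  rw [this, Finset.card_union_add_card_inter, Finset.card_powersetCard, hh]
  have : Nat.choose 4 2 = 6 := by decide
  omega

lemma card_pr_six {A : Finset (Finset (Fin n))} {h : Finset (Fin n)} (hh : h.card = 4)
    (h1 : ∀ a ∈ A, (h ∩ a).card ≤ 1) : (pr (insert h A)).card = (pr A).card + 6 := by
  have := card_pr_insert (A := A) hh
  have h0 : h.powersetCard 2 ∩ pr A = ∅ := by
    rw [Finset.eq_empty_iff_forall_notMem]
    intro q hq
    rw [Finset.mem_inter, Finset.mem_powersetCard, mem_pr] at hq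
    obtain ⟨⟨hqh, hq2⟩, a, ha, hqa, -⟩ := hq
    have := Finset.card_le_card (Finset.subset_inter hqh hqa)
    have := h1 a ha
    omega
  rw [h0] at this
  simpa using this

section
variable {A B : Finset (Finset (Fin n))}

lemma GenI.pr (hI : GenI A B h) : (GRU.pr (insert h A)).card = (GRU.pr A).card + 5 := by
  obtain ⟨hE, h2, a, ha, hsub⟩ := hI
  have := card_pr_insert (A := A) (mem_Ed.1 hE)
  have h0 : h.powersetCard 2 ∩ GRU.pr A = {h ∩ un (A ∪ B)} := by
    ext q
    rw [Finset.mem_inter, Finset.mem_powersetCard, mem_pr, Finset.mem_singleton]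
    constructor
    · rintro ⟨⟨hqh, hq2⟩, a', ha', hqa, -⟩
      refine Finset.eq_of_subset_of_card_le (Finset.subset_inter hqh
        (hqa.trans (sub_un (Finset.mem_union_left _ ha')))) (by omega)
    · rintro rfl
      exact ⟨⟨Finset.inter_subset_left, h2⟩, a, ha, hsub, h2⟩
  rw [h0, Finset.card_singleton] at this
  omega

lemma GenII.pr (H : Cls A B) (ha : a ∈ A) (hII : GenII A B a C) (hh : h ∈ C) (hha : h ≠ a) :
    (GRU.pr (insert h A)).card = (GRU.pr A).card + 6 := by
  obtain ⟨m, hE, h3, hc, haC, hU⟩ := hII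
  refine card_pr_six (mem_Ed.1 (hE hh)) (fun a' ha' => ?_)
  have hs : h ∩ a' ⊆ a ∩ h := by
    refine Finset.subset_inter ?_ Finset.inter_subset_left
    rw [← hU]
    exact Finset.inter_subset_inter (sub_un hh) (sub_un (Finset.mem_union_left _ ha'))
  have h1 := Finset.card_le_card hs
  have hu := Finset.card_union_add_card_inter a h
  rw [mem_Ed.1 (hE hh), mem_Ed.1 (hE haC)] at hu
  have hsub : ({a, h} : Finset (Finset (Fin n))) ⊆ C := by
    intro x hx; simp at hx; rcases hx with rfl | rfl <;> assumption
  have hcp : ({a, h} : Finset (Finset (Fin n))).card = 2 := Finset.card_pair hha.symm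
  have := m.proper (T := {a, h}) (Finset.ssubset_iff_subset_ne.2 ⟨hsub, by
    intro e; rw [e] at hcp; omega⟩) hcp.ge
  rw [un_pair, hcp] at this
  omega

lemma Cls.pr (H : Cls A B) (hb : b ∈ B) : (GRU.pr (insert b A)).card = (GRU.pr A).card + 6 := by
  refine card_pr_six (mem_Ed.1 (H.hB hb)) (fun a' ha' => ?_)
  rw [Finset.inter_comm]
  exact H.pair_AB ha' hb

lemma card_G1 (H : Cls A B) : (G1 A B).card = (GRU.pr A).card * (n - (un (A ∪ B)).card).choose 2 := by
  set U0 := un (A ∪ B) with hU0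
  have hc : (U0ᶜ.powersetCard 2).card = (n - U0.card).choose 2 := by
    rw [Finset.card_powersetCard, Finset.card_compl, Fintype.card_fin]
  rw [← hc, ← Finset.card_product]
  have hpU : ∀ q ∈ GRU.pr A, q ⊆ U0 ∧ q.card = 2 := by
    intro q hq
    obtain ⟨a, ha, hqa, hq2⟩ := mem_pr.1 hq
    exact ⟨hqa.trans (sub_un (Finset.mem_union_left _ ha)), hq2⟩
  have key : ∀ q r : Finset (Fin n), q ⊆ U0 → r ⊆ U0ᶜ → (q ∪ r) ∩ U0 = q ∧ (q ∪ r) \ U0 = r := by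
    intro q r hq hr
    have hr' : ∀ v ∈ r, v ∉ U0 := fun v hv => Finset.mem_compl.1 (hr hv)
    constructor
    · ext v
      simp only [Finset.mem_inter, Finset.mem_union]
      constructor
      · rintro ⟨h1 | h1, h2⟩
        · exact h1
        · exact absurd h2 (hr' v h1)
      · exact fun h1 => ⟨Or.inl h1, hq h1⟩
    · ext v
      simp only [Finset.mem_sdiff, Finset.mem_union]
      constructor
      · rintro ⟨h1 | h1, h2⟩
        · exact absurd (hq h1) h2
        · exact h1
      · exact fun h1 => ⟨Or.inr h1, hr' v h1⟩
  symm
  refine Finset.card_bij' (fun x _ => x.1 ∪ x.2) (fun h _ => (h ∩ U0, h \ U0)) ?_ ?_ ?_ ?_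
  · rintro ⟨q, r⟩ hx
    rw [Finset.mem_product, Finset.mem_powersetCard] at hx
    obtain ⟨hq, hr, hr2⟩ := hx
    have k := key q r (hpU q hq).1 hr
    rw [mem_G1]
    obtain ⟨a, ha, hqa, hq2⟩ := mem_pr.1 hq
    refine ⟨?_, ?_, a, ha, ?_⟩
    · rw [mem_Ed]
      have := Finset.card_sdiff_add_card_inter (q ∪ r) U0
      rw [k.1, k.2] at this
      simp only at this hr2 hq2 ⊢
      omega
    · rw [← hU0]; simp only [k.1]; exact hq2
    · rw [← hU0]; simp only [k.1]; exact hqa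
  · intro h hh
    rw [mem_G1] at hh
    obtain ⟨hE, h2, a, ha, hsub⟩ := hh
    rw [Finset.mem_product, Finset.mem_powersetCard, mem_pr]
    refine ⟨⟨a, ha, hsub, h2⟩, ?_, ?_⟩
    · intro v hv
      exact Finset.mem_compl.2 (Finset.mem_sdiff.1 hv).2
    · have := Finset.card_sdiff_add_card_inter h U0
      rw [mem_Ed.1 hE] at this
      rw [← hU0] at h2
      simp only
      omega
  · rintro ⟨q, r⟩ hx
    rw [Finset.mem_product, Finset.mem_powersetCard] at hx
    obtain ⟨hq, hr, hr2⟩ := hx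
    have k := key q r (hpU q hq).1 hr
    simp only [k.1, k.2]
  · intro h _
    exact inter_union_sdiff' h U0

end

/-- target value -/
noncomputable def tau (u g μ : ℝ) (A B : Finset (Finset (Fin n))) : ℝ :=
  u ^ (pr A).card * g ^ A.card * μ ^ B.card

section
variable {A B : Finset (Finset (Fin n))} (u g μ : ℝ)

lemma tau_I (H : Cls A B) : ∑ h ∈ G1 A B, tau u g μ (insert h A) B =
    (G1 A B).card * (u ^ ((pr A).card + 5) * g ^ (A.card + 1) * μ ^ B.card) := by
  rw [← nsmul_eq_mul, ← Finset.sum_const]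
  refine Finset.sum_congr rfl fun h hh => ?_
  rw [mem_G1] at hh
  have := hh.notMem
  rw [Finset.mem_union, not_or] at this
  rw [tau, hh.pr, Finset.card_insert_of_notMem this.1]

lemma card_newB (H : Cls A B) (ha : a ∈ A) (hII : GenII A B a C) (hh : h ∈ C) (hha : h ≠ a) :
    (B ∪ (C.erase a).erase h).card = B.card + (C.card - 2) := by
  rw [Finset.card_union_of_disjoint, Finset.card_erase_of_mem, Finset.card_erase_of_mem hII.2.2.2.2.1]
  · have := hII.2.2.1
    omega
  · exact Finset.mem_erase.2 ⟨hha, hh⟩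
  · rw [Finset.disjoint_right]
    intro x hx hxB
    rw [Finset.mem_erase, Finset.mem_erase] at hx
    exact hII.notMem (mem_Ed.1 (H.hA ha)) hx.2.2 hx.2.1 (Finset.mem_union_right _ hxB)

lemma tau_II (H : Cls A B) :
    ∑ x ∈ G2 A B, ∑ h ∈ x.2.erase x.1, tau u g μ (insert h A) (B ∪ (x.2.erase x.1).erase h) =
    (∑ x ∈ G2 A B, ((x.2.card - 1 : ℕ) : ℝ) * μ ^ (x.2.card - 2)) *
      (u ^ ((pr A).card + 6) * g ^ (A.card + 1) * μ ^ B.card) := by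
  rw [Finset.sum_mul]
  refine Finset.sum_congr rfl fun x hx => ?_
  rw [mem_G2] at hx
  have : ∀ h ∈ x.2.erase x.1, tau u g μ (insert h A) (B ∪ (x.2.erase x.1).erase h) =
      μ ^ (x.2.card - 2) * (u ^ ((pr A).card + 6) * g ^ (A.card + 1) * μ ^ B.card) := by
    intro h hh
    rw [Finset.mem_erase] at hh
    have hn := hx.2.notMem (mem_Ed.1 (H.hA hx.1)) hh.2 hh.1
    rw [Finset.mem_union, not_or] at hn
    rw [tau, hx.2.pr H hx.1 hh.2 hh.1, Finset.card_insert_of_notMem hn.1,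
      card_newB H hx.1 hx.2 hh.2 hh.1, pow_add μ]
    ring
  rw [Finset.sum_congr rfl this, Finset.sum_const, nsmul_eq_mul,
    Finset.card_erase_of_mem hx.2.2.2.2.2.1]
  ring

lemma tau_III (H : Cls A B) : ∑ b ∈ B, tau u g μ (insert b A) (B.erase b) =
    B.card * (u ^ ((pr A).card + 6) * g ^ (A.card + 1) * μ ^ (B.card - 1)) := by
  rw [← nsmul_eq_mul, ← Finset.sum_const]
  refine Finset.sum_congr rfl fun b hb => ?_
  have hbA : b ∉ A := fun h => Finset.disjoint_left.1 H.disj h hb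
  rw [tau, H.pr hb, Finset.card_insert_of_notMem hbA, Finset.card_erase_of_mem hb]

end

/-- tight configurations through `a` -/
def Tight (a : Finset (Fin n)) (C : Finset (Finset (Fin n))) : Prop :=
  MinBad C ∧ C ⊆ Ed n ∧ 3 ≤ C.card ∧ (un C).card = 2 * C.card + 2 ∧ a ∈ C

open Classical in
noncomputable def Tg (a : Finset (Fin n)) : Finset (Finset (Finset (Fin n))) :=
  (Ed n).powerset.filter (Tight a)

lemma mem_Tg {a : Finset (Fin n)} {C : Finset (Finset (Fin n))} : C ∈ Tg a ↔ Tight a C := by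
  classical
  simp only [Tg, Finset.mem_filter, Finset.mem_powerset, and_iff_right_iff_imp]
  exact fun h => h.2.1

/-- weighted number of tight configurations -/
noncomputable def GG (a : Finset (Fin n)) (μ : ℝ) : ℝ :=
  ∑ C ∈ Tg a, ((C.card - 1 : ℕ) : ℝ) * μ ^ (C.card - 2)

section symm
variable (σ : Equiv.Perm (Fin n))

/-- action on sets of blocks -/
abbrev act : Finset (Finset (Fin n)) ≃ Finset (Finset (Fin n)) := σ.finsetCongr.finsetCongr

lemma act_card (C : Finset (Finset (Fin n))) : (act σ C).card = C.card := by
  simp [act, Equiv.finsetCongr_apply]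

lemma un_act (C : Finset (Finset (Fin n))) : un (act σ C) = σ.finsetCongr (un C) := by
  ext v
  simp only [mem_un, act, Equiv.finsetCongr_apply, Finset.mem_map, Equiv.coe_toEmbedding]
  constructor
  · rintro ⟨b, ⟨c, hc, rfl⟩, hv⟩
    simp only [Equiv.finsetCongr_apply, Finset.mem_map, Equiv.coe_toEmbedding] at hv
    obtain ⟨w, hw, rfl⟩ := hv
    exact ⟨w, ⟨c, hc, hw⟩, rfl⟩
  · rintro ⟨w, hw, rfl⟩
    obtain ⟨c, hc, hwc⟩ := hw
    exact ⟨_, ⟨c, hc, rfl⟩, by simpa [Equiv.finsetCongr_apply] using hwc⟩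

lemma bad_act (C : Finset (Finset (Fin n))) : Bad (act σ C) ↔ Bad C := by
  unfold Bad
  rw [un_act, act_card]
  simp [Equiv.finsetCongr_apply]

lemma act_subset (C D : Finset (Finset (Fin n))) : act σ C ⊆ act σ D ↔ C ⊆ D := by
  simp [act, Equiv.finsetCongr_apply]

lemma minbad_act (C : Finset (Finset (Fin n))) (h : MinBad C) : MinBad (act σ C) := by
  refine ⟨(bad_act σ C).2 h.1, fun T hT hb => ?_⟩
  obtain ⟨T', rfl⟩ := (act σ).surjective T
  rw [bad_act] at hb
  refine h.2 T' ?_ hb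
  rw [Finset.ssubset_def, act_subset, act_subset] at hT
  exact Finset.ssubset_def.2 hT

lemma tight_act (a : Finset (Fin n)) (C : Finset (Finset (Fin n))) (h : Tight a C) :
    Tight (σ.finsetCongr a) (act σ C) := by
  obtain ⟨m, hE, h3, hc, ha⟩ := h
  refine ⟨minbad_act σ C m, ?_, by rwa [act_card], ?_, ?_⟩
  · intro b hb
    simp only [act, Equiv.finsetCongr_apply, Finset.mem_map, Equiv.coe_toEmbedding] at hb
    obtain ⟨c, hc, rfl⟩ := hb
    rw [mem_Ed]
    simpa [Equiv.finsetCongr_apply] using mem_Ed.1 (hE hc)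
  · rw [un_act, act_card, ← hc]; simp [Equiv.finsetCongr_apply]
  · simp only [act, Equiv.finsetCongr_apply, Finset.mem_map, Equiv.coe_toEmbedding]
    exact ⟨a, ha, rfl⟩

lemma GG_eq {a a' : Finset (Fin n)} (ha : a ∈ Ed n) (ha' : a' ∈ Ed n) (μ : ℝ) : GG a μ = GG a' μ := by
  rw [mem_Ed] at ha ha'
  obtain ⟨σ, hσ⟩ : ∃ σ : Equiv.Perm (Fin n), σ.finsetCongr a = a' := by
    have e : {x // x ∈ a} ≃ {x // x ∈ a'} := Finset.equivOfCardEq (ha.trans ha'.symm)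
    refine ⟨e.extendSubtype, ?_⟩
    refine Finset.eq_of_subset_of_card_le ?_ ?_
    · intro v hv
      simp only [Equiv.finsetCongr_apply, Finset.mem_map, Equiv.coe_toEmbedding] at hv
      obtain ⟨w, hw, rfl⟩ := hv
      exact Equiv.extendSubtype_mem e w hw
    · simp [Equiv.finsetCongr_apply, ha, ha']
  have hσ' : σ.symm.finsetCongr a' = a := by
    rw [← hσ]
    simp [Equiv.finsetCongr_apply, Finset.map_map]
  unfold GG
  refine Finset.sum_bij' (fun C _ => act σ C) (fun C _ => act σ.symm C) ?_ ?_ ?_ ?_ ?_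
  · intro C hC
    rw [mem_Tg] at *
    rw [← hσ]; exact tight_act σ a C hC
  · intro C hC
    rw [mem_Tg] at *
    rw [← hσ']; exact tight_act σ.symm a' C hC
  · intro C _
    exact (act σ).symm_apply_apply C
  · intro C _
    exact (act σ).apply_symm_apply C
  · intro C _
    rw [act_card]
end symm

end GRU


namespace GRU
open Finset

variable {n : ℕ}

/-- weight of a configuration -/
noncomputable def Wt (μ : ℝ) (C : Finset (Finset (Fin n))) : ℝ := ((C.card - 1 : ℕ) : ℝ) * μ ^ (C.card - 2)

lemma Wt_nonneg {μ : ℝ} (h : 0 ≤ μ) (C : Finset (Finset (Fin n))) : 0 ≤ Wt μ C := by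
  unfold Wt; positivity

lemma Wt_le {μ k : ℝ} (h : 0 ≤ μ) (hk : 1 ≤ k) (hμ : μ ≤ k * (1 / (n:ℝ)) ^ 2)
    {C : Finset (Finset (Fin n))} (hC : C.card ≤ 8) :
    Wt μ C ≤ 7 * k ^ 6 * (1 / (n:ℝ)) ^ (2 * (C.card - 2)) := by
  unfold Wt
  have h1 : ((C.card - 1 : ℕ) : ℝ) ≤ 7 := by
    have : C.card - 1 ≤ 7 := by omega
    exact_mod_cast this
  have h2 : μ ^ (C.card - 2) ≤ k ^ 6 * (1 / (n:ℝ)) ^ (2 * (C.card - 2)) := by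
    calc μ ^ (C.card - 2) ≤ (k * (1 / (n:ℝ)) ^ 2) ^ (C.card - 2) := pow_le_pow_left₀ h hμ _
      _ = k ^ (C.card - 2) * (1 / (n:ℝ)) ^ (2 * (C.card - 2)) := by rw [mul_pow, ← pow_mul]
      _ ≤ _ := by
        gcongr
        omega
  calc _ ≤ 7 * (k ^ 6 * (1 / (n:ℝ)) ^ (2 * (C.card - 2))) :=
        mul_le_mul h1 h2 (by positivity) (by norm_num)
    _ = _ := by ring

lemma GG_nonneg {μ : ℝ} (h : 0 ≤ μ) (a : Finset (Fin n)) : 0 ≤ GG a μ :=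
  Finset.sum_nonneg fun C _ => Wt_nonneg h C

lemma x_pow_shift (hn : 1 ≤ n) {i j m : ℕ} (h : j ≤ i + m) :
    (1 / (n:ℝ)) ^ i ≤ (n:ℝ) ^ m * (1 / (n:ℝ)) ^ j := by
  have hn' : (1:ℝ) ≤ n := by exact_mod_cast hn
  have h0 : (0:ℝ) < n := by linarith
  have hx : 1 / (n:ℝ) ≤ 1 := by rw [div_le_one h0]; exact hn'
  calc (1 / (n:ℝ)) ^ i = (n:ℝ) ^ m * (1 / (n:ℝ)) ^ (i + m) := by
        rw [pow_add, one_div, inv_pow, inv_pow]; field_simp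
    _ ≤ _ := by
        gcongr ?_ * ?_
        exact pow_le_pow_of_le_one (by positivity) hx h

lemma GG_le (hn : 1 ≤ n) {μ k : ℝ} (h : 0 ≤ μ) (hk : 1 ≤ k) (hμ : μ ≤ k * (1 / (n:ℝ)) ^ 2)
    {a : Finset (Fin n)} (ha : a ∈ Ed n) : GG a μ ≤ 7 * k ^ 6 * cnt 4 8 * (n:ℝ) ^ 2 := by
  have ha4 := mem_Ed.1 ha
  have h1 : ∀ C ∈ Tg a, Wt μ C ≤ 7 * k ^ 6 * (n:ℝ) ^ 2 * (1 / (n:ℝ)) ^ (un C \ a).card := by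
    intro C hC
    obtain ⟨m, hE, h3, hc, haC⟩ := mem_Tg.1 hC
    refine (Wt_le h hk hμ m.1.2.1).trans ?_
    rw [mul_assoc (7 * k ^ 6)]
    gcongr ?_ * ?_
    apply x_pow_shift hn
    rw [Finset.card_sdiff_of_subset (sub_un haC)]
    omega
  calc GG a μ = ∑ C ∈ Tg a, Wt μ C := rfl
    _ ≤ ∑ C ∈ Tg a, 7 * k ^ 6 * (n:ℝ) ^ 2 * (1 / (n:ℝ)) ^ (un C \ a).card := Finset.sum_le_sum h1
    _ = 7 * k ^ 6 * (n:ℝ) ^ 2 * ∑ C ∈ Tg a, (1 / (n:ℝ)) ^ (un C \ a).card := by rw [Finset.mul_sum]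
    _ ≤ 7 * k ^ 6 * (n:ℝ) ^ 2 * cnt 4 8 := by
        gcongr
        exact cnt_sum hn a 4 8 ha4.le _ fun C hC => ⟨(mem_Tg.1 hC).2.1, (mem_Tg.1 hC).1.1.2.1⟩
    _ = _ := by ring

/-- weighted number of generic configurations -/
noncomputable def S2 (A B : Finset (Finset (Fin n))) (μ : ℝ) : ℝ := ∑ x ∈ G2 A B, Wt μ x.2

open Classical in
lemma S2_eq (A B : Finset (Finset (Fin n))) (μ : ℝ) :
    S2 A B μ = ∑ a ∈ A, ∑ C ∈ (Tg a).filter (fun C => un C ∩ un (A ∪ B) = a), Wt μ C := by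
  unfold S2
  rw [G2, Finset.sum_filter, Finset.sum_product]
  refine Finset.sum_congr rfl fun a ha => ?_
  rw [← Finset.sum_filter]
  refine Finset.sum_congr ?_ fun _ _ => rfl
  ext C
  rw [Finset.mem_filter, Finset.mem_filter]
  simp only [Finset.mem_powerset, mem_Tg, GenII, Tight]
  tauto

open Classical in
lemma S2_diff (A B : Finset (Finset (Fin n))) (μ : ℝ) :
    ∑ a ∈ A, GG a μ - S2 A B μ =
      ∑ a ∈ A, ∑ C ∈ (Tg a).filter (fun C => ¬ un C ∩ un (A ∪ B) = a), Wt μ C := by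
  rw [S2_eq, ← Finset.sum_sub_distrib]
  refine Finset.sum_congr rfl fun a ha => ?_
  rw [sub_eq_iff_eq_add, add_comm, Finset.sum_filter_add_sum_filter_not]
  rfl

lemma S2_nonneg {μ : ℝ} (h : 0 ≤ μ) (A B : Finset (Finset (Fin n))) : 0 ≤ S2 A B μ :=
  Finset.sum_nonneg fun _ _ => Wt_nonneg h _

lemma S2_le {μ : ℝ} (h : 0 ≤ μ) (A B : Finset (Finset (Fin n))) : S2 A B μ ≤ ∑ a ∈ A, GG a μ := by
  rw [← sub_nonneg, S2_diff]
  exact Finset.sum_nonneg fun _ _ => Finset.sum_nonneg fun _ _ => Wt_nonneg h _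

lemma S2_close (hn : 1 ≤ n) {μ k : ℝ} (h : 0 ≤ μ) (hk : 1 ≤ k) (hμ : μ ≤ k * (1 / (n:ℝ)) ^ 2)
    {A B : Finset (Finset (Fin n))} (H : Cls A B) {s : ℕ} (hs : A.card + B.card ≤ s) :
    ∑ a ∈ A, GG a μ - S2 A B μ ≤ s * (7 * k ^ 6 * cnt (4 * s) 8) * n := by
  classical
  have hU : (un (A ∪ B)).card ≤ 4 * s := by
    have := card_un_le (A ∪ B) (Finset.union_subset H.hA H.hB)
    have := Finset.card_union_le A B
    omega
  rw [S2_diff]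
  have h0 : ∀ a ∈ A, ∑ C ∈ (Tg a).filter (fun C => ¬ un C ∩ un (A ∪ B) = a), Wt μ C ≤
      7 * k ^ 6 * cnt (4 * s) 8 * n := by
    intro a ha
    have ha4 := mem_Ed.1 (H.hA ha)
    have h1 : ∀ C ∈ (Tg a).filter (fun C => ¬ un C ∩ un (A ∪ B) = a),
        Wt μ C ≤ 7 * k ^ 6 * (n:ℝ) ^ 1 * (1 / (n:ℝ)) ^ (un C \ un (A ∪ B)).card := by
      intro C hC
      rw [Finset.mem_filter, mem_Tg] at hC
      obtain ⟨⟨m, hE, h3, hc, haC⟩, hne⟩ := hC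
      refine (Wt_le h hk hμ m.1.2.1).trans ?_
      rw [mul_assoc (7 * k ^ 6)]
      gcongr ?_ * ?_
      apply x_pow_shift hn
      have hss : a ⊂ un C ∩ un (A ∪ B) := by
        refine (Finset.subset_inter (sub_un haC) (sub_un (Finset.mem_union_left _ ha))).ssubset_of_ne ?_
        exact fun h => hne h.symm
      have h5 := Finset.card_lt_card hss
      have h6 := Finset.card_sdiff_add_card_inter (un C) (un (A ∪ B))
      omega
    calc _ ≤ ∑ C ∈ (Tg a).filter (fun C => ¬ un C ∩ un (A ∪ B) = a),
          7 * k ^ 6 * (n:ℝ) ^ 1 * (1 / (n:ℝ)) ^ (un C \ un (A ∪ B)).card := Finset.sum_le_sum h1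
      _ = 7 * k ^ 6 * (n:ℝ) ^ 1 * ∑ C ∈ (Tg a).filter (fun C => ¬ un C ∩ un (A ∪ B) = a),
          (1 / (n:ℝ)) ^ (un C \ un (A ∪ B)).card := by rw [Finset.mul_sum]
      _ ≤ 7 * k ^ 6 * (n:ℝ) ^ 1 * cnt (4 * s) 8 := by
          gcongr
          refine cnt_sum hn _ (4 * s) 8 hU _ fun C hC => ?_
          have := mem_Tg.1 (Finset.mem_filter.1 hC).1
          exact ⟨this.2.1, this.1.1.2.1⟩
      _ = _ := by ring
  calc _ ≤ ∑ a ∈ A, 7 * k ^ 6 * (cnt (4 * s) 8 : ℝ) * n := Finset.sum_le_sum h0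
    _ = A.card * (7 * k ^ 6 * (cnt (4 * s) 8 : ℝ) * n) := by rw [Finset.sum_const, nsmul_eq_mul]
    _ ≤ s * (7 * k ^ 6 * (cnt (4 * s) 8 : ℝ) * n) := by
        gcongr
        omega
    _ = _ := by ring

/-- common value of the weighted count -/
noncomputable def Gn (n : ℕ) (μ : ℝ) : ℝ := (∑ a ∈ Ed n, GG a μ) / (Ed n).card

lemma Gn_eq {a : Finset (Fin n)} (ha : a ∈ Ed n) (μ : ℝ) : GG a μ = Gn n μ := by
  unfold Gn
  have : (0:ℝ) < (Ed n).card := by exact_mod_cast Finset.card_pos.2 ⟨a, ha⟩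
  rw [Finset.sum_congr rfl (fun b hb => GG_eq hb ha μ), Finset.sum_const, nsmul_eq_mul]
  field_simp

lemma Gn_nonneg {μ : ℝ} (h : 0 ≤ μ) : 0 ≤ Gn n μ :=
  div_nonneg (Finset.sum_nonneg fun a _ => GG_nonneg h a) (by positivity)

lemma Gn_le (hn : 1 ≤ n) (hN : 0 < (Ed n).card) {μ k : ℝ} (h : 0 ≤ μ) (hk : 1 ≤ k)
    (hμ : μ ≤ k * (1 / (n:ℝ)) ^ 2) : Gn n μ ≤ 7 * k ^ 6 * cnt 4 8 * (n:ℝ) ^ 2 := by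
  obtain ⟨a, ha⟩ := Finset.card_pos.1 hN
  rw [← Gn_eq ha]
  exact GG_le hn h hk hμ ha

lemma sum_GG {A : Finset (Finset (Fin n))} (hA : A ⊆ Ed n) (μ : ℝ) :
    ∑ a ∈ A, GG a μ = A.card * Gn n μ := by
  rw [Finset.sum_congr rfl (fun a ha => Gn_eq (hA ha) μ), Finset.sum_const, nsmul_eq_mul]

/-- number of loss terms of the second kind -/
lemma II_count (hn : 1 ≤ n) (hN : 0 < (Ed n).card) {A B : Finset (Finset (Fin n))} (H : Cls A B) :
    ∑ x ∈ G2 A B, ∑ h ∈ x.2.erase x.1, (1 / (n:ℝ)) ^ (2 * (B ∪ (x.2.erase x.1).erase h).card) ≤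
      A.card * (7 * cnt 4 8) * (n:ℝ) ^ 2 * (1 / (n:ℝ)) ^ (2 * B.card) := by
  have key : ∑ x ∈ G2 A B, ∑ h ∈ x.2.erase x.1, (1 / (n:ℝ)) ^ (2 * (B ∪ (x.2.erase x.1).erase h).card)
      = S2 A B ((1 / (n:ℝ)) ^ 2) * (1 / (n:ℝ)) ^ (2 * B.card) := by
    have := tau_II (u := 1) (g := 1) (μ := (1 / (n:ℝ)) ^ 2) H
    simp only [tau, one_pow, one_mul] at this
    simp only [pow_mul]
    exact this
  rw [key]
  gcongr
  refine (S2_le (by positivity) A B).trans ?_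
  rw [sum_GG H.hA, mul_assoc]
  gcongr
  have := Gn_le hn hN (μ := (1 / (n:ℝ)) ^ 2) (k := 1) (by positivity) le_rfl (by rw [one_mul])
  simpa using this

end GRU


namespace GRU
open Finset

/-- the constant bounding the weighted count -/
noncomputable def c0 : ℝ := 7 * 4 ^ 6 * (cnt 4 8 : ℝ) + 1

lemma c0_pos : 1 ≤ c0 := by
  unfold c0
  have : (0:ℝ) ≤ 7 * 4 ^ 6 * (cnt 4 8 : ℝ) := by positivity
  linarith

noncomputable def NN (n : ℕ) : ℝ := ((Ed n).card : ℝ)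
noncomputable def DD (n : ℕ) : ℝ := ((n - 2).choose 2 : ℝ)

/-- `n` is large -/
structure Bg (n : ℕ) : Prop where
  h100 : 100 ≤ n
  hN1 : (n:ℝ) ^ 4 ≤ 48 * NN n
  hN2 : 24 * NN n ≤ (n:ℝ) ^ 4
  hD1 : (n:ℝ) ^ 2 ≤ 4 * DD n
  hD2 : DD n ≤ (n:ℝ) ^ 2
  hPD : 6 * NN n = (n.choose 2 : ℝ) * DD n
  hc : 96 * c0 ≤ (n:ℝ) ^ 2

lemma exists_Bg : ∃ n0, ∀ n ≥ n0, Bg n := by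
  obtain ⟨m, hm⟩ := exists_nat_ge (96 * c0)
  refine ⟨max 100 m, fun n hn => ?_⟩
  have h1 : 100 ≤ n := (le_max_left _ _).trans hn
  have h2 : m ≤ n := (le_max_right _ _).trans hn
  have h1' : (100:ℝ) ≤ n := by exact_mod_cast h1
  have h2' : (m:ℝ) ≤ n := by exact_mod_cast h2
  have hD : DD n = ((n:ℝ) - 2) * ((n:ℝ) - 3) / 2 := by
    unfold DD
    rw [Nat.cast_choose_two, Nat.cast_sub (by omega)]
    push_cast; ring
  have hP : (n.choose 2 : ℝ) = (n:ℝ) * ((n:ℝ) - 1) / 2 := Nat.cast_choose_two ℝ n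
  have hPD : 6 * NN n = (n.choose 2 : ℝ) * DD n := by
    unfold NN DD
    have : (Ed n).card = n.choose 4 := by
      rw [Ed, Finset.card_powersetCard]; simp
    rw [this]
    have h := Nat.choose_mul (n := n) (k := 4) (s := 2) (by omega)
    have h6 : Nat.choose 4 2 = 6 := by decide
    rw [h6] at h
    have h' : (4 - 2 : ℕ) = 2 := rfl
    rw [h'] at h
    rw [mul_comm]
    exact_mod_cast h
  rw [hP, hD] at hPD
  refine ⟨h1, ?_, ?_, ?_, ?_, ?_, ?_⟩
  · nlinarith [mul_nonneg (by linarith : (0:ℝ) ≤ n - 100) (by positivity : (0:ℝ) ≤ (n:ℝ)^3), mul_nonneg (by linarith : (0:ℝ) ≤ n - 100) (by positivity : (0:ℝ) ≤ (n:ℝ)^2), mul_nonneg (by linarith : (0:ℝ) ≤ n - 100) (by positivity : (0:ℝ) ≤ (n:ℝ))]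
  · nlinarith [mul_nonneg (by linarith : (0:ℝ) ≤ n - 100) (by positivity : (0:ℝ) ≤ (n:ℝ)^3), mul_nonneg (by linarith : (0:ℝ) ≤ n - 100) (by positivity : (0:ℝ) ≤ (n:ℝ)^2), mul_nonneg (by linarith : (0:ℝ) ≤ n - 100) (by positivity : (0:ℝ) ≤ (n:ℝ))]
  · rw [hD]; nlinarith
  · rw [hD]; nlinarith
  · rw [hP, hD]; exact hPD
  · nlinarith

/-- the trajectory: `(g, μ)` -/
noncomputable def sq (n : ℕ) : ℕ → ℝ × ℝ
  | 0 => (1, 0)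
  | t + 1 => let g := (sq n t).1; let μ := (sq n t).2; let u := 1 - DD n * μ
    (g - 1 / NN n * Gn n μ * u ^ 6 * g ^ 2, μ + 1 / NN n * u ^ 6 * g)

noncomputable def sg (n t : ℕ) : ℝ := (sq n t).1
noncomputable def sm (n t : ℕ) : ℝ := (sq n t).2
noncomputable def su (n t : ℕ) : ℝ := 1 - DD n * sm n t

lemma sg_zero (n : ℕ) : sg n 0 = 1 := rfl
lemma sm_zero (n : ℕ) : sm n 0 = 0 := rfl
lemma su_zero (n : ℕ) : su n 0 = 1 := by simp [su, sm_zero]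
lemma sg_succ (n t : ℕ) : sg n (t+1) = sg n t - 1 / NN n * Gn n (sm n t) * su n t ^ 6 * sg n t ^ 2 := rfl
lemma sm_succ (n t : ℕ) : sm n (t+1) = sm n t + 1 / NN n * su n t ^ 6 * sg n t := rfl
lemma su_succ (n t : ℕ) : su n (t+1) = su n t - DD n / NN n * su n t ^ 6 * sg n t := by
  rw [su, sm_succ, su]; ring

section

lemma Bg.n1 {n : ℕ} (hB : Bg n) : 1 ≤ n := by have := hB.h100; omega
lemma Bg.np {n : ℕ} (hB : Bg n) : (0:ℝ) < n := by have := hB.n1; exact_mod_cast this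
lemma Bg.Np {n : ℕ} (hB : Bg n) : 0 < NN n := by have := hB.hN1; have := pow_pos hB.np 4; linarith
lemma Bg.Nc {n : ℕ} (hB : Bg n) : 0 < (Ed n).card := by have := hB.Np; unfold NN at this; exact_mod_cast this
lemma Bg.Dp {n : ℕ} (hB : Bg n) : 0 < DD n := by have := hB.hD1; have := pow_pos hB.np 2; linarith

lemma Bg.invN {n : ℕ} (hB : Bg n) : 1 / NN n ≤ 48 * (1 / (n:ℝ)) ^ 4 := by
  have h1 := hB.hN1
  have := hB.np
  rw [div_le_iff₀ hB.Np, one_div, inv_pow]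
  have h4 : (0:ℝ) < (n:ℝ) ^ 4 := by positivity
  have : (1:ℝ) = ((n:ℝ) ^ 4)⁻¹ * (n:ℝ) ^ 4 := (inv_mul_cancel₀ h4.ne').symm
  calc (1:ℝ) = ((n:ℝ) ^ 4)⁻¹ * (n:ℝ) ^ 4 := this
    _ ≤ ((n:ℝ) ^ 4)⁻¹ * (48 * NN n) := by gcongr
    _ = _ := by ring

lemma Bg.mu_of_u {n : ℕ} (hB : Bg n) {μ : ℝ} (h : 0 ≤ 1 - DD n * μ) : μ ≤ 4 * (1 / (n:ℝ)) ^ 2 := by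
  have hn := hB.np
  have h1 : μ ≤ 1 / DD n := by rw [le_div_iff₀ hB.Dp]; linarith
  refine h1.trans ?_
  rw [div_le_iff₀ hB.Dp, one_div, inv_pow]
  have := hB.hD1
  have h4 : (0:ℝ) < (n:ℝ) ^ 2 := by positivity
  calc (1:ℝ) = ((n:ℝ) ^ 2)⁻¹ * (n:ℝ) ^ 2 := (inv_mul_cancel₀ h4.ne').symm
    _ ≤ ((n:ℝ) ^ 2)⁻¹ * (4 * DD n) := by gcongr
    _ = _ := by ring

lemma Bg.Gn_le {n : ℕ} (hB : Bg n) {μ : ℝ} (h0 : 0 ≤ μ) (h : μ ≤ 4 * (1 / (n:ℝ)) ^ 2) : Gn n μ ≤ c0 * (n:ℝ) ^ 2 := by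
  refine (GRU.Gn_le hB.n1 hB.Nc h0 (by norm_num) h).trans ?_
  unfold c0
  have : (0:ℝ) ≤ (n:ℝ)^2 := by positivity
  nlinarith

lemma Bg.GnN {n : ℕ} (hB : Bg n) {μ : ℝ} (h0 : 0 ≤ μ) (h : μ ≤ 4 * (1 / (n:ℝ)) ^ 2) :
    1 / NN n * Gn n μ ≤ 48 * c0 * (1 / (n:ℝ)) ^ 2 := by
  have hn := hB.np
  have := c0_pos
  calc 1 / NN n * Gn n μ ≤ (48 * (1 / (n:ℝ)) ^ 4) * (c0 * (n:ℝ) ^ 2) :=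
        mul_le_mul hB.invN (hB.Gn_le h0 h) (Gn_nonneg h0) (by positivity)
    _ = _ := by field_simp

lemma Bg.x2 {n : ℕ} (hB : Bg n) : 96 * c0 * (1 / (n:ℝ)) ^ 2 ≤ 1 := by
  have := hB.hc
  have hn := hB.np
  rw [one_div, inv_pow, mul_inv_le_iff₀ (by positivity)]
  linarith

lemma Bg.DN {n : ℕ} (hB : Bg n) : DD n / NN n ≤ 48 * (1 / (n:ℝ)) ^ 2 := by
  have hn := hB.np
  calc DD n / NN n = (1 / NN n) * DD n := by ring
    _ ≤ (48 * (1 / (n:ℝ)) ^ 4) * (n:ℝ) ^ 2 := mul_le_mul hB.invN hB.hD2 hB.Dp.le (by positivity)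
    _ = _ := by field_simp

lemma seq_bounds {n : ℕ} (hB : Bg n) (t : ℕ) : (0 ≤ su n t ∧ su n t ≤ 1) ∧ (0 < sg n t ∧ sg n t ≤ 1) ∧ 0 ≤ sm n t ∧
    Real.exp (-(2 * c0 * (n:ℝ) ^ 2 * sm n t)) ≤ sg n t := by
  have hN := hB.Np
  have hn := hB.np
  have hc := c0_pos
  induction t with
  | zero => simp [su_zero, sg_zero, sm_zero]
  | succ t ih =>
    obtain ⟨⟨u0, u1⟩, ⟨g0, g1⟩, m0, e⟩ := ih
    have hm4 := hB.mu_of_u u0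
    have hGn := hB.Gn_le m0 hm4
    have hG0 : 0 ≤ Gn n (sm n t) := Gn_nonneg m0
    have hGN := hB.GnN m0 hm4
    have hx := hB.x2
    have hDN := hB.DN
    have hDN0 : 0 ≤ DD n / NN n := div_nonneg hB.Dp.le hN.le
    have hx0 : 0 ≤ (1 / (n:ℝ)) ^ 2 := by positivity
    have hDN1 : DD n / NN n ≤ 1 := by nlinarith
    have hu5 : su n t ^ 5 ≤ 1 := pow_le_one₀ u0 u1
    have hu6 : su n t ^ 6 ≤ 1 := pow_le_one₀ u0 u1
    set u := su n t with hu
    set g := sg n t with hg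
    set y := 1 / NN n * Gn n (sm n t) * u ^ 6 * g with hy
    have hy0 : 0 ≤ y := by positivity
    have hb0 : 0 ≤ 1 / NN n * Gn n (sm n t) := by positivity
    have hy1 : y ≤ 1 / 2 := by
      calc y ≤ 1 / NN n * Gn n (sm n t) * 1 * 1 := by rw [hy]; gcongr
        _ ≤ 1 / 2 := by linarith
    have hgs : sg n (t+1) = g * (1 - y) := by rw [sg_succ, hy]; ring
    refine ⟨⟨?_, ?_⟩, ⟨?_, ?_⟩, ?_, ?_⟩
    · have : su n (t+1) = u * (1 - DD n / NN n * u ^ 5 * g) := by rw [su_succ]; ring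
      rw [this]
      have : DD n / NN n * u ^ 5 * g ≤ 1 * 1 * 1 := by gcongr
      exact mul_nonneg u0 (by linarith)
    · rw [su_succ]
      have : 0 ≤ DD n / NN n * u ^ 6 * g := by positivity
      linarith
    · rw [hgs]; apply mul_pos g0; linarith
    · rw [hgs]; nlinarith
    · rw [sm_succ]; positivity
    · rw [hgs]
      have h1 : y ≤ c0 * (n:ℝ)^2 * (1 / NN n * u ^ 6 * g) := by
        calc y = Gn n (sm n t) * (1 / NN n * u ^ 6 * g) := by rw [hy]; ring
          _ ≤ _ := by gcongr
      have h2 : Real.exp (-(2 * y)) ≤ 1 - y := by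
        rw [Real.exp_neg, inv_le_iff_one_le_mul₀ (Real.exp_pos _)]
        have := Real.add_one_le_exp (2 * y)
        nlinarith
      calc Real.exp (-(2 * c0 * (n:ℝ) ^ 2 * sm n (t+1)))
          ≤ Real.exp (-(2 * c0 * (n:ℝ) ^ 2 * sm n t) + -(2 * y)) := by
            apply Real.exp_le_exp.2
            rw [sm_succ]; linarith
        _ = Real.exp (-(2 * c0 * (n:ℝ) ^ 2 * sm n t)) * Real.exp (-(2 * y)) := Real.exp_add _ _
        _ ≤ g * (1 - y) := mul_le_mul e h2 (Real.exp_pos _).le g0.le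

lemma sm_le {n : ℕ} (hB : Bg n) (t : ℕ) : sm n t ≤ 4 * (1 / (n:ℝ)) ^ 2 := hB.mu_of_u (seq_bounds hB t).1.1

/-- uniform lower bound for `g` -/
lemma sg_ge {n : ℕ} (hB : Bg n) (t : ℕ) : Real.exp (-(8 * c0)) ≤ sg n t := by
  refine le_trans (Real.exp_le_exp.2 ?_) (seq_bounds hB t).2.2.2
  have h1 := sm_le hB t
  have hn := hB.np
  have h2 : (n:ℝ)^2 * sm n t ≤ 4 := by
    calc (n:ℝ)^2 * sm n t ≤ (n:ℝ)^2 * (4 * (1 / (n:ℝ)) ^ 2) := by gcongr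
      _ = 4 := by field_simp
  nlinarith [c0_pos]

lemma su_anti {n : ℕ} (hB : Bg n) (t : ℕ) : su n (t+1) ≤ su n t := by
  obtain ⟨⟨u0, u1⟩, ⟨g0, g1⟩, m0, e⟩ := seq_bounds hB t
  rw [su_succ]
  have := hB.Dp
  have := hB.Np
  have : 0 ≤ DD n / NN n * su n t ^ 6 * sg n t := by positivity
  linarith

lemma su_small {n : ℕ} (hB : Bg n) {ε : ℝ} (hε : 0 < ε) (T : ℕ)
    (hT : (n:ℝ) ^ 2 ≤ T * (ε ^ 6 * Real.exp (-(8 * c0)))) : su n T ≤ ε := by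
  have hn := hB.np
  have hN := hB.Np
  by_contra hcon
  push Not at hcon
  have hant : Antitone (su n) := antitone_nat_of_succ_le (su_anti hB)
  have hδ : 6 * (1 / (n:ℝ)) ^ 2 ≤ DD n / NN n := by
    rw [le_div_iff₀ hN]
    have h1 := hB.hN2
    have h2 := hB.hD1
    have : 6 * (1 / (n:ℝ)) ^ 2 * NN n ≤ 6 * (1 / (n:ℝ)) ^ 2 * ((n:ℝ)^4 / 24) := by
      gcongr; linarith
    have h3 : 6 * (1 / (n:ℝ)) ^ 2 * ((n:ℝ)^4 / 24) = (n:ℝ)^2 / 4 := by field_simp; norm_num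
    linarith
  set z := ε ^ 6 * Real.exp (-(8 * c0)) with hz
  have hz0 : 0 < z := by positivity
  have key : ∀ t ≤ T, su n t ≤ 1 - t * (6 * (1 / (n:ℝ)) ^ 2 * z) := by
    intro t ht
    induction t with
    | zero => simp [su_zero]
    | succ t ih =>
      have h1 := ih (by omega)
      have h2 : ε ≤ su n t := hcon.le.trans (hant (by omega))
      rw [su_succ]
      have h3 : 6 * (1 / (n:ℝ)) ^ 2 * z ≤ DD n / NN n * su n t ^ 6 * sg n t := by
        rw [hz, mul_assoc (DD n / NN n)]
        have := sg_ge hB t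
        have := hB.Dp
        gcongr
      push_cast
      linarith
  have h1 := key T le_rfl
  have h2 : 6 ≤ (T:ℝ) * (6 * (1 / (n:ℝ)) ^ 2 * z) := by
    calc (6:ℝ) = 6 * (1 / (n:ℝ)) ^ 2 * (n:ℝ)^2 := by field_simp
      _ ≤ 6 * (1 / (n:ℝ)) ^ 2 * (T * z) := by gcongr
      _ = _ := by ring
  linarith

end
end GRU


namespace GRU
open Finset

/-- first order expansion -/
def FO (ν C x y d : ℝ) : Prop := |x| ≤ C ∧ |d| ≤ C * ν ∧ |y - x - d| ≤ C * ν ^ 2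

lemma FO.mul {ν C D x y d x' y' d' : ℝ} (hν : 0 ≤ ν) (hν1 : ν ≤ 1) (hC : 0 ≤ C) (hD : 0 ≤ D)
    (h : FO ν C x y d) (h' : FO ν D x' y' d') : FO ν (6 * (C * D)) (x * x') (y * y') (x * d' + x' * d) := by
  obtain ⟨a, b, c⟩ := h
  obtain ⟨a', b', c'⟩ := h'
  have hCD : 0 ≤ C * D := mul_nonneg hC hD
  have hCν : 0 ≤ C * ν := mul_nonneg hC hν
  have hDν : 0 ≤ D * ν := mul_nonneg hD hν
  have hν2 : ν ^ 2 ≤ 1 := pow_le_one₀ hν hν1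
  refine ⟨?_, ?_, ?_⟩
  · rw [abs_mul]
    have := mul_le_mul a a' (abs_nonneg _) hC
    linarith
  · have h1 := mul_le_mul a b' (abs_nonneg _) hC
    have h2 := mul_le_mul a' b (abs_nonneg _) hD
    rw [← abs_mul] at h1 h2
    have := abs_add_le (x * d') (x' * d)
    nlinarith [mul_nonneg hCD hν]
  · set e := y - x - d with he
    set e' := y' - x' - d' with he'
    have e1 : y * y' - x * x' - (x * d' + x' * d) = d * d' + x * e' + x' * e + d * e' + e * d' + e * e' := by
      rw [he, he']; ring
    rw [e1]
    have hν20 : 0 ≤ ν ^ 2 := by positivity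
    have t1 : |d * d'| ≤ C * D * ν ^ 2 := by
      rw [abs_mul]; refine (mul_le_mul b b' (abs_nonneg _) hCν).trans (le_of_eq (by ring))
    have t2 : |x * e'| ≤ C * D * ν ^ 2 := by
      rw [abs_mul]; refine (mul_le_mul a c' (abs_nonneg _) hC).trans (le_of_eq (by ring))
    have t3 : |x' * e| ≤ C * D * ν ^ 2 := by
      rw [abs_mul]; refine (mul_le_mul a' c (abs_nonneg _) hD).trans (le_of_eq (by ring))
    have t4 : |d * e'| ≤ C * D * ν ^ 2 := by
      rw [abs_mul]; refine (mul_le_mul b c' (abs_nonneg _) hCν).trans ?_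
      have := mul_nonneg hCD hν20
      nlinarith
    have t5 : |e * d'| ≤ C * D * ν ^ 2 := by
      rw [abs_mul]; refine (mul_le_mul c b' (abs_nonneg _) (by positivity)).trans ?_
      have := mul_nonneg hCD hν20
      nlinarith
    have t6 : |e * e'| ≤ C * D * ν ^ 2 := by
      rw [abs_mul]; refine (mul_le_mul c c' (abs_nonneg _) (by positivity)).trans ?_
      have := mul_nonneg hCD hν20
      nlinarith
    have s1 := abs_add_le (d * d' + x * e' + x' * e + d * e' + e * d') (e * e')
    have s2 := abs_add_le (d * d' + x * e' + x' * e + d * e') (e * d')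
    have s3 := abs_add_le (d * d' + x * e' + x' * e) (d * e')
    have s4 := abs_add_le (d * d' + x * e') (x' * e)
    have s5 := abs_add_le (d * d') (x * e')
    linarith

lemma FO.pow {ν C x y d : ℝ} (hν : 0 ≤ ν) (hν1 : ν ≤ 1) (hC : 0 ≤ C)
    (h : FO ν C x y d) (k : ℕ) : FO ν ((6 * C) ^ k) (x ^ k) (y ^ k) (k * x ^ (k - 1) * d) := by
  induction k with
  | zero => simp [FO, hν]
  | succ k ih =>
    have := FO.mul hν hν1 hC (by positivity) h ih
    convert this using 1
    · ring
    · ring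
    · ring
    · rcases k with _ | k
      · simp
      · simp only [Nat.add_sub_cancel]
        push_cast; ring

lemma FO.mono {ν C D x y d : ℝ} (hν : 0 ≤ ν) (h : FO ν C x y d) (hCD : C ≤ D) : FO ν D x y d :=
  ⟨h.1.trans hCD, h.2.1.trans (by gcongr), h.2.2.trans (by gcongr)⟩

/-- the error constant for the trajectory -/
noncomputable def Cs (s : ℕ) : ℝ :=
  36 * ((6 * (200 * c0)) ^ (6 * s) * ((6 * (200 * c0)) ^ s * (6 * (200 * c0)) ^ s)) +
    24 * s ^ 2 * 5 * 4 ^ s + s * (7 * 4 ^ 6 * cnt (4 * s) 8) * 4 ^ s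

lemma choose_diff {n v : ℕ} (hn : 2 ≤ n) : |DD n - ((n - v).choose 2 : ℝ)| ≤ (v + 2) * n := by
  unfold DD
  have aux : ∀ w : ℕ, |(n.choose 2 : ℝ) - ((n - w).choose 2 : ℝ)| ≤ w * n := by
    intro w
    induction w with
    | zero => simp
    | succ w ih =>
      have h1 : |((n - w).choose 2 : ℝ) - ((n - (w+1)).choose 2 : ℝ)| ≤ n := by
        rcases Nat.lt_or_ge w n with h | h
        · have : n - w = (n - (w+1)) + 1 := by omega
          rw [this, Nat.choose_succ_succ' _ 1, Nat.choose_one_right]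
          push_cast
          rw [add_sub_cancel_right, abs_of_nonneg (by positivity)]
          exact_mod_cast Nat.sub_le _ _
        · have e1 : n - w = 0 := by omega
          have e2 : n - (w+1) = 0 := by omega
          rw [e1, e2]; simp
      have := abs_sub_le (n.choose 2 : ℝ) ((n - w).choose 2 : ℝ) ((n - (w+1)).choose 2 : ℝ)
      push_cast
      linarith
  have h1 := aux 2
  have h2 := aux v
  have := abs_sub_le ((n-2).choose 2 : ℝ) (n.choose 2 : ℝ) ((n - v).choose 2 : ℝ)
  rw [abs_sub_comm ((n-2).choose 2 : ℝ) (n.choose 2 : ℝ)] at this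
  push_cast at h1
  linarith

/-- the trajectory functional at time `t` -/
noncomputable def tt {n : ℕ} (t : ℕ) (A B : Finset (Finset (Fin n))) : ℝ :=
  tau (su n t) (sg n t) (sm n t) A B

section

lemma FO_seq {n : ℕ} (hB : Bg n) (t : ℕ) : FO ((1 / (n:ℝ)) ^ 2) (200 * c0) (su n t) (su n (t+1)) (-(DD n / NN n * su n t ^ 6 * sg n t)) ∧
    FO ((1 / (n:ℝ)) ^ 2) (200 * c0) (sg n t) (sg n (t+1))
      (-(1 / NN n * Gn n (sm n t) * su n t ^ 6 * sg n t ^ 2)) ∧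
    FO ((1 / (n:ℝ)) ^ 2) (200 * c0) ((n:ℝ)^2 * sm n t) ((n:ℝ)^2 * sm n (t+1))
      ((n:ℝ)^2 * (1 / NN n * su n t ^ 6 * sg n t)) := by
  obtain ⟨⟨u0, u1⟩, ⟨g0, g1⟩, m0, e⟩ := seq_bounds hB t
  have hm4 := sm_le hB t
  have hn := hB.np
  have hN := hB.Np
  have hD := hB.Dp
  have hc := c0_pos
  have hGn := hB.GnN m0 hm4
  have hGn0 : 0 ≤ Gn n (sm n t) := Gn_nonneg m0
  have hDN := hB.DN
  have hx0 : 0 ≤ (1 / (n:ℝ)) ^ 2 := by positivity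
  have hu6 : su n t ^ 6 ≤ 1 := pow_le_one₀ u0 u1
  have hg2 : sg n t ^ 2 ≤ 1 := pow_le_one₀ g0.le g1
  have hu60 : 0 ≤ su n t ^ 6 := by positivity
  have hnn : (n:ℝ)^2 * (1 / NN n) ≤ 48 * (1 / (n:ℝ)) ^ 2 := by
    calc (n:ℝ)^2 * (1 / NN n) ≤ (n:ℝ)^2 * (48 * (1 / (n:ℝ)) ^ 4) := by gcongr; exact hB.invN
      _ = _ := by field_simp
  refine ⟨⟨?_, ?_, ?_⟩, ⟨?_, ?_, ?_⟩, ⟨?_, ?_, ?_⟩⟩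
  · rw [abs_of_nonneg u0]; linarith
  · rw [abs_neg, abs_of_nonneg (by positivity)]
    calc _ ≤ (48 * (1 / (n:ℝ)) ^ 2) * 1 * 1 := by gcongr
      _ ≤ _ := by nlinarith
  · rw [su_succ]
    have : su n t - DD n / NN n * su n t ^ 6 * sg n t - su n t - -(DD n / NN n * su n t ^ 6 * sg n t) = 0 := by ring
    rw [this, abs_zero]; positivity
  · rw [abs_of_pos g0]; linarith
  · rw [abs_neg, abs_of_nonneg (by positivity)]
    calc _ ≤ (48 * c0 * (1 / (n:ℝ)) ^ 2) * 1 * 1 := by gcongr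
      _ ≤ _ := by nlinarith
  · rw [sg_succ]
    ring_nf
    simp only [abs_zero]; positivity
  · rw [abs_of_nonneg (by positivity)]
    calc (n:ℝ)^2 * sm n t ≤ (n:ℝ)^2 * (4 * (1 / (n:ℝ)) ^ 2) := by gcongr
      _ = 4 := by field_simp
      _ ≤ _ := by linarith
  · rw [abs_of_nonneg (by positivity)]
    calc _ = ((n:ℝ)^2 * (1 / NN n)) * su n t ^ 6 * sg n t := by ring
      _ ≤ (48 * (1 / (n:ℝ)) ^ 2) * 1 * 1 := by gcongr
      _ ≤ _ := by nlinarith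
  · rw [sm_succ]
    have : (n:ℝ) ^ 2 * (sm n t + 1 / NN n * su n t ^ 6 * sg n t) - (n:ℝ) ^ 2 * sm n t -
        (n:ℝ) ^ 2 * (1 / NN n * su n t ^ 6 * sg n t) = 0 := by ring
    rw [this, abs_zero]; positivity

lemma tt_evol {n : ℕ} (hB : Bg n) (t : ℕ) {A B : Finset (Finset (Fin n))} (H : Cls A B) {s : ℕ} (hs : A.card + B.card ≤ s) :
    |NN n * (tt (t+1) A B - tt t A B) + ∑ h ∈ G1 A B, tt t (insert h A) B
      + ∑ x ∈ G2 A B, ∑ h ∈ x.2.erase x.1, tt t (insert h A) (B ∪ (x.2.erase x.1).erase h)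
      - ∑ b ∈ B, tt t (insert b A) (B.erase b)| ≤ Cs s * n * (1 / (n:ℝ)) ^ (2 * B.card) := by
  obtain ⟨⟨u0, u1⟩, ⟨g0, g1⟩, m0, -⟩ := seq_bounds hB t
  have hm4 := sm_le hB t
  have hn := hB.np
  have hN := hB.Np
  have hc := c0_pos
  obtain ⟨f1, f2, f3⟩ := FO_seq hB t
  have hν0 : 0 ≤ (1 / (n:ℝ)) ^ 2 := by positivity
  have hν1 : (1 / (n:ℝ)) ^ 2 ≤ 1 := by
    have := hB.x2
    nlinarith
  have hn1 : (1:ℝ) ≤ n := by exact_mod_cast hB.n1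
  have hC0 : (0:ℝ) ≤ 200 * c0 := by positivity
  have hC1 : (1:ℝ) ≤ 6 * (200 * c0) := by linarith
  set a := (pr A).card with ha
  set j := A.card with hj
  set b := B.card with hb
  have ha6 : a ≤ 6 * s := by have := card_pr_le H.hA; omega
  have F1 := (FO.pow hν0 hν1 hC0 f1 a).mono hν0 (pow_le_pow_right₀ hC1 ha6)
  have F2 := (FO.pow hν0 hν1 hC0 f2 j).mono hν0 (pow_le_pow_right₀ hC1 (show j ≤ s by omega))
  have F3 := (FO.pow hν0 hν1 hC0 f3 b).mono hν0 (pow_le_pow_right₀ hC1 (show b ≤ s by omega))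
  have F4 := FO.mul hν0 hν1 (by positivity) (by positivity) F1 (FO.mul hν0 hν1 (by positivity) (by positivity) F2 F3)
  have E := F4.2.2
  simp only [tt]
  rw [tau_I (H := H), tau_II (H := H), tau_III (H := H), card_G1 H, ← ha, ← hj, ← hb]
  change |_ + S2 A B (sm n t) * _ - _| ≤ _
  have hS1 := S2_le m0 A B
  have hS2 := S2_close hB.n1 m0 (by norm_num) hm4 H hs
  rw [sum_GG H.hA, ← hj] at hS1 hS2
  have hch := choose_diff (n := n) (v := (un (A ∪ B)).card) (by have := hB.h100; omega)
  have hU : (un (A ∪ B)).card ≤ 4 * s := by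
    have := card_un_le (A ∪ B) (Finset.union_subset H.hA H.hB)
    have := Finset.card_union_le A B
    omega
  simp only [tau, ← ha, ← hj, ← hb]
  set Q : ℝ := ((n - (un (A ∪ B)).card).choose 2 : ℝ) with hQ
  set S := S2 A B (sm n t) with hS
  set G := Gn n (sm n t) with hG
  set u := su n t with hu
  set g := sg n t with hg
  set μ := sm n t with hμ
  set u' := su n (t+1)
  set g' := sg n (t+1)
  set μ' := sm n (t+1)
  set N := NN n with hNN
  set D := DD n with hDD
  -- normalise
  have hnb : 0 < (n:ℝ) ^ (2 * b) := by positivity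
  rw [one_div, inv_pow, ← div_eq_mul_inv, le_div_iff₀ hnb, ← abs_of_pos hnb, ← abs_mul]
  set m := (n:ℝ)^2 * μ with hm
  have hm0 : 0 ≤ m := by positivity
  have hmle : m ≤ 4 := by
    calc m ≤ (n:ℝ)^2 * (4 * (1 / (n:ℝ)) ^ 2) := by rw [hm]; gcongr
      _ = 4 := by field_simp
  have hmb : m ^ b ≤ 4 ^ s := (pow_le_pow_left₀ hm0 hmle b).trans (pow_le_pow_right₀ (by norm_num) (by omega))
  have hmb0 : 0 ≤ m ^ b := by positivity
  set R := u' ^ a * (g' ^ j * ((n:ℝ)^2 * μ') ^ b) - u ^ a * (g ^ j * m ^ b) -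
    (u ^ a * (g ^ j * (b * m ^ (b - 1) * ((n:ℝ) ^ 2 * (1 / N * u ^ 6 * g))) +
      m ^ b * (j * g ^ (j - 1) * -(1 / N * G * u ^ 6 * g ^ 2))) +
      g ^ j * m ^ b * (a * u ^ (a - 1) * -(D / N * u ^ 6 * g))) with hR
  have key : (N * (u' ^ a * g' ^ j * μ' ^ b - u ^ a * g ^ j * μ ^ b) +
      ((a * (n - (un (A ∪ B)).card).choose 2 : ℕ) : ℝ) * (u ^ (a + 5) * g ^ (j + 1) * μ ^ b) +
      S * (u ^ (a + 6) * g ^ (j + 1) * μ ^ b) - b * (u ^ (a + 6) * g ^ (j + 1) * μ ^ (b - 1))) * (n:ℝ) ^ (2 * b)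
      = N * R - a * (D - Q) * (u ^ (a + 5) * g ^ (j + 1) * m ^ b) -
        (j * G - S) * (u ^ (a + 6) * g ^ (j + 1) * m ^ b) := by
    have ea : (a:ℝ) * u ^ (a - 1) * u ^ 6 = a * u ^ (a + 5) := by
      rcases Nat.eq_zero_or_pos a with h | h
      · rw [h]; simp
      · have : a + 5 = (a - 1) + 6 := by omega
        rw [this, pow_add]; ring
    have ej : (j:ℝ) * g ^ (j - 1) * g ^ 2 = j * g ^ (j + 1) := by
      rcases Nat.eq_zero_or_pos j with h | h
      · rw [h]; simp
      · have : j + 1 = (j - 1) + 2 := by omega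
        rw [this, pow_add]; ring
    have eb : (b:ℝ) * μ ^ (b - 1) * (n:ℝ) ^ (2 * b) = b * m ^ (b - 1) * (n:ℝ)^2 := by
      rcases Nat.eq_zero_or_pos b with h | h
      · rw [h]; simp
      · have : 2 * b = 2 * (b - 1) + 2 := by omega
        rw [this, pow_add, hm, mul_pow, ← pow_mul]; ring
    have em : m ^ b = (n:ℝ) ^ (2 * b) * μ ^ b := by rw [hm, mul_pow, ← pow_mul]
    have em' : ((n:ℝ)^2 * μ') ^ b = (n:ℝ) ^ (2 * b) * μ' ^ b := by rw [mul_pow, ← pow_mul]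
    have hNR : N * R = N * (u' ^ a * (g' ^ j * ((n:ℝ)^2 * μ') ^ b) - u ^ a * (g ^ j * m ^ b)) -
        u ^ (a + 6) * g ^ (j + 1) * (b * m ^ (b - 1) * (n:ℝ)^2) +
        (j * g ^ (j - 1) * g ^ 2) * G * u ^ (a + 6) * m ^ b +
        (a * u ^ (a - 1) * u ^ 6) * D * g ^ (j + 1) * m ^ b := by
      rw [hR]; field_simp; ring
    rw [hNR, ea, ej, ← eb, em, em']
    push_cast
    rw [← hQ]
    ring
  rw [key]
  have hR' : |N * R| ≤ 36 * ((6 * (200 * c0)) ^ (6 * s) * ((6 * (200 * c0)) ^ s * (6 * (200 * c0)) ^ s)) * n := by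
    rw [abs_mul, abs_of_pos hN]
    have hN4 : N * ((1 / (n:ℝ)) ^ 2) ^ 2 ≤ 1 := by
      have := hB.hN2
      have h4 : (0:ℝ) < (n:ℝ)^4 := by positivity
      rw [one_div, inv_pow, inv_pow, ← pow_mul, mul_inv_le_iff₀ h4]
      linarith
    set K := 6 * ((6 * (200 * c0)) ^ (6 * s) * (6 * ((6 * (200 * c0)) ^ s * (6 * (200 * c0)) ^ s))) with hK
    have hK0 : 0 ≤ K := by positivity
    calc N * |R| ≤ N * (K * ((1 / (n:ℝ)) ^ 2) ^ 2) := by gcongr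
      _ = K * (N * ((1 / (n:ℝ)) ^ 2) ^ 2) := by ring
      _ ≤ K * n := by gcongr; linarith
      _ = _ := by rw [hK]; ring
  have hs1 : (a:ℝ) ≤ 6 * s := by exact_mod_cast ha6
  have hs0 : (0:ℝ) ≤ s := by positivity
  have hpa : u ^ (a + 5) * g ^ (j + 1) * m ^ b ≤ 1 * 1 * 4 ^ s := by
    gcongr
    · exact pow_le_one₀ u0 u1
    · exact pow_le_one₀ g0.le g1
  have hpb : u ^ (a + 6) * g ^ (j + 1) * m ^ b ≤ 1 * 1 * 4 ^ s := by
    gcongr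
    · exact pow_le_one₀ u0 u1
    · exact pow_le_one₀ g0.le g1
  have h1 : |a * (D - Q) * (u ^ (a + 5) * g ^ (j + 1) * m ^ b)| ≤ 24 * s ^ 2 * 5 * 4 ^ s * n := by
    rcases Nat.eq_zero_or_pos s with h | h
    · have : a = 0 := by omega
      rw [this]; simp; positivity
    have hs1' : (1:ℝ) ≤ s := by exact_mod_cast h
    rw [abs_mul, abs_mul, Nat.abs_cast, abs_of_nonneg (show 0 ≤ u ^ (a + 5) * g ^ (j + 1) * m ^ b by positivity)]
    have hU' : ((un (A ∪ B)).card : ℝ) + 2 ≤ 20 * s := by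
      have : ((un (A ∪ B)).card : ℝ) ≤ 4 * s := by exact_mod_cast hU
      linarith
    calc a * |D - Q| * (u ^ (a + 5) * g ^ (j + 1) * m ^ b) ≤ (6 * (s:ℝ)) * ((20 * (s:ℝ)) * (n:ℝ)) * (1 * 1 * 4 ^ s) := by
          gcongr
          exact hch.trans (by gcongr)
      _ = _ := by ring
  have h2 : |(j * G - S) * (u ^ (a + 6) * g ^ (j + 1) * m ^ b)| ≤ s * (7 * 4 ^ 6 * cnt (4 * s) 8) * 4 ^ s * n := by
    rw [abs_mul, abs_of_nonneg (show 0 ≤ u ^ (a + 6) * g ^ (j + 1) * m ^ b by positivity),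
      abs_of_nonneg (by linarith)]
    calc (j * G - S) * (u ^ (a + 6) * g ^ (j + 1) * m ^ b) ≤ ((s:ℝ) * (7 * 4 ^ 6 * cnt (4 * s) 8) * (n:ℝ)) * (1 * 1 * 4 ^ s) := by gcongr
      _ = _ := by ring
  have t1 := abs_sub (N * R - a * (D - Q) * (u ^ (a + 5) * g ^ (j + 1) * m ^ b)) ((j * G - S) * (u ^ (a + 6) * g ^ (j + 1) * m ^ b))
  have t2 := abs_sub (N * R) (a * (D - Q) * (u ^ (a + 5) * g ^ (j + 1) * m ^ b))
  unfold Cs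
  linarith

lemma tt_nonneg {n : ℕ} (hB : Bg n) (t : ℕ) (A B : Finset (Finset (Fin n))) : 0 ≤ tt t A B := by
  obtain ⟨⟨u0, u1⟩, ⟨g0, g1⟩, m0, -⟩ := seq_bounds hB t
  unfold tt tau; positivity

lemma tt_le {n : ℕ} (hB : Bg n) (t : ℕ) (A B : Finset (Finset (Fin n))) : tt t A B ≤ (4 * (1 / (n:ℝ)) ^ 2) ^ B.card := by
  obtain ⟨⟨u0, u1⟩, ⟨g0, g1⟩, m0, -⟩ := seq_bounds hB t
  unfold tt tau
  calc _ ≤ 1 * 1 * (4 * (1 / (n:ℝ)) ^ 2) ^ B.card := by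
        gcongr
        · exact pow_le_one₀ u0 u1
        · exact pow_le_one₀ g0.le g1
        · exact sm_le hB t
    _ = _ := by ring

end
end GRU


namespace GRU
open Finset

/-- closeness to the trajectory -/
def Bd (n t s : ℕ) (η : ℝ) : Prop := ∀ A B : Finset (Finset (Fin n)), Cls A B → A.card + B.card ≤ s →
  |p t A B - tt t A B| ≤ η * (1 / (n:ℝ)) ^ (2 * B.card)

lemma Bd.mono {n t s : ℕ} {η η' : ℝ} (h : Bd n t s η) (hη : η ≤ η') : Bd n t s η' :=
  fun A B H hs => (h A B H hs).trans (by gcongr)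

lemma Bd_zero (n s : ℕ) : Bd n 0 s 0 := by
  intro A B H hs
  have h1 : p 0 A B = tt 0 A B := by
    simp only [p, ex, tt, tau, su_zero, sg_zero, sm_zero, one_pow, one_mul, ind]
    have hA : A ⊆ Op ∅ := by
      intro a ha
      rw [mem_Op]
      refine ⟨H.hA ha, by simp, ?_⟩
      intro C hC h2
      have h3 := Finset.card_le_card hC
      simp at h3
      omega
    rcases B.eq_empty_or_nonempty with rfl | hB
    · simp [hA]
    · have : ¬ B ⊆ ∅ := by rw [Finset.subset_empty]; exact hB.ne_empty
      rw [if_neg (fun h => this h.2), zero_pow (Finset.card_pos.2 hB).ne']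
  rw [h1]; simp

section

lemma Bd_triv {n : ℕ} (hB : Bg n) {k : ℝ} (hk : 4 ≤ k) {t : ℕ} (ht : (t:ℝ) / (Ed n).card ≤ k * (1 / (n:ℝ)) ^ 2) (s : ℕ) :
    Bd n t s (k ^ s) := by
  intro A B H hs
  have h1 := p_le hB.Nc ht A B
  have h2 := p_nonneg t A B
  have h3 := tt_le hB t A B
  have h4 := tt_nonneg hB t A B
  have h5 : (4 * (1 / (n:ℝ)) ^ 2) ^ B.card ≤ (k * (1 / (n:ℝ)) ^ 2) ^ B.card := by gcongr
  have h6 : (k * (1 / (n:ℝ)) ^ 2) ^ B.card ≤ k ^ s * (1 / (n:ℝ)) ^ (2 * B.card) := by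
    rw [mul_pow, ← pow_mul]
    gcongr
    · linarith
    · omega
  rw [abs_le]
  constructor <;> linarith

end

/-- the rate constant -/
noncomputable def kp : ℝ := 48 * (7 + 7 * cnt 4 8)

noncomputable def Ec (k : ℝ) (s : ℕ) : ℝ := 48 * (Es k s + Cs s)

section

lemma Bd_step {n : ℕ} (hB : Bg n) {k : ℝ} (hk : 4 ≤ k) {t : ℕ} (ht : (t:ℝ) / (Ed n).card ≤ k * (1 / (n:ℝ)) ^ 2) {s : ℕ}
    {η η' : ℝ} (hη' : 0 ≤ η') (h1 : Bd n t s η) (h2 : Bd n t (s + 7) η') :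
    Bd n (t+1) s (η + kp * s * (1 / (n:ℝ)) ^ 2 * η' + Ec k s * (1 / (n:ℝ)) ^ 3) := by
  intro A B H hs
  have hn := hB.np
  have hN := hB.Np
  have e1 := evol hB.n1 hB.Nc H (by linarith) ht hs
  have e2 := tt_evol hB t H hs
  have e3 := h1 A B H hs
  change |NN n * _ + _ + _ - _| ≤ _ at e1
  set x := (1 / (n:ℝ)) with hx
  have hx0 : 0 < x := by positivity
  set b := B.card with hb
  set X := x ^ (2 * b) with hX
  have hX0 : 0 < X := by positivity
  have d1 : |∑ h ∈ G1 A B, p t (insert h A) B - ∑ h ∈ G1 A B, tt t (insert h A) B| ≤ 6 * s * (n:ℝ)^2 * (η' * X) := by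
    rw [← Finset.sum_sub_distrib]
    refine (Finset.abs_sum_le_sum_abs _ _).trans ?_
    have : ∀ h ∈ G1 A B, |p t (insert h A) B - tt t (insert h A) B| ≤ η' * X := by
      intro h hh
      refine h2 _ _ (H.closeI (mem_G1.1 hh)) ?_
      have := Finset.card_insert_le h A
      omega
    refine (Finset.sum_le_sum this).trans ?_
    rw [Finset.sum_const, nsmul_eq_mul]
    have hc : ((G1 A B).card : ℝ) ≤ 6 * s * (n:ℝ)^2 := by
      rw [card_G1 H]
      have a1 : (pr A).card ≤ 6 * s := by have := card_pr_le H.hA; omega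
      have a2 : (n - (un (A ∪ B)).card).choose 2 ≤ n ^ 2 :=
        (Nat.choose_le_pow _ _).trans (Nat.pow_le_pow_left (Nat.sub_le _ _) 2)
      exact_mod_cast Nat.mul_le_mul a1 a2
    gcongr
  have d2 : |∑ x ∈ G2 A B, ∑ h ∈ x.2.erase x.1, p t (insert h A) (B ∪ (x.2.erase x.1).erase h) -
      ∑ x ∈ G2 A B, ∑ h ∈ x.2.erase x.1, tt t (insert h A) (B ∪ (x.2.erase x.1).erase h)| ≤
      s * (7 * cnt 4 8) * (n:ℝ)^2 * (η' * X) := by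
    rw [← Finset.sum_sub_distrib]
    simp only [← Finset.sum_sub_distrib]
    have c1 := II_count hB.n1 hB.Nc H
    calc _ ≤ ∑ y ∈ G2 A B, ∑ h ∈ y.2.erase y.1, |p t (insert h A) (B ∪ (y.2.erase y.1).erase h) -
          tt t (insert h A) (B ∪ (y.2.erase y.1).erase h)| := by
          refine (Finset.abs_sum_le_sum_abs _ _).trans (Finset.sum_le_sum fun y _ => ?_)
          exact Finset.abs_sum_le_sum_abs _ _
      _ ≤ ∑ y ∈ G2 A B, ∑ h ∈ y.2.erase y.1, η' * x ^ (2 * (B ∪ (y.2.erase y.1).erase h).card) := by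
          refine Finset.sum_le_sum fun y hy => Finset.sum_le_sum fun h hh => ?_
          rw [mem_G2] at hy
          rw [Finset.mem_erase] at hh
          refine h2 _ _ (H.closeII hy.1 hy.2 hh.2 hh.1) ?_
          rw [card_newB H hy.1 hy.2 hh.2 hh.1]
          have := Finset.card_insert_le h A
          have := hy.2.1.1.2.1
          omega
      _ = η' * ∑ y ∈ G2 A B, ∑ h ∈ y.2.erase y.1, x ^ (2 * (B ∪ (y.2.erase y.1).erase h).card) := by
          simp only [Finset.mul_sum]
      _ ≤ η' * (A.card * (7 * cnt 4 8) * (n:ℝ) ^ 2 * X) := by gcongr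
      _ ≤ η' * (s * (7 * cnt 4 8) * (n:ℝ) ^ 2 * X) := by gcongr; omega
      _ = _ := by ring
  have d3 : |∑ c ∈ B, p t (insert c A) (B.erase c) - ∑ c ∈ B, tt t (insert c A) (B.erase c)| ≤
      s * (n:ℝ)^2 * (η' * X) := by
    rw [← Finset.sum_sub_distrib]
    refine (Finset.abs_sum_le_sum_abs _ _).trans ?_
    have : ∀ c ∈ B, |p t (insert c A) (B.erase c) - tt t (insert c A) (B.erase c)| ≤ (n:ℝ)^2 * (η' * X) := by
      intro c hc
      have hbp : 1 ≤ b := Finset.card_pos.2 ⟨c, hc⟩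
      have h3 := h2 _ _ (H.closeIII hc) (by
        have := Finset.card_insert_le c A
        rw [Finset.card_erase_of_mem hc]
        omega)
      rw [Finset.card_erase_of_mem hc, ← hb, ← hx] at h3
      refine h3.trans (le_of_eq ?_)
      have : 2 * b = 2 * (b - 1) + 2 := by omega
      rw [hX, this, pow_add, hx]
      field_simp
    refine (Finset.sum_le_sum this).trans ?_
    rw [Finset.sum_const, nsmul_eq_mul, mul_assoc]
    gcongr
    omega
  set I1 := ∑ h ∈ G1 A B, p t (insert h A) B
  set I2 := ∑ h ∈ G1 A B, tt t (insert h A) B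
  set J1 := ∑ x ∈ G2 A B, ∑ h ∈ x.2.erase x.1, p t (insert h A) (B ∪ (x.2.erase x.1).erase h)
  set J2 := ∑ x ∈ G2 A B, ∑ h ∈ x.2.erase x.1, tt t (insert h A) (B ∪ (x.2.erase x.1).erase h)
  set K1 := ∑ c ∈ B, p t (insert c A) (B.erase c)
  set K2 := ∑ c ∈ B, tt t (insert c A) (B.erase c)
  set δ := p t A B - tt t A B with hδ
  set δ' := p (t+1) A B - tt (t+1) A B with hδ'
  have big : |NN n * (δ' - δ)| ≤ (7 + 7 * cnt 4 8) * s * (n:ℝ)^2 * (η' * X) + (Es k s + Cs s) * n * X := by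
    rw [abs_le] at *
    constructor
    · rw [hδ', hδ]; linarith [e1.1, e1.2, e2.1, e2.2, d1.1, d1.2, d2.1, d2.2, d3.1, d3.2]
    · rw [hδ', hδ]; linarith [e1.1, e1.2, e2.1, e2.2, d1.1, d1.2, d2.1, d2.2, d3.1, d3.2]
  rw [abs_mul, abs_of_pos hN] at big
  set R := (7 + 7 * cnt 4 8) * s * (n:ℝ)^2 * (η' * X) + (Es k s + Cs s) * n * X with hR
  have hR0 : 0 ≤ R := le_trans (by positivity) big
  have big2 : |δ' - δ| ≤ 48 * x ^ 4 * R := by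
    have : |δ' - δ| ≤ 1 / NN n * R := by
      rw [one_div, ← div_eq_inv_mul, le_div_iff₀ hN]; linarith
    refine this.trans ?_
    gcongr
    exact hB.invN
  have hfin : 48 * x ^ 4 * R = (kp * s * x ^ 2 * η' + Ec k s * x ^ 3) * X := by
    have hnx : (n:ℝ) = 1 / x := by rw [hx]; field_simp
    rw [hR, kp, Ec, hnx]
    field_simp
  rw [hfin] at big2
  have := abs_add_le δ (δ' - δ)
  rw [add_sub_cancel] at this
  linarith

end
end GRU


namespace GRU
open Finset

lemma Bd.sub {n t s s' : ℕ} {η : ℝ} (h : Bd n t s η) (hs : s' ≤ s) : Bd n t s' η :=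
  fun A B H h' => h A B H (h'.trans hs)

lemma kp_pos : 0 < kp := by unfold kp; positivity

lemma window_aux {n : ℕ} (hB : Bg n) {k : ℝ} (hk : 4 ≤ k) (s J t0 : ℕ) {η0 c x : ℝ} (hη0 : 0 ≤ η0)
    (hc0 : 0 ≤ c) (hc : ∀ i ≤ J, Ec k (s + 7 * i) * (1 / (n:ℝ)) ^ 3 ≤ c)
    (hx : x = kp * (s + 7 * J) * (1 / (n:ℝ)) ^ 2)
    (h0 : Bd n t0 (s + 7 * J) η0) (l : ℕ)
    (hl : ((t0 + l : ℕ):ℝ) / (Ed n).card ≤ k * (1 / (n:ℝ)) ^ 2) :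
    ∀ i ≤ J, Bd n (t0 + l) (s + 7 * i)
      ((1 + x) ^ l * (η0 + l * c) + (l.choose (J - i) : ℝ) * x ^ (J - i) * k ^ (s + 7 * J)) := by
  have hx0 : 0 ≤ x := by rw [hx]; have := kp_pos; positivity
  have hk0 : (0:ℝ) ≤ k := by linarith
  induction l with
  | zero =>
    intro i hi
    refine (h0.sub (by omega)).mono ?_
    have : (0:ℝ) ≤ (Nat.choose 0 (J - i) : ℝ) * x ^ (J - i) * k ^ (s + 7 * J) := by positivity
    simp only [pow_zero, Nat.cast_zero, zero_mul, add_zero, one_mul]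
    linarith
  | succ l ih =>
    have hl' : ((t0 + l : ℕ):ℝ) / (Ed n).card ≤ k * (1 / (n:ℝ)) ^ 2 := by
      refine le_trans ?_ hl
      gcongr
      omega
    have ih' := ih hl'
    intro i hi
    rcases hi.eq_or_lt with rfl | hlt
    · refine (Bd_triv hB hk hl (s + 7 * i)).mono ?_
      simp only [Nat.sub_self, Nat.choose_zero_right, Nat.cast_one, pow_zero, one_mul]
      have : 0 ≤ (1 + x) ^ (l+1) * (η0 + ((l+1 : ℕ):ℝ) * c) := by positivity
      linarith
    · have a1 := ih' i hi
      have a2 := ih' (i+1) (by omega)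
      have e7 : s + 7 * (i + 1) = s + 7 * i + 7 := by ring
      rw [e7] at a2
      have st := Bd_step hB hk hl' (by positivity) a1 a2
      refine st.mono ?_
      have hji : J - i = (J - (i+1)) + 1 := by omega
      rw [hji, Nat.choose_succ_succ']
      set q := J - (i+1) with hq
      set P := (1 + x) ^ l * (η0 + l * c) with hP
      have hP0 : 0 ≤ P := by positivity
      set Z := (l.choose q : ℝ) * x ^ q * k ^ (s + 7 * J) with hZ
      have hZ0 : 0 ≤ Z := by positivity
      have hco : kp * ((s + 7 * i : ℕ):ℝ) * (1 / (n:ℝ)) ^ 2 ≤ x := by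
        rw [hx]
        have := kp_pos
        gcongr
        push_cast
        have : (i:ℝ) ≤ J := by exact_mod_cast hi
        linarith
      have h1 : kp * ((s + 7 * i : ℕ):ℝ) * (1 / (n:ℝ)) ^ 2 * (P + Z) ≤ x * (P + Z) := by gcongr
      have h2 := hc i hi
      have h3 : c ≤ (1 + x) ^ (l + 1) * c := le_mul_of_one_le_left hc0 (one_le_pow₀ (by linarith))
      have h4 : (1 + x) ^ (l+1) * (η0 + ((l+1 : ℕ):ℝ) * c) = P + x * P + (1 + x) ^ (l+1) * c := by
        rw [hP]; push_cast; ring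
      have h5 : (((l.choose q + l.choose (q+1) : ℕ)):ℝ) * x ^ (q+1) * k ^ (s + 7 * J) =
          x * Z + (l.choose (q+1) : ℝ) * x ^ (q+1) * k ^ (s + 7 * J) := by
        rw [hZ]; push_cast; ring
      rw [h4, h5]
      linarith

/-- window length -/
noncomputable def th (k : ℝ) : ℝ := 1 / (2 * kp * (Real.exp 1 * k) ^ 7)

lemma th_pos {k : ℝ} (hk : 4 ≤ k) : 0 < th k := by
  have := kp_pos
  unfold th
  have : 0 < k := by linarith
  positivity

lemma window {k : ℝ} (hk : 4 ≤ k) (s : ℕ) {ε : ℝ} (hε : 0 < ε) : ∃ J : ℕ, ∃ η0 > 0, ∃ n1 : ℕ, ∀ n ≥ n1,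
    Bg n → ∀ t0 l : ℕ, Bd n t0 (s + 7 * J) η0 → (l:ℝ) ≤ th k * (n:ℝ)^2 →
    ((t0 + l : ℕ):ℝ) / (Ed n).card ≤ k * (1 / (n:ℝ)) ^ 2 → Bd n (t0 + l) s ε := by
  have hκ := kp_pos
  have hθ := th_pos hk
  have hk0 : (0:ℝ) < k := by linarith
  set θ := th k with hθd
  obtain ⟨J, hJ⟩ : ∃ J : ℕ, (Real.exp 1 * k) ^ s * (1/2 : ℝ) ^ J ≤ ε / 3 := by
    have hp : 0 < (Real.exp 1 * k) ^ s := by positivity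
    obtain ⟨J, hJ⟩ := exists_pow_lt_of_lt_one (show 0 < ε / 3 / (Real.exp 1 * k) ^ s by positivity)
      (show (1/2 : ℝ) < 1 by norm_num)
    refine ⟨J, ?_⟩
    rw [lt_div_iff₀ hp] at hJ
    linarith
  set E := Real.exp (θ * kp * (s + 7 * J)) with hE
  have hE0 : 0 < E := Real.exp_pos _
  set cm := ∑ i ∈ Finset.range (J+1), |Ec k (s + 7 * i)| with hcm
  have hcm0 : 0 ≤ cm := Finset.sum_nonneg fun _ _ => abs_nonneg _
  obtain ⟨n1, hn1⟩ := exists_nat_ge (3 * (E * θ * cm) / ε)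
  refine ⟨J, ε / (3 * E), by positivity, n1, fun n hn hB t0 l h0 hl ht => ?_⟩
  have hnp := hB.np
  set x := kp * (s + 7 * J) * (1 / (n:ℝ)) ^ 2 with hx
  have hx0 : 0 ≤ x := by positivity
  have hw := window_aux hB hk s J t0 (c := cm * (1 / (n:ℝ)) ^ 3) (x := x) (by positivity : 0 ≤ ε / (3 * E)) (by positivity)
    (fun i hi => by
      gcongr
      refine (le_abs_self _).trans ?_
      exact Finset.single_le_sum (f := fun i => |Ec k (s + 7 * i)|) (fun _ _ => abs_nonneg _)
        (Finset.mem_range.2 (by omega))) hx h0 l ht 0 (Nat.zero_le _)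
  refine Bd.mono hw ?_
  rw [Nat.sub_zero]
  have hlx : l * x ≤ θ * kp * (s + 7 * J) := by
    calc l * x ≤ (θ * (n:ℝ)^2) * x := by gcongr
      _ = _ := by rw [hx]; field_simp
  have b1 : (1 + x) ^ l ≤ E := by
    calc (1 + x) ^ l ≤ (Real.exp x) ^ l := by
          gcongr
          have := Real.add_one_le_exp x
          linarith
      _ = Real.exp (l * x) := by rw [← Real.exp_nat_mul]
      _ ≤ E := Real.exp_le_exp.2 hlx
  have b2 : (l:ℝ) * (cm * (1 / (n:ℝ)) ^ 3) ≤ ε / (3 * E) := by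
    have hn1' : 3 * (E * θ * cm) / ε ≤ n := hn1.trans (by exact_mod_cast hn)
    rw [div_le_iff₀ hε] at hn1'
    calc (l:ℝ) * (cm * (1 / (n:ℝ)) ^ 3) ≤ (θ * (n:ℝ)^2) * (cm * (1 / (n:ℝ)) ^ 3) := by gcongr
      _ = θ * cm / n := by field_simp
      _ ≤ ε / (3 * E) := by
        rw [div_le_div_iff₀ hnp (by positivity)]
        linarith
  have b3 : (l.choose J : ℝ) * x ^ J * k ^ (s + 7 * J) ≤ ε / 3 := by
    refine le_trans ?_ hJ
    have c1 : (l.choose J : ℝ) ≤ (l:ℝ) ^ J / J.factorial := Nat.choose_le_pow_div J l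
    have c2 : ((s + 7 * J : ℝ)) ^ J / J.factorial ≤ Real.exp (s + 7 * J) :=
      Real.pow_div_factorial_le_exp _ (by positivity) J
    have c3 : Real.exp (s + 7 * J) = Real.exp 1 ^ (s + 7 * J) := by
      rw [← Real.exp_nat_mul]; push_cast; ring_nf
    calc (l.choose J : ℝ) * x ^ J * k ^ (s + 7 * J)
        ≤ ((l:ℝ) ^ J / J.factorial) * x ^ J * k ^ (s + 7 * J) := by gcongr
      _ = (l * x) ^ J / J.factorial * k ^ (s + 7 * J) := by rw [mul_pow (l:ℝ) x J]; ring
      _ ≤ (θ * kp * (s + 7 * J)) ^ J / J.factorial * k ^ (s + 7 * J) := by gcongr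
      _ = (θ * kp) ^ J * ((s + 7 * J : ℝ) ^ J / J.factorial) * k ^ (s + 7 * J) := by rw [mul_pow]; ring
      _ ≤ (θ * kp) ^ J * (Real.exp 1 ^ (s + 7 * J)) * k ^ (s + 7 * J) := by
          rw [← c3]; gcongr
      _ = (Real.exp 1 * k) ^ s * (θ * kp * (Real.exp 1 * k) ^ 7) ^ J := by
          simp only [mul_pow, pow_add, ← pow_mul]; ring
      _ = (Real.exp 1 * k) ^ s * (1/2 : ℝ) ^ J := by
          congr 2
          rw [hθd, th]
          field_simp
  have b4 : (1 + x) ^ l * (ε / (3 * E) + l * (cm * (1 / (n:ℝ)) ^ 3)) ≤ 2 * ε / 3 := by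
    calc _ ≤ E * (ε / (3 * E) + ε / (3 * E)) := by gcongr
      _ = _ := by field_simp; norm_num
  linarith

lemma all_windows {k : ℝ} (hk : 4 ≤ k) (W : ℕ) : ∀ (s : ℕ) (ε : ℝ), 0 < ε → ∃ n0 : ℕ, ∀ n ≥ n0, Bg n ∧
    ∀ t : ℕ, t ≤ W * ⌊th k * (n:ℝ)^2⌋₊ → (t:ℝ) / (Ed n).card ≤ k * (1 / (n:ℝ)) ^ 2 → Bd n t s ε := by
  induction W with
  | zero =>
    intro s ε hε
    obtain ⟨n0, h0⟩ := exists_Bg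
    refine ⟨n0, fun n hn => ⟨h0 n hn, fun t ht _ => ?_⟩⟩
    have : t = 0 := by simpa using ht
    rw [this]
    exact (Bd_zero n s).mono hε.le
  | succ W ih =>
    intro s ε hε
    obtain ⟨J, η0, hη0, n1, hw⟩ := window hk s hε
    obtain ⟨n2, h2⟩ := ih (s + 7 * J) η0 hη0
    refine ⟨max n1 n2, fun n hn => ?_⟩
    obtain ⟨hB, h3⟩ := h2 n ((le_max_right _ _).trans hn)
    refine ⟨hB, fun t ht htN => ?_⟩
    set L := ⌊th k * (n:ℝ)^2⌋₊ with hL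
    have hL' : (L:ℝ) ≤ th k * (n:ℝ)^2 := Nat.floor_le (by have := th_pos hk; positivity)
    have hexp : (W + 1) * L = W * L + L := by ring
    rw [hexp] at ht
    obtain ⟨l, hl⟩ : ∃ l, t = min t (W * L) + l := ⟨t - min t (W * L), by omega⟩
    have hlL : l ≤ L := by omega
    have hle : min t (W * L) ≤ t := min_le_left _ _
    rw [hl]
    refine hw n ((le_max_left _ _).trans hn) hB _ l (h3 _ (min_le_right _ _) ?_) ?_ ?_
    · refine le_trans ?_ htN
      exact div_le_div_of_nonneg_right (Nat.cast_le.2 hle) (Nat.cast_nonneg _)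
    · refine le_trans ?_ hL'
      exact_mod_cast hlL
    · rw [← hl]; exact htN

end GRU


namespace GRU
open Finset

lemma Cls_single {n : ℕ} {e : Finset (Fin n)} (he : e ∈ Ed n) : Cls {e} ∅ := by
  refine ⟨by simpa using he, by simp, by simp, ?_, ?_⟩
  · intro T hT hne
    rw [Finset.union_empty] at hT
    have : T = {e} := (Finset.subset_singleton_iff.1 hT).resolve_left hne.ne_empty
    rw [this, un_singleton, mem_Ed.1 he]
    simp
  · intro T hT hb
    rw [Finset.union_empty] at hT
    have h1 := Finset.card_le_card hT
    have h2 := hb.1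
    simp at h1
    omega

lemma tt_single {n : ℕ} {e : Finset (Fin n)} (he : e ∈ Ed n) (t : ℕ) :
    tt t {e} ∅ = su n t ^ 6 * sg n t := by
  have : (pr {e}).card = 6 := by
    simp only [pr, Finset.singleton_biUnion, Finset.card_powersetCard, mem_Ed.1 he]
    decide
  simp [tt, tau, this]

lemma ex_card_succ {n : ℕ} (hN : 0 < (Ed n).card) (t : ℕ) :
    ex t (opL (fun M : Finset (Finset (Fin n)) => (M.card : ℝ))) =
      ex t (fun M : Finset (Finset (Fin n)) => (M.card : ℝ)) + 1 / NN n * ∑ e ∈ Ed n, p t {e} ∅ := by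
  have hN' : (0:ℝ) < (Ed n).card := by exact_mod_cast hN
  have : opL (fun M : Finset (Finset (Fin n)) => (M.card : ℝ)) =
      fun M => (M.card : ℝ) + 1 / NN n * ∑ e ∈ Ed n, ind {e} ∅ M := by
    funext M
    unfold opL NN
    have h1 : ∀ h ∈ Ed n, ((step M h).card : ℝ) = M.card + ind {h} ∅ M := by
      intro h hh
      unfold step ind
      by_cases hO : h ∈ Op M
      · have hM := (mem_Op.1 hO).2.1
        simp [hO, Finset.card_insert_of_notMem hM]
      · simp [hO]
    rw [Finset.sum_congr rfl h1, Finset.sum_add_distrib, Finset.sum_const, nsmul_eq_mul]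
    field_simp
  rw [this, ex_add, ex_smul, ex_sum']
  rfl

lemma ex_card_ge {n : ℕ} (hB : Bg n) {η : ℝ} (T : ℕ) (h : ∀ t < T, Bd n t 1 η) :
    NN n * sm n T - T * η ≤ ex T (fun M : Finset (Finset (Fin n)) => (M.card : ℝ)) := by
  have hN := hB.Np
  induction T with
  | zero => simp [sm_zero, ex]
  | succ T ih =>
    have ih' := ih fun t ht => h t (by omega)
    have hb := h T (by omega)
    rw [ex, ex_card_succ hB.Nc, sm_succ]
    have h1 : ∀ e ∈ Ed n, su n T ^ 6 * sg n T - η ≤ p T {e} ∅ := by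
      intro e he
      have := hb {e} ∅ (Cls_single he) (by simp)
      rw [tt_single he, abs_le] at this
      simp at this
      linarith
    have h2 := Finset.sum_le_sum h1
    rw [Finset.sum_const, nsmul_eq_mul] at h2
    change NN n * _ ≤ _ at h2
    have h3 : su n T ^ 6 * sg n T - η ≤ 1 / NN n * ∑ e ∈ Ed n, p T {e} ∅ := by
      rw [one_div, ← div_eq_inv_mul, le_div_iff₀ hN]; linarith
    have h4 : NN n * (sm n T + 1 / NN n * su n T ^ 6 * sg n T) = NN n * sm n T + su n T ^ 6 * sg n T := by
      field_simp
    rw [h4]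
    push_cast
    linarith

set_option maxHeartbeats 1000000 in
theorem exists_good {ε : ℝ} (hε : 0 < ε) (hε1 : ε < 1) : ∃ n0 : ℕ, ∀ n ≥ n0,
    ∃ M : Finset (Finset (Fin n)), (∀ m ∈ M, m.card = 4) ∧ Good M ∧ (1 - ε) * ((n:ℝ)^2 / 12) ≤ M.card := by
  have hc := c0_pos
  set z := (ε / 4) ^ 6 * Real.exp (-(8 * c0)) with hz
  have hz0 : 0 < z := by positivity
  have hz1 : z ≤ 1 := by
    have h1 : (ε / 4) ^ 6 ≤ 1 := pow_le_one₀ (by positivity) (by linarith)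
    have h2 : Real.exp (-(8 * c0)) ≤ 1 := Real.exp_le_one_iff.2 (by linarith)
    calc z ≤ 1 * 1 := by rw [hz]; gcongr
      _ = 1 := by norm_num
  set τ := 2 / z with hτ
  have hτ0 : 0 < τ := by positivity
  set k := max 4 (48 * τ) with hk
  have hk4 : 4 ≤ k := le_max_left _ _
  have hkτ : 48 * τ ≤ k := le_max_right _ _
  have hθ := th_pos hk4
  obtain ⟨W, hW⟩ := exists_nat_ge (2 * τ / th k)
  obtain ⟨n0, h0⟩ := all_windows hk4 W 1 (ε / (48 * τ)) (by positivity)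
  obtain ⟨n1, hn1⟩ := exists_nat_ge (4 / ε)
  obtain ⟨n2, hn2⟩ := exists_nat_ge (2 / th k)
  refine ⟨max n0 (max n1 n2), fun n hn => ?_⟩
  obtain ⟨hB, hbd⟩ := h0 n ((le_max_left _ _).trans hn)
  have hnn1 : n1 ≤ n := (le_max_left _ _).trans ((le_max_right _ _).trans hn)
  have hnn2 : n2 ≤ n := (le_max_right _ _).trans ((le_max_right _ _).trans hn)
  have hn4 : 4 / ε ≤ n := hn1.trans (by exact_mod_cast hnn1)
  have hnθ : 2 / th k ≤ n := hn2.trans (by exact_mod_cast hnn2)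
  rw [div_le_iff₀ hε] at hn4
  rw [div_le_iff₀ hθ] at hnθ
  have hnp := hB.np
  have hn1r : (1:ℝ) ≤ n := by exact_mod_cast hB.n1
  have hN := hB.Np
  have hD := hB.Dp
  set T := ⌈(n:ℝ)^2 / z⌉₊ with hT
  have hT1 : (n:ℝ)^2 / z ≤ T := Nat.le_ceil _
  have hT2 : (T:ℝ) ≤ τ * (n:ℝ)^2 := by
    have h1 := (Nat.ceil_lt_add_one (show 0 ≤ (n:ℝ)^2 / z by positivity)).le
    have h2 : 1 ≤ (n:ℝ)^2 / z := by
      rw [le_div_iff₀ hz0]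
      nlinarith
    calc (T:ℝ) ≤ (n:ℝ)^2 / z + 1 := h1
      _ ≤ (n:ℝ)^2 / z + (n:ℝ)^2 / z := by linarith
      _ = _ := by rw [hτ]; ring
  have hTW : T ≤ W * ⌊th k * (n:ℝ)^2⌋₊ := by
    have h1 : th k * (n:ℝ)^2 / 2 ≤ (⌊th k * (n:ℝ)^2⌋₊ : ℝ) := by
      have := (Nat.lt_floor_add_one (th k * (n:ℝ)^2)).le
      nlinarith
    have h2 : (T:ℝ) ≤ (W:ℝ) * (⌊th k * (n:ℝ)^2⌋₊ : ℝ) := by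
      calc (T:ℝ) ≤ τ * (n:ℝ)^2 := hT2
        _ = (2 * τ / th k) * (th k * (n:ℝ)^2 / 2) := by field_simp
        _ ≤ _ := by gcongr
    exact_mod_cast h2
  have hbd' : ∀ t < T, Bd n t 1 (ε / (48 * τ)) := by
    intro t ht
    refine hbd t (by omega) ?_
    have h1 : (t:ℝ) ≤ τ * (n:ℝ)^2 := le_trans (by exact_mod_cast ht.le) hT2
    calc (t:ℝ) / (Ed n).card = t * (1 / NN n) := by rw [NN]; ring
      _ ≤ (τ * (n:ℝ)^2) * (48 * (1 / (n:ℝ)) ^ 4) := by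
          gcongr
          exact hB.invN
      _ = (48 * τ) * (1 / (n:ℝ)) ^ 2 := by field_simp
      _ ≤ _ := by gcongr
  have hex := ex_card_ge hB T hbd'
  have hu : su n T ≤ ε / 4 := by
    apply su_small hB (by positivity)
    rw [← hz]
    rw [div_le_iff₀ hz0] at hT1
    exact hT1
  have hP : (n.choose 2 : ℝ) = (n:ℝ) * ((n:ℝ) - 1) / 2 := Nat.cast_choose_two ℝ n
  have hμ : NN n * sm n T = (n:ℝ) * ((n:ℝ) - 1) / 12 * (1 - su n T) := by
    have h1 := hB.hPD
    rw [hP] at h1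
    have h2 : DD n * sm n T = 1 - su n T := by rw [su]; ring
    rw [← h2]
    have : NN n = (n:ℝ) * ((n:ℝ) - 1) / 12 * DD n := by linarith
    rw [this]; ring
  have hTη : T * (ε / (48 * τ)) ≤ ε / 48 * (n:ℝ)^2 := by
    calc T * (ε / (48 * τ)) ≤ (τ * (n:ℝ)^2) * (ε / (48 * τ)) := by gcongr
      _ = _ := by field_simp
  have hmain : (n:ℝ)^2 / 12 * (1 - ε / 2) ≤ NN n * sm n T := by
    rw [hμ]
    have h1 : (n:ℝ)^2 * (1 - ε / 4) ≤ (n:ℝ) * ((n:ℝ) - 1) := by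
      have := mul_le_mul_of_nonneg_left hn4 hnp.le
      linarith [this, show (n:ℝ)^2 * (1 - ε / 4) = (n:ℝ)^2 - (n:ℝ) * ((n:ℝ) * ε) / 4 by ring,
        show (n:ℝ) * ((n:ℝ) - 1) = (n:ℝ)^2 - n by ring]
    calc (n:ℝ)^2 / 12 * (1 - ε / 2) ≤ (n:ℝ)^2 * (1 - ε / 4) / 12 * (1 - ε / 4) := by
          have h2 : 0 ≤ (n:ℝ)^2 * ε^2 := by positivity
          linarith [show (n:ℝ)^2 * (1 - ε / 4) / 12 * (1 - ε / 4) =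
            (n:ℝ)^2 / 12 * (1 - ε / 2) + (n:ℝ)^2 * ε^2 / 192 by ring]
      _ ≤ _ := by
          gcongr
          linarith
  have hlt : (1 - ε) * ((n:ℝ)^2 / 12) < ex T (fun M : Finset (Finset (Fin n)) => (M.card : ℝ)) := by
    have h0 : 0 < ε * (n:ℝ)^2 := by positivity
    have e1 : (n:ℝ)^2/12*(1-ε/2) = (n:ℝ)^2/12 - ε*(n:ℝ)^2/24 := by ring
    have e2 : (1-ε)*((n:ℝ)^2/12) = (n:ℝ)^2/12 - ε*(n:ℝ)^2/12 := by ring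
    have e3 : ε/48*(n:ℝ)^2 = ε*(n:ℝ)^2/48 := by ring
    rw [e2]; rw [e1] at hmain; rw [e3] at hTη; linarith
  obtain ⟨M, hM, hMc⟩ := exists_of_ex hB.Nc T hlt
  exact ⟨M, fun m hm => mem_Ed.1 (hM.1 hm), hM.2, hMc⟩

end GRU


theorem gr_final : Filter.Tendsto (fun n : ℕ => (GR n 18 146 : ℝ) / (n : ℝ) ^ 2) Filter.atTop
    (nhds ((5 : ℝ) / 12)) := by
  rw [Metric.tendsto_atTop]
  intro ε hε
  set δ := min ε (1/2) with hδ
  have hδ0 : 0 < δ := by positivity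
  have hδ1 : δ < 1 := lt_of_le_of_lt (min_le_right _ _) (by norm_num)
  have hδε : δ ≤ ε := min_le_left _ _
  obtain ⟨n0, h0⟩ := GRU.exists_good hδ0 hδ1
  obtain ⟨n1, hn1⟩ := exists_nat_ge (40 / ε)
  refine ⟨max (max n0 n1) 18, fun n hn => ?_⟩
  have hnn0 : n0 ≤ n := by omega
  have hnn1 : n1 ≤ n := by omega
  have hn18 : 18 ≤ n := by omega
  have hnr : (18:ℝ) ≤ n := by exact_mod_cast hn18
  have hne : 40 / ε ≤ n := hn1.trans (by exact_mod_cast hnn1)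
  rw [div_le_iff₀ hε] at hne
  obtain ⟨M, h4, hM, hMc⟩ := h0 n hnn0
  have hcol := GRU.coloring_of_good M h4 hM
  have hle : GR n 18 146 ≤ n.choose 2 - M.card + 1 := Nat.sInf_le hcol
  have hmem : HasPQColoring n 18 146 (GR n 18 146) :=
    Nat.sInf_mem (s := {c | HasPQColoring n 18 146 c}) ⟨_, hcol⟩
  have hlow := GRL.lower hn18 hmem
  have hP : (n.choose 2 : ℝ) = (n:ℝ) * ((n:ℝ) - 1) / 2 := Nat.cast_choose_two ℝ n
  have hlow' : 6 * (n.choose 2 : ℝ) ≤ 6 * (GR n 18 146 : ℝ) + (n.choose 2 + (90 * n + 24)) := by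
    exact_mod_cast hlow
  rw [hP] at hlow'
  have hn2 : 0 < (n:ℝ)^2 := by positivity
  have hk : 40 * (n:ℝ) ≤ ε * (n:ℝ)^2 := by nlinarith
  have hlo : 5/12 * (n:ℝ)^2 - ε * (n:ℝ)^2 < GR n 18 146 := by
    nlinarith
  have hhi : (GR n 18 146 : ℝ) < 5/12 * (n:ℝ)^2 + ε * (n:ℝ)^2 := by
    have hen : 0 < ε * (n:ℝ)^2 := by positivity
    rcases le_total M.card (n.choose 2) with h | h
    · have : (GR n 18 146 : ℝ) ≤ (n.choose 2 : ℝ) - M.card + 1 := by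
        have h2 : GR n 18 146 + M.card ≤ n.choose 2 + 1 := by omega
        have : (GR n 18 146 : ℝ) + M.card ≤ n.choose 2 + 1 := by exact_mod_cast h2
        linarith
      rw [hP] at this
      have h3 : δ * (n:ℝ)^2 ≤ ε * (n:ℝ)^2 := by gcongr
      linarith [show (1 - δ) * ((n:ℝ)^2/12) = (n:ℝ)^2/12 - δ * (n:ℝ)^2/12 by ring,
        show (n:ℝ) * ((n:ℝ) - 1) / 2 = (n:ℝ)^2/2 - n/2 by ring]
    · have h2 : GR n 18 146 ≤ 1 := by omega
      have h3 : (GR n 18 146 : ℝ) ≤ 1 := by exact_mod_cast h2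
      nlinarith
  rw [Real.dist_eq, abs_lt]
  constructor
  · have : 5/12 - ε < (GR n 18 146 : ℝ) / (n:ℝ)^2 := by
      rw [lt_div_iff₀ hn2]; linarith
    linarith
  · have : (GR n 18 146 : ℝ) / (n:ℝ)^2 < 5/12 + ε := by
      rw [div_lt_iff₀ hn2]; linarith
    linarith

/-- `GR(n,18,146)/n²` converges to `5/12`. -/
theorem generalized_ramsey_18_146 :
    Filter.Tendsto (fun n : ℕ => (GR n 18 146 : ℝ) / (n : ℝ) ^ 2)
      Filter.atTop (nhds ((5 : ℝ) / 12)) := by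
  exact gr_final
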